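/- arXiv:1908.09408 — 2 statements merged into one kernel-verified Lean document; each statement's English description precedes it below -/
import Mathlib

section
/- Let l ≥ n ≥ 1, let a ∈ ℝ^n have pairwise distinct nonzero entries, let x = diag(a_1,…,a_n,0,…,0) be the l×l Hermitian matrix with a on the first n diagonal entries and zeros elsewhere, let L ∈ {0,1}^n, and let s ∈ ℂ^n have pairwise distinct entries with Re(s_j − s_{j+1}) ≥ 1 for all j = 1,…,n (conventions s_{n+1} = −1, L_{n+1} = −1). Then N_{l,n}(s, L; x) = (∏_{j=1}^{n} (l−j)! Γ(s_j+1) / ((n−j)! Γ(s_j+l−n+1))) · (∏_{j=0}^{n−1} j!) · det[ sign(a_c)^{L_b} |a_c|^{s_b} ]_{b,c=1,…,n} / (Δ_n(a) Δ_n(s)), where Γ is the Gamma function. -/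
open MeasureTheory Matrix Finset Filter

noncomputable section

namespace RMT

instance matMS (l m : ℕ) : MeasurableSpace (Matrix (Fin l) (Fin m) ℂ) :=
  inferInstanceAs (MeasurableSpace (Fin l → Fin m → ℂ))

/-- The real part of the determinant of the leading principal `j × j` submatrix. -/
def pminor {l : ℕ} (y : Matrix (Fin l) (Fin l) ℂ) (j : ℕ) : ℝ :=
  (Matrix.det (Matrix.of fun p q : Fin (min j l) =>
    y (Fin.castLE (min_le_right j l) p) (Fin.castLE (min_le_right j l) q))).re

/-- `s_{j+1}` with the convention `s_{n+1} = -1` (0-based index `j`). -/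
def sNext (n : ℕ) (s : ℕ → ℂ) (j : ℕ) : ℂ := if j + 1 < n then s (j + 1) else -1

/-- `L_{j+1}` with the convention `L_{n+1} = -1` (0-based index `j`). -/
def LNext (n : ℕ) (L : ℕ → ℤ) (j : ℕ) : ℤ := if j + 1 < n then L (j + 1) else -1

/-- The integrand of the spherical function `N_{l,n}(s,L;·)`. -/
def sphProd (n : ℕ) (s : ℕ → ℂ) (L : ℕ → ℤ) {l : ℕ} (y : Matrix (Fin l) (Fin l) ℂ) : ℂ :=
  ∏ j ∈ Finset.range n,
    if pminor y (j + 1) = 0 then 0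
    else ((Real.sign (pminor y (j + 1)) : ℂ) ^ (L j - LNext n L j - 1)) *
      (((|pminor y (j + 1)| : ℝ) : ℂ) ^ (s j - sNext n s j - 1))

/-- The integrand of the normalization constant `C_{l,n}(s)`. -/
def absProd (n : ℕ) (s : ℕ → ℂ) {l : ℕ} (y : Matrix (Fin l) (Fin l) ℂ) : ℂ :=
  ∏ j ∈ Finset.range n,
    if pminor y (j + 1) = 0 then 0
    else (((|pminor y (j + 1)| : ℝ) : ℂ) ^ (s j - sNext n s j - 1))

/-- `μ` is the normalized Haar probability measure of `U(l)`, viewed as a measure on the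
space of `l × l` complex matrices: it is a probability measure, it is carried by the
unitary group, and it is invariant under left translation by every unitary matrix.
(These properties determine `μ` uniquely.) -/
def IsHaarUnitary (l : ℕ) (μ : Measure (Matrix (Fin l) (Fin l) ℂ)) : Prop :=
  IsProbabilityMeasure μ ∧ μ {A | A ∈ Matrix.unitaryGroup (Fin l) ℂ}ᶜ = 0 ∧
    ∀ U ∈ Matrix.unitaryGroup (Fin l) ℂ, μ.map (fun A => U * A) = μ

/-- `N_{l,n}(s, L; x)`. -/
def Nsph (l n : ℕ) (μ : Measure (Matrix (Fin l) (Fin l) ℂ)) (s : ℕ → ℂ) (L : ℕ → ℤ)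
    (x : Matrix (Fin l) (Fin l) ℂ) : ℂ :=
  ∫ k, sphProd n s L (k * x * kᴴ) ∂μ

/-- The l×l diagonal matrix with `n` ones followed by zeros. -/
def projMat (l n : ℕ) : Matrix (Fin l) (Fin l) ℂ :=
  Matrix.diagonal fun i => if (i : ℕ) < n then 1 else 0

/-- The normalization `C_{l,n}(s)`. -/
def Csph (l n : ℕ) (μ : Measure (Matrix (Fin l) (Fin l) ℂ)) (s : ℕ → ℂ) : ℂ :=
  ∫ k, absProd n s (k * projMat l n * kᴴ) ∂μ

/-- The spherical function `Φ_{l,n}(s,L;x) = N_{l,n}(s,L;x)/C_{l,n}(s)`. -/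
def Phi (l n : ℕ) (μ : Measure (Matrix (Fin l) (Fin l) ℂ)) (s : ℕ → ℂ) (L : ℕ → ℤ)
    (x : Matrix (Fin l) (Fin l) ℂ) : ℂ :=
  Nsph l n μ s L x / Csph l n μ s

/-- `L^{(n)} = ((n-1) mod 2, (n-2) mod 2, …, 1, 0)`. -/
def Lstd (n : ℕ) : ℕ → ℤ := fun j => ((n - 1 - j : ℕ) : ℤ) % 2

/-- The spherical function `Ψ(s; g) = Φ_{l,n}(s, L^{(n)}; g g*)` for `g` of rank `n`. -/
def Psi (l m n : ℕ) (μ : Measure (Matrix (Fin l) (Fin l) ℂ)) (s : ℕ → ℂ)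
    (g : Matrix (Fin l) (Fin m) ℂ) : ℂ :=
  Phi l n μ s (Lstd n) (g * gᴴ)

/-- The Vandermonde determinant `Δ_n(a) = ∏_{c>d} (a_c - a_d)` (complex version). -/
def VdmC (n : ℕ) (a : ℕ → ℂ) : ℂ := ∏ c ∈ Finset.range n, ∏ d ∈ Finset.range c, (a c - a d)

/-- The Vandermonde determinant `Δ_n(a) = ∏_{c>d} (a_c - a_d)` (real version). -/
def VdmR (n : ℕ) (a : ℕ → ℝ) : ℝ := ∏ c ∈ Finset.range n, ∏ d ∈ Finset.range c, (a c - a d)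

end RMT


namespace RMT

instance matBorel (l m : ℕ) : BorelSpace (Matrix (Fin l) (Fin m) ℂ) :=
  inferInstanceAs (BorelSpace (Fin l → Fin m → ℂ))

instance matSC (l m : ℕ) : SecondCountableTopology (Matrix (Fin l) (Fin m) ℂ) :=
  inferInstanceAs (SecondCountableTopology (Fin l → Fin m → ℂ))

lemma haar_ae_mem {l : ℕ} {μ : Measure (Matrix (Fin l) (Fin l) ℂ)} (hμ : IsHaarUnitary l μ) :
    ∀ᵐ k ∂μ, k ∈ Matrix.unitaryGroup (Fin l) ℂ := by
  rw [ae_iff]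
  exact hμ.2.1

lemma haar_left {l : ℕ} {μ : Measure (Matrix (Fin l) (Fin l) ℂ)} (hμ : IsHaarUnitary l μ)
    {U : Matrix (Fin l) (Fin l) ℂ} (hU : U ∈ Matrix.unitaryGroup (Fin l) ℂ) :
    MeasurePreserving (fun A => U * A) μ μ :=
  ⟨(by fun_prop : Continuous fun A : Matrix (Fin l) (Fin l) ℂ => U * A).measurable, hμ.2.2 U hU⟩

lemma lintegral_left {l : ℕ} {μ : Measure (Matrix (Fin l) (Fin l) ℂ)} (hμ : IsHaarUnitary l μ)
    {U : Matrix (Fin l) (Fin l) ℂ} (hU : U ∈ Matrix.unitaryGroup (Fin l) ℂ)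
    {f : Matrix (Fin l) (Fin l) ℂ → ENNReal} (hf : Measurable f) :
    ∫⁻ k, f (U * k) ∂μ = ∫⁻ k, f k ∂μ :=
  (haar_left hμ hU).lintegral_comp hf

lemma haar_star_lintegral {l : ℕ} {μ : Measure (Matrix (Fin l) (Fin l) ℂ)}
    (hμ : IsHaarUnitary l μ)
    {f : Matrix (Fin l) (Fin l) ℂ → ENNReal} (hf : Measurable f) :
    ∫⁻ k, f kᴴ ∂μ = ∫⁻ k, f k ∂μ := by
  have := hμ.1
  have mstar : Measurable fun A : Matrix (Fin l) (Fin l) ℂ => Aᴴ :=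
    (by fun_prop : Continuous fun A : Matrix (Fin l) (Fin l) ℂ => Aᴴ).measurable
  have mm : Measurable fun p : Matrix (Fin l) (Fin l) ℂ × Matrix (Fin l) (Fin l) ℂ =>
      f (p.2ᴴ * p.1) :=
    hf.comp (by fun_prop : Continuous fun p : Matrix (Fin l) (Fin l) ℂ × Matrix (Fin l) (Fin l) ℂ =>
      p.2ᴴ * p.1).measurable
  have h1 : ∫⁻ k, ∫⁻ h, f (kᴴ * h) ∂μ ∂μ = ∫⁻ h, f h ∂μ := by
    have : ∀ᵐ k ∂μ, ∫⁻ h, f (kᴴ * h) ∂μ = ∫⁻ h, f h ∂μ := by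
      filter_upwards [haar_ae_mem hμ] with k hk
      exact lintegral_left hμ (Unitary.star_mem hk) hf
    rw [lintegral_congr_ae this]
    simp
  have h2 : ∫⁻ h, ∫⁻ k, f (kᴴ * h) ∂μ ∂μ = ∫⁻ k, f kᴴ ∂μ := by
    have : ∀ᵐ h ∂μ, ∫⁻ k, f (kᴴ * h) ∂μ = ∫⁻ k, f kᴴ ∂μ := by
      filter_upwards [haar_ae_mem hμ] with h hh
      have := lintegral_left hμ (Unitary.star_mem hh) (hf.comp mstar)
      simpa [Function.comp, Matrix.conjTranspose_mul, Matrix.star_eq_conjTranspose] using this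
    rw [lintegral_congr_ae this]
    simp
  rw [← h1, ← h2]
  exact lintegral_lintegral_swap (f := fun h k => f (kᴴ * h)) mm.aemeasurable

lemma haar_right {l : ℕ} {μ : Measure (Matrix (Fin l) (Fin l) ℂ)} (hμ : IsHaarUnitary l μ)
    {U : Matrix (Fin l) (Fin l) ℂ} (hU : U ∈ Matrix.unitaryGroup (Fin l) ℂ) :
    MeasurePreserving (fun A => A * U) μ μ := by
  have mr : Measurable fun A : Matrix (Fin l) (Fin l) ℂ => A * U :=
    (by fun_prop : Continuous fun A : Matrix (Fin l) (Fin l) ℂ => A * U).measurable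
  have mstar : Measurable fun A : Matrix (Fin l) (Fin l) ℂ => Aᴴ :=
    (by fun_prop : Continuous fun A : Matrix (Fin l) (Fin l) ℂ => Aᴴ).measurable
  refine ⟨mr, Measure.ext_of_lintegral _ fun f hf => ?_⟩
  rw [lintegral_map hf mr]
  refine (haar_star_lintegral hμ (hf.comp mr)).symm.trans ?_
  have := lintegral_left hμ (Unitary.star_mem hU) (hf.comp mstar)
  simp only [Function.comp, Matrix.conjTranspose_mul, Matrix.star_eq_conjTranspose,
    Matrix.conjTranspose_conjTranspose] at this ⊢
  rw [this]
  exact haar_star_lintegral hμ hf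

lemma unitary_isCompact (l : ℕ) :
    IsCompact {A : Matrix (Fin l) (Fin l) ℂ | A ∈ Matrix.unitaryGroup (Fin l) ℂ} := by
  have hc : IsClosed {A : Matrix (Fin l) (Fin l) ℂ | A ∈ Matrix.unitaryGroup (Fin l) ℂ} := by
    simp only [Matrix.mem_unitaryGroup_iff, Matrix.star_eq_conjTranspose]
    exact isClosed_eq (by fun_prop) (by fun_prop)
  have hK : IsCompact {A : Fin l → Fin l → ℂ | ∀ i, A i ∈ {v : Fin l → ℂ |
      ∀ j, v j ∈ Metric.closedBall (0:ℂ) 1}} :=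
    isCompact_pi_infinite fun _ => isCompact_pi_infinite fun _ => isCompact_closedBall _ _
  refine IsCompact.of_isClosed_subset (X := Matrix (Fin l) (Fin l) ℂ) hK hc ?_
  intro A hA i j
  simpa using entry_norm_bound_of_unitary hA i j

lemma exists_haar (l : ℕ) : ∃ μ : Measure (Matrix (Fin l) (Fin l) ℂ), IsHaarUnitary l μ := by
  let G := Matrix.unitaryGroup (Fin l) ℂ
  let _ : MeasurableSpace G := borel G
  have : BorelSpace G := ⟨rfl⟩
  have : CompactSpace G := isCompact_iff_compactSpace.mp (unitary_isCompact l)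
  let K : TopologicalSpace.PositiveCompacts G := ⟨⊤, by simp⟩
  let ν : Measure G := Measure.haarMeasure K
  have hν : IsProbabilityMeasure ν := ⟨by
    have := Measure.haarMeasure_self (K₀ := K)
    simpa [K] using this⟩
  have mval : Measurable (Subtype.val : G → Matrix (Fin l) (Fin l) ℂ) :=
    continuous_subtype_val.measurable
  have hms : MeasurableSet {A : Matrix (Fin l) (Fin l) ℂ | A ∈ Matrix.unitaryGroup (Fin l) ℂ} :=
    (unitary_isCompact l).isClosed.measurableSet
  refine ⟨ν.map Subtype.val, Measure.isProbabilityMeasure_map mval.aemeasurable, ?_, ?_⟩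
  · rw [Measure.map_apply mval hms.compl]
    convert measure_empty (μ := ν)
    ext x
    simp
  · intro U hU
    have m1 : Measurable fun A : Matrix (Fin l) (Fin l) ℂ => U * A :=
      (by fun_prop : Continuous fun A : Matrix (Fin l) (Fin l) ℂ => U * A).measurable
    rw [Measure.map_map m1 mval]
    have h2 : ((fun A => U * A) ∘ (Subtype.val : G → Matrix (Fin l) (Fin l) ℂ)) =
        Subtype.val ∘ (fun A : G => (⟨U, hU⟩ : G) * A) := by
      ext x; simp
    rw [h2, ← Measure.map_map mval (continuous_const_mul _).measurable]
    congr 1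
    exact map_mul_left_eq_self ν _

/-- Hermitian matrices with equal characteristic polynomials are unitarily conjugate. -/
lemma exists_conj {n : ℕ} {A B : Matrix (Fin n) (Fin n) ℂ} (hA : A.IsHermitian)
    (hB : B.IsHermitian) (h : A.charpoly = B.charpoly) :
    ∃ U ∈ Matrix.unitaryGroup (Fin n) ℂ, A = U * B * Uᴴ := by
  have he := (Matrix.IsHermitian.eigenvalues_eq_eigenvalues_iff hA hB).2 h
  have h1 := hA.spectral_theorem
  have h2 := Matrix.IsHermitian.conjStarAlgAut_star_eigenvectorUnitary hB
  rw [he, ← h2] at h1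
  refine ⟨(hA.eigenvectorUnitary * star hB.eigenvectorUnitary : Matrix.unitaryGroup (Fin n) ℂ),
    Subtype.property _, ?_⟩
  conv_lhs => rw [h1]
  simp [Unitary.conjStarAlgAut_apply, Matrix.mul_assoc, Matrix.star_eq_conjTranspose]

lemma integral_conj {n : ℕ} {μ : Measure (Matrix (Fin n) (Fin n) ℂ)} (hμ : IsHaarUnitary n μ)
    {A B : Matrix (Fin n) (Fin n) ℂ} (hA : A.IsHermitian)
    (hB : B.IsHermitian) (h : A.charpoly = B.charpoly)
    {F : Matrix (Fin n) (Fin n) ℂ → ℂ} (hF : Measurable F) :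
    ∫ k, F (k * A * kᴴ) ∂μ = ∫ k, F (k * B * kᴴ) ∂μ := by
  obtain ⟨U, hU, rfl⟩ := exists_conj hA hB h
  have hm := haar_right hμ hU
  have hm2 : Measurable fun k : Matrix (Fin n) (Fin n) ℂ => F (k * B * kᴴ) :=
    hF.comp (by fun_prop : Continuous fun k : Matrix (Fin n) (Fin n) ℂ => k * B * kᴴ).measurable
  conv_rhs => rw [← hm.map_eq, integral_map hm.measurable.aemeasurable
    hm2.aestronglyMeasurable]
  simp [Matrix.mul_assoc, Matrix.conjTranspose_mul]

end RMT

namespace RMT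

/-- every nonzero vector is a positive multiple of the last row of some unitary matrix -/
lemma exists_unitary_row {m : ℕ} (g : Fin (m + 1) → ℂ) (hg : g ≠ 0) :
    ∃ h ∈ Matrix.unitaryGroup (Fin (m + 1)) ℂ, ∃ c : ℝ, 0 < c ∧
      ∀ i, g i = (c : ℂ) * h (Fin.last m) i := by
  let v : EuclideanSpace ℂ (Fin (m + 1)) := WithLp.toLp 2 g
  have hv : v ≠ 0 := by
    intro h
    apply hg
    have := congrArg (WithLp.ofLp) h
    simpa [v] using this
  have hnv : 0 < ‖v‖ := norm_pos_iff.2 hv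
  let u : EuclideanSpace ℂ (Fin (m + 1)) := ((‖v‖⁻¹ : ℝ) : ℂ) • v
  have hu : ‖u‖ = 1 := by
    simp only [u, norm_smul, Complex.norm_real, norm_inv, norm_norm]
    field_simp
  have ho : Orthonormal ℂ (Set.domRestrict ({Fin.last m} : Set (Fin (m + 1)))
      (fun _ => u)) := by
    constructor
    · intro i; simpa using hu
    · intro i j hij
      exact absurd (Subsingleton.elim i j) hij
  obtain ⟨b, hb⟩ := ho.exists_orthonormalBasis_extension_of_card_eq (by simp)
  have hb' := hb (Fin.last m) (by simp)
  refine ⟨Matrix.of fun i j => b i j, ?_, ‖v‖, hnv, ?_⟩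
  · rw [Matrix.mem_unitaryGroup_iff]
    ext i j
    have := orthonormal_iff_ite.1 b.orthonormal j i
    rw [PiLp.inner_apply] at this
    simp only [Matrix.mul_apply, Matrix.star_apply, Matrix.of_apply, Matrix.one_apply]
    simp only [eq_comm (a := i)]
    rw [← this]
    refine Finset.sum_congr rfl fun x _ => ?_
    simp
  · intro i
    simp only [Matrix.of_apply, hb', u]
    have hc : ((‖v‖ : ℝ) : ℂ) ≠ 0 := by exact_mod_cast hnv.ne'
    rw [PiLp.smul_apply, smul_eq_mul, ← mul_assoc, Complex.ofReal_inv, mul_inv_cancel₀ hc, one_mul]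

lemma unitary_volume {n : ℕ} {U : Matrix (Fin n) (Fin n) ℂ}
    (hU : U ∈ Matrix.unitaryGroup (Fin n) ℂ) :
    MeasurePreserving (fun g : Fin n → ℂ => g ᵥ* U) volume volume := by
  let f : (Fin n → ℂ) →ₗ[ℂ] (Fin n → ℂ) := Matrix.toLin' Uᵀ
  have hdet : ‖LinearMap.det f‖ = 1 := by
    simp only [f, LinearMap.det_toLin', Matrix.det_transpose]
    exact CStarRing.norm_of_mem_unitary (Matrix.det_of_mem_unitary hU)
  have hd2 : LinearMap.det (f.restrictScalars ℝ) = 1 := by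
    rw [LinearMap.det_restrictScalars, Algebra.norm_complex_eq]
    change Complex.normSq (LinearMap.det f) = 1
    rw [Complex.normSq_eq_norm_sq, hdet]
    norm_num
  have h1 := Measure.map_linearMap_addHaar_eq_smul_addHaar (volume : Measure (Fin n → ℂ))
    (f := f.restrictScalars ℝ) (by rw [hd2]; exact one_ne_zero)
  rw [hd2] at h1
  have h3 : (f.restrictScalars ℝ : (Fin n → ℂ) → (Fin n → ℂ)) = fun g => g ᵥ* U := by
    ext1 g
    simp [f, Matrix.mulVec_transpose]
  rw [h3] at h1
  refine ⟨(by fun_prop : Continuous fun g : Fin n → ℂ => g ᵥ* U).measurable, ?_⟩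
  rw [h1]
  simp

lemma map_normSq : (volume : Measure ℂ).map (fun z => ‖z‖ ^ 2) =
    ENNReal.ofReal Real.pi • (volume.restrict (Set.Ioi (0 : ℝ))) := by
  have mm : Measurable fun z : ℂ => ‖z‖ ^ 2 := by fun_prop
  refine Measure.ext_of_lintegral _ fun f hf => ?_
  rw [lintegral_map hf mm, lintegral_smul_measure, ← Complex.lintegral_comp_polarCoord_symm]
  have h0 : (fun x : ℝ => x ^ 2) '' Set.Ioi 0 = Set.Ioi 0 := by
    ext y
    simp only [Set.mem_image, Set.mem_Ioi]
    constructor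
    · rintro ⟨x, hx, rfl⟩; positivity
    · intro hy; exact ⟨√y, Real.sqrt_pos.2 hy, Real.sq_sqrt hy.le⟩
  have h1 : ∫⁻ u in Set.Ioi (0 : ℝ), f u =
      ∫⁻ r in Set.Ioi (0 : ℝ), ENNReal.ofReal |2 * r| * f (r ^ 2) := by
    conv_lhs => rw [← h0]
    refine lintegral_image_eq_lintegral_abs_deriv_mul measurableSet_Ioi
      (f := fun x : ℝ => x ^ 2) (f' := fun r => 2 * r) ?_ ?_ f
    · intro x _
      simpa using (hasDerivAt_pow 2 x).hasDerivWithinAt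
    · intro x hx y hy hxy
      simp only [Set.mem_Ioi] at hx hy
      exact (pow_left_inj₀ hx.le hy.le two_ne_zero).1 hxy
  rw [h1, polarCoord_target, Measure.volume_eq_prod, ← Measure.prod_restrict, lintegral_prod]
  · simp only [Complex.norm_polarCoord_symm, sq_abs, smul_eq_mul]
    simp only [lintegral_const, Measure.restrict_apply MeasurableSet.univ, Set.univ_inter,
      Real.volume_Ioo]
    rw [← lintegral_const_mul _ (by fun_prop)]
    refine setLIntegral_congr_fun measurableSet_Ioi fun r hr => ?_
    simp only [Set.mem_Ioi] at hr
    simp only [abs_of_pos (by positivity : (0:ℝ) < 2 * r)]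
    rw [← mul_assoc, ← ENNReal.ofReal_mul Real.pi_pos.le, mul_right_comm,
      ← ENNReal.ofReal_mul hr.le]
    congr 2
    ring
  · simp only [Complex.norm_polarCoord_symm, sq_abs, smul_eq_mul]
    fun_prop

/-- The positive orthant. -/
def orthant (n : ℕ) : Set (Fin n → ℝ) := {e | ∀ i, 0 < e i}

lemma orthant_eq (n : ℕ) : orthant n = Set.univ.pi fun _ => Set.Ioi (0 : ℝ) := by
  ext e; simp [orthant]

lemma measurableSet_orthant (n : ℕ) : MeasurableSet (orthant n) := by
  rw [orthant_eq]
  exact MeasurableSet.univ_pi fun _ => measurableSet_Ioi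

/-- Exponential weight. -/
def wt {n : ℕ} (e : Fin n → ℝ) : ENNReal := ENNReal.ofReal (Real.exp (-∑ i, e i))

lemma measurable_wt {n : ℕ} : Measurable (wt (n := n)) := by
  unfold wt; fun_prop

lemma lintegral_wt (n : ℕ) : ∫⁻ e in orthant n, wt e = 1 := by
  have hi : IntegrableOn (fun x : ℝ => Real.exp (-x)) (Set.Ioi 0) := by
    have := integrableOn_exp_neg_Ioi 0
    simpa using this
  have h0 : (volume : Measure (Fin n → ℝ)).restrict (orthant n) =
      Measure.pi fun _ => volume.restrict (Set.Ioi (0 : ℝ)) := by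
    rw [orthant_eq, volume_pi, Measure.restrict_pi_pi]
  have h1 : (fun e : Fin n → ℝ => Real.exp (-∑ i, e i)) = fun e => ∏ i, Real.exp (-e i) := by
    ext e; rw [← Finset.sum_neg_distrib, Real.exp_sum]
  unfold wt
  rw [h0, ← ofReal_integral_eq_lintegral_ofReal]
  · rw [h1, integral_fintype_prod_eq_prod (fun (_ : Fin n) (x : ℝ) => Real.exp (-x))]
    simp only [integral_exp_neg_Ioi_zero, Finset.prod_const_one, ENNReal.ofReal_one]
  · rw [h1]
    exact Integrable.fintype_prod (f := fun (_ : Fin n) (x : ℝ) => Real.exp (-x)) fun _ => hi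
  · exact Eventually.of_forall fun e => (Real.exp_pos _).le

lemma lintegral_normSq {n : ℕ} {f : (Fin n → ℝ) → ENNReal} (hf : Measurable f) :
    ∫⁻ g : Fin n → ℂ, f (fun i => ‖g i‖ ^ 2) =
      ENNReal.ofReal Real.pi ^ n * ∫⁻ e in orthant n, f e := by
  have mm : Measurable fun z : ℂ => ‖z‖ ^ 2 := by fun_prop
  have hsf : SigmaFinite ((volume : Measure ℂ).map (fun z => ‖z‖ ^ 2)) := by
    rw [map_normSq]
    have : (ENNReal.ofReal Real.pi • (volume.restrict (Set.Ioi (0 : ℝ)))) =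
      (Real.pi.toNNReal • (volume.restrict (Set.Ioi (0 : ℝ)))) := rfl
    rw [this]
    infer_instance
  have h := Measure.pi_map_pi (μ := fun _ : Fin n => (volume : Measure ℂ))
    (f := fun _ z => ‖z‖ ^ 2) (fun _ => mm.aemeasurable)
  have h2 : Measure.pi (fun _ : Fin n => (volume : Measure ℂ).map (fun z => ‖z‖ ^ 2)) =
      ENNReal.ofReal Real.pi ^ n • (volume.restrict (orthant n)) := by
    refine Measure.pi_eq fun s hs => ?_
    rw [orthant_eq, volume_pi, Measure.restrict_pi_pi, Measure.smul_apply, Measure.pi_pi,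
      map_normSq]
    simp only [Measure.smul_apply, smul_eq_mul, Finset.prod_mul_distrib]
    simp
  rw [h2] at h
  rw [← lintegral_map (f := f) (g := fun g : Fin n → ℂ => fun i => ‖g i‖ ^ 2) hf (by fun_prop),
    volume_pi, h, lintegral_smul_measure, smul_eq_mul]

lemma row_law {m : ℕ} {μ : Measure (Matrix (Fin (m + 1)) (Fin (m + 1)) ℂ)}
    (hμ : IsHaarUnitary (m + 1) μ) {f : (Fin (m + 1) → ℝ) → ENNReal} (hf : Measurable f)
    (hom : ∀ c : ℝ, 0 < c → ∀ w, f (fun i => c * w i) = f w) :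
    ∫⁻ k, f (fun i => ‖k (Fin.last m) i‖ ^ 2) ∂μ = ∫⁻ e in orthant (m + 1), f e * wt e := by
  have := hμ.1
  have hpi : ENNReal.ofReal Real.pi ^ (m + 1) ≠ 0 := by
    simp [Real.pi_pos]
  have hpi' : ENNReal.ofReal Real.pi ^ (m + 1) ≠ ⊤ := by
    simp
  have mrow : ∀ i, Measurable fun k : Matrix (Fin (m + 1)) (Fin (m + 1)) ℂ =>
      k (Fin.last m) i := fun i =>
    (by fun_prop : Continuous fun k : Matrix (Fin (m + 1)) (Fin (m + 1)) ℂ =>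
      k (Fin.last m) i).measurable
  have mf : Measurable fun k : Matrix (Fin (m + 1)) (Fin (m + 1)) ℂ =>
      f (fun i => ‖k (Fin.last m) i‖ ^ 2) := by
    refine hf.comp (measurable_pi_iff.2 fun i => ?_)
    exact (mrow i).norm.pow_const 2
  have key1 : ∀ g : Fin (m + 1) → ℂ, g ≠ 0 →
      ∫⁻ k, f (fun i => ‖(g ᵥ* k) i‖ ^ 2) ∂μ = ∫⁻ k, f (fun i => ‖k (Fin.last m) i‖ ^ 2) ∂μ := by
    intro g hg
    obtain ⟨h, hh, c, hc, hgc⟩ := exists_unitary_row g hg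
    rw [← lintegral_left hμ hh mf]
    refine lintegral_congr fun k => ?_
    rw [← hom (c ^ 2) (by positivity) (fun i => ‖(h * k) (Fin.last m) i‖ ^ 2)]
    congr 1
    ext i
    have : (g ᵥ* k) i = (c : ℂ) * (h * k) (Fin.last m) i := by
      simp only [Matrix.vecMul, dotProduct, Matrix.mul_apply, hgc, Finset.mul_sum, mul_assoc]
    rw [this, norm_mul, mul_pow, Complex.norm_real, Real.norm_eq_abs, sq_abs]
  have hae : ∀ᵐ g : Fin (m + 1) → ℂ, g ≠ 0 := by
    simp [ae_iff]
  have mwt : Measurable fun g : Fin (m + 1) → ℂ => wt (fun i => ‖g i‖ ^ 2) :=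
    measurable_wt.comp (by fun_prop)
  have cont : Continuous fun p : (Fin (m + 1) → ℂ) × Matrix (Fin (m + 1)) (Fin (m + 1)) ℂ =>
      p.1 ᵥ* p.2 := by fun_prop
  have mF : Measurable (Function.uncurry fun (g : Fin (m + 1) → ℂ)
      (k : Matrix (Fin (m + 1)) (Fin (m + 1)) ℂ) => f (fun i => ‖(g ᵥ* k) i‖ ^ 2)) := by
    refine hf.comp (measurable_pi_iff.2 fun i => ?_)
    exact (((continuous_apply i).comp cont).measurable).norm.pow_const 2
  have A : ∫⁻ g : Fin (m + 1) → ℂ, ∫⁻ k, f (fun i => ‖(g ᵥ* k) i‖ ^ 2) *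
      wt (fun i => ‖g i‖ ^ 2) ∂μ =
      (∫⁻ k, f (fun i => ‖k (Fin.last m) i‖ ^ 2) ∂μ) * ENNReal.ofReal Real.pi ^ (m + 1) := by
    have : ∀ᵐ g : Fin (m + 1) → ℂ, ∫⁻ k, f (fun i => ‖(g ᵥ* k) i‖ ^ 2) *
      wt (fun i => ‖g i‖ ^ 2) ∂μ =
      (∫⁻ k, f (fun i => ‖k (Fin.last m) i‖ ^ 2) ∂μ) * wt (fun i => ‖g i‖ ^ 2) := by
      filter_upwards [hae] with g hg
      have mg : Measurable fun k : Matrix (Fin (m + 1)) (Fin (m + 1)) ℂ =>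
          f (fun i => ‖(g ᵥ* k) i‖ ^ 2) := mF.of_uncurry_left
      rw [lintegral_mul_const _ mg, key1 g hg]
    rw [lintegral_congr_ae this, lintegral_const_mul _ mwt,
      lintegral_normSq (f := wt) measurable_wt, lintegral_wt, mul_one]
  have B : ∫⁻ k, (∫⁻ g : Fin (m + 1) → ℂ, f (fun i => ‖(g ᵥ* k) i‖ ^ 2) *
      wt (fun i => ‖g i‖ ^ 2)) ∂μ =
      ENNReal.ofReal Real.pi ^ (m + 1) * ∫⁻ e in orthant (m + 1), f e * wt e := by
    have : ∀ᵐ k ∂μ, ∫⁻ g : Fin (m + 1) → ℂ, f (fun i => ‖(g ᵥ* k) i‖ ^ 2) *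
      wt (fun i => ‖g i‖ ^ 2) =
      ENNReal.ofReal Real.pi ^ (m + 1) * ∫⁻ e in orthant (m + 1), f e * wt e := by
      filter_upwards [haar_ae_mem hμ] with k hk
      rw [← lintegral_normSq (f := fun e => f e * wt e) (hf.mul measurable_wt)]
      have h := (unitary_volume hk).lintegral_comp
        (f := fun g => f (fun i => ‖g i‖ ^ 2) * wt (fun i => ‖g i‖ ^ 2))
        ((hf.comp (by fun_prop)).mul mwt)
      rw [← h]
      refine lintegral_congr fun g => ?_
      congr 1
      unfold wt
      congr 3
      have e1 : ∀ v : Fin (m + 1) → ℂ, ((∑ i, ‖v i‖ ^ 2 : ℝ) : ℂ) = v ⬝ᵥ star v := by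
        intro v
        simp [dotProduct, Complex.mul_conj, Complex.normSq_eq_norm_sq]
      have : ((∑ i, ‖g i‖ ^ 2 : ℝ) : ℂ) = ((∑ i, ‖(g ᵥ* k) i‖ ^ 2 : ℝ) : ℂ) := by
        rw [e1, e1, Matrix.star_vecMul, Matrix.dotProduct_mulVec, Matrix.vecMul_vecMul]
        have hk' := (Matrix.mem_unitaryGroup_iff).1 hk
        rw [Matrix.star_eq_conjTranspose] at hk'
        rw [hk', Matrix.vecMul_one]
      exact_mod_cast this
    rw [lintegral_congr_ae this]
    simp
  have C := lintegral_lintegral_swap (μ := (volume : Measure (Fin (m + 1) → ℂ))) (ν := μ)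
    (f := fun g k => f (fun i => ‖(g ᵥ* k) i‖ ^ 2) * wt (fun i => ‖g i‖ ^ 2))
    (mF.mul (mwt.comp measurable_fst)).aemeasurable
  rw [A, B, mul_comm] at C
  exact (ENNReal.mul_right_inj hpi hpi').1 C

end RMT

namespace RMT

open Polynomial in
/-- `∑ w_i ∏_{j ≠ i} (X - a_j)`. -/
def qpoly {R : Type*} [CommRing R] {m : ℕ} (a w : Fin (m + 1) → R) : R[X] :=
  ∑ i, C (w i) * ∏ j : Fin m, (X - C (a (i.succAbove j)))

open Polynomial in
lemma corner_charpoly {m : ℕ} (a : Fin (m + 1) → ℂ)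
    {k : Matrix (Fin (m + 1)) (Fin (m + 1)) ℂ}
    (hk : k ∈ Matrix.unitaryGroup (Fin (m + 1)) ℂ) :
    ((k * Matrix.diagonal a * kᴴ).submatrix Fin.castSucc Fin.castSucc).charpoly =
      qpoly a (fun i => ((‖k (Fin.last m) i‖ ^ 2 : ℝ) : ℂ)) := by
  set K : Matrix (Fin (m + 1)) (Fin (m + 1)) ℂ[X] := k.map C with hK
  set K' : Matrix (Fin (m + 1)) (Fin (m + 1)) ℂ[X] := kᴴ.map C with hK'
  have hkk : k * kᴴ = 1 := by
    have := (Matrix.mem_unitaryGroup_iff).1 hk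
    rwa [Matrix.star_eq_conjTranspose] at this
  have hKK : K * K' = 1 := by
    rw [hK, hK', ← Matrix.map_mul, hkk]
    simp
  have hK'K : K' * K = 1 := mul_eq_one_comm.1 hKK
  have h1 : (k * Matrix.diagonal a * kᴴ).charmatrix = K * (Matrix.diagonal a).charmatrix * K' := by
    simp only [Matrix.charmatrix, Matrix.mul_sub, Matrix.sub_mul]
    congr 1
    · rw [← Matrix.scalar_commute _ (fun r => Commute.all _ _), Matrix.mul_assoc, hKK, mul_one]
    · simp [hK, hK', Matrix.map_mul]
  have hadj : K.adjugate = K.det • K' := by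
    calc K.adjugate = K.adjugate * (K * K') := by rw [hKK, mul_one]
      _ = K.det • K' := by rw [← Matrix.mul_assoc, Matrix.adjugate_mul]; simp
  have hadj' : K'.adjugate = K'.det • K := by
    calc K'.adjugate = K'.adjugate * (K' * K) := by rw [hK'K, mul_one]
      _ = K'.det • K := by rw [← Matrix.mul_assoc, Matrix.adjugate_mul]; simp
  have hdd : K.det * K'.det = 1 := by rw [← Matrix.det_mul, hKK, Matrix.det_one]
  have h2 : (k * Matrix.diagonal a * kᴴ).charmatrix.adjugate =
      K * (Matrix.diagonal a).charmatrix.adjugate * K' := by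
    rw [h1, Matrix.adjugate_mul_distrib, Matrix.adjugate_mul_distrib, hadj, hadj']
    simp only [Matrix.smul_mul, Matrix.mul_smul, smul_smul, ← Matrix.mul_assoc]
    rw [hdd, one_smul]
  have h3 : (k * Matrix.diagonal a * kᴴ).charmatrix.adjugate (Fin.last m) (Fin.last m) =
      ((k * Matrix.diagonal a * kᴴ).submatrix Fin.castSucc Fin.castSucc).charpoly := by
    rw [Matrix.adjugate_fin_succ_eq_det_submatrix, Matrix.charpoly]
    have : (-1 : ℂ[X]) ^ ((Fin.last m : Fin (m + 1)) + (Fin.last m : Fin (m + 1)) : ℕ) = 1 :=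
      Even.neg_one_pow ⟨_, rfl⟩
    rw [this, one_mul]
    congr 1
    ext1 i j
    simp [Matrix.charmatrix_apply, Matrix.diagonal_apply, Fin.succAbove_last]
  rw [← h3, h2]
  have h4 : (Matrix.diagonal a).charmatrix = Matrix.diagonal fun i => (X - C (a i)) := by
    ext1 i j
    by_cases h : i = j
    · subst h; simp
    · simp [h]
  rw [h4, Matrix.adjugate_diagonal, Matrix.mul_apply, qpoly]
  refine Finset.sum_congr rfl fun i _ => ?_
  rw [Matrix.mul_diagonal]
  have h5 : ∏ j ∈ univ.erase i, (X - C (a j)) = ∏ j : Fin m, (X - C (a (i.succAbove j))) := by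
    rw [← Finset.compl_singleton, ← Fin.image_succAbove_univ, Finset.prod_image]
    intro x _ y _ h
    exact Fin.succAbove_right_injective h
  rw [h5]
  simp only [hK, hK', Matrix.map_apply, Matrix.conjTranspose_apply]
  rw [mul_right_comm, ← C_mul]
  congr 2
  simp [Complex.mul_conj, Complex.normSq_eq_norm_sq]

end RMT

namespace RMT

section Interlace

open Polynomial

variable {m : ℕ}

lemma qpoly_eval (a w : Fin (m + 1) → ℝ) (i : Fin (m + 1)) :
    (qpoly a w).eval (a i) = w i * ∏ j : Fin m, (a i - a (i.succAbove j)) := by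
  rw [qpoly, Polynomial.eval_finsetSum, Finset.sum_eq_single i]
  · simp [Polynomial.eval_prod]
  · intro b _ hb
    rw [Polynomial.eval_mul, Polynomial.eval_prod]
    obtain ⟨z, hz⟩ := Fin.exists_succAbove_eq hb.symm
    rw [Finset.prod_eq_zero (Finset.mem_univ z), mul_zero]
    simp [hz]
  · simp

lemma monicprod_monic {R : Type*} [CommRing R] (b : Fin m → R) :
    (∏ j : Fin m, (X - C (b j))).Monic :=
  Polynomial.monic_prod_of_monic _ _ fun _ _ => Polynomial.monic_X_sub_C _

lemma monicprod_natDegree (b : Fin m → ℝ) :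
    (∏ j : Fin m, (X - C (b j))).natDegree = m := by
  rw [Polynomial.natDegree_prod_of_monic _ _ fun _ _ => Polynomial.monic_X_sub_C _]
  simp

lemma cprod_degree (t : ℝ) (b : Fin m → ℝ) :
    (C t * ∏ j : Fin m, (X - C (b j))).degree < ((m + 1 : ℕ) : WithBot ℕ) := by
  refine lt_of_le_of_lt (Polynomial.degree_mul_le _ _) ?_
  refine lt_of_le_of_lt (add_le_add Polynomial.degree_C_le Polynomial.degree_le_natDegree) ?_
  rw [monicprod_natDegree, zero_add]
  exact_mod_cast Nat.lt_succ_self m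

lemma cprod_coeff (t : ℝ) (b : Fin m → ℝ) :
    (C t * ∏ j : Fin m, (X - C (b j))).coeff m = t := by
  rw [Polynomial.coeff_C_mul]
  have h := monicprod_monic b
  rw [Polynomial.Monic, Polynomial.leadingCoeff, monicprod_natDegree] at h
  rw [h, mul_one]

lemma qpoly_degree (a w : Fin (m + 1) → ℝ) :
    (qpoly a w).degree < ((m + 1 : ℕ) : WithBot ℕ) := by
  rw [qpoly]
  refine lt_of_le_of_lt (Polynomial.degree_sum_le _ _) ?_
  rw [Finset.sup_lt_iff (WithBot.bot_lt_coe _)]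
  intro i _
  exact cprod_degree _ _

lemma qpoly_coeff (a w : Fin (m + 1) → ℝ) : (qpoly a w).coeff m = ∑ i, w i := by
  rw [qpoly, Polynomial.finsetSum_coeff]
  exact Finset.sum_congr rfl fun i _ => cprod_coeff _ _

/-- the interlacing parametrisation -/
def ilmap (a y : Fin (m + 1) → ℝ) (i : Fin (m + 1)) : ℝ :=
  y 0 * ∏ j : Fin m, ((a i - y j.succ) / (a i - a (i.succAbove j)))

/-- the interlacing domain -/
def ilset (a : Fin (m + 1) → ℝ) : Set (Fin (m + 1) → ℝ) :=
  {y | 0 < y 0 ∧ ∀ j : Fin m, a j.castSucc < y j.succ ∧ y j.succ < a j.succ}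

lemma Dne {a : Fin (m + 1) → ℝ} (ha : Function.Injective a) (i : Fin (m + 1)) (j : Fin m) :
    a i - a (i.succAbove j) ≠ 0 :=
  sub_ne_zero.2 fun h => Fin.succAbove_ne i j (ha h).symm

lemma ilmap_qpoly {a : Fin (m + 1) → ℝ} (ha : Function.Injective a) (y : Fin (m + 1) → ℝ) :
    qpoly a (ilmap a y) = C (y 0) * ∏ j : Fin m, (X - C (y j.succ)) := by
  refine Polynomial.eq_of_degrees_lt_of_eval_index_eq (s := (Finset.univ : Finset (Fin (m + 1))))
    (v := a) ha.injOn ?_ ?_ ?_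
  · simpa using qpoly_degree a (ilmap a y)
  · simpa using cprod_degree (y 0) (fun j => y j.succ)
  · intro i _
    rw [qpoly_eval, ilmap, Finset.prod_div_distrib, mul_assoc, div_mul_cancel₀]
    · simp [Polynomial.eval_prod]
    · exact Finset.prod_ne_zero_iff.2 fun j _ => Dne ha i j

lemma ilmap_sum {a : Fin (m + 1) → ℝ} (ha : Function.Injective a) (y : Fin (m + 1) → ℝ) :
    ∑ i, ilmap a y i = y 0 := by
  rw [← qpoly_coeff a, ilmap_qpoly ha, cprod_coeff]

lemma ilmap_pos {a : Fin (m + 1) → ℝ} (ha : StrictMono a) {y : Fin (m + 1) → ℝ}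
    (hy : y ∈ ilset a) : ilmap a y ∈ orthant (m + 1) := by
  intro i
  refine mul_pos hy.1 (Finset.prod_pos fun j _ => ?_)
  obtain ⟨h1, h2⟩ := hy.2 j
  rcases lt_or_ge j.castSucc i with h | h
  · rw [Fin.succAbove_of_castSucc_lt _ _ h]
    have : a j.succ ≤ a i := ha.monotone (Fin.castSucc_lt_iff_succ_le.1 h)
    apply div_pos <;> linarith
  · rw [Fin.succAbove_of_le_castSucc _ _ h]
    have : a i ≤ a j.castSucc := ha.monotone h
    apply div_pos_of_neg_of_neg <;> linarith

lemma ilset_disj {a : Fin (m + 1) → ℝ} (ha : StrictMono a) {y y' : Fin (m + 1) → ℝ}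
    (hy : y ∈ ilset a) (hy' : y' ∈ ilset a) {j k : Fin m} (hjk : j < k) :
    y j.succ < y' k.succ := by
  have : a j.succ ≤ a k.castSucc := ha.monotone (by
    rw [Fin.le_def]; simp; exact hjk)
  linarith [(hy.2 j).2, (hy'.2 k).1]

lemma ilmap_injOn {a : Fin (m + 1) → ℝ} (ha : StrictMono a) :
    Set.InjOn (ilmap a) (ilset a) := by
  intro y hy y' hy' h
  have h0 : y 0 = y' 0 := by rw [← ilmap_sum ha.injective y, h, ilmap_sum ha.injective]
  have hq := ilmap_qpoly ha.injective y
  rw [h, ilmap_qpoly ha.injective y', h0] at hq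
  have hq' := mul_left_cancel₀ (by simpa using hy'.1.ne') hq
  ext i
  refine Fin.cases h0 (fun j => ?_) i
  have h1 : (∏ k : Fin m, (X - C (y' k.succ))).eval (y j.succ) = 0 := by
    rw [hq', Polynomial.eval_prod]
    exact Finset.prod_eq_zero (Finset.mem_univ j) (by simp)
  rw [Polynomial.eval_prod, Finset.prod_eq_zero_iff] at h1
  obtain ⟨k, _, hk⟩ := h1
  simp [sub_eq_zero] at hk
  rcases lt_trichotomy j k with hjk | hjk | hjk
  · exact absurd hk (ilset_disj ha hy hy' hjk).ne
  · rw [hk, hjk]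
  · exact absurd hk (ilset_disj ha hy' hy hjk).ne'

lemma qpoly_sign {a : Fin (m + 1) → ℝ} (ha : StrictMono a) {e : Fin (m + 1) → ℝ}
    (he : e ∈ orthant (m + 1)) (j : Fin m) :
    (qpoly a e).eval (a j.castSucc) * (qpoly a e).eval (a j.succ) < 0 := by
  rw [qpoly_eval, qpoly_eval]
  have key : (∏ k : Fin m, (a j.castSucc - a (j.castSucc.succAbove k))) *
      (∏ k : Fin m, (a j.succ - a (j.succ.succAbove k))) < 0 := by
    rw [← Finset.prod_mul_distrib, ← Finset.mul_prod_erase _ _ (Finset.mem_univ j)]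
    have hj : a j.castSucc < a j.succ := ha Fin.castSucc_lt_succ
    refine mul_neg_of_neg_of_pos ?_ (Finset.prod_pos fun k hk => ?_)
    · rw [Fin.succAbove_castSucc_self, Fin.succAbove_succ_self]
      nlinarith
    · rcases lt_or_gt_of_ne (Finset.ne_of_mem_erase hk) with h | h
      · rw [Fin.succAbove_of_castSucc_lt _ _ (by simpa using h),
          Fin.succAbove_of_castSucc_lt _ _ (by rw [Fin.lt_def]; simp; omega)]
        have : a k.castSucc < a j.castSucc := ha (by simpa using h)
        apply mul_pos <;> linarith
      · rw [Fin.succAbove_of_le_castSucc _ _ (by simpa using h.le),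
          Fin.succAbove_of_le_castSucc _ _ (by rw [Fin.le_def]; simp; omega)]
        have : a j.succ < a k.succ := ha (by simpa using h)
        apply mul_pos_of_neg_of_neg <;> linarith
  have := mul_pos (he j.castSucc) (he j.succ)
  nlinarith

lemma ilmap_surj {a : Fin (m + 1) → ℝ} (ha : StrictMono a) {e : Fin (m + 1) → ℝ}
    (he : e ∈ orthant (m + 1)) : ∃ y ∈ ilset a, ilmap a y = e := by
  have h1 : ∀ j : Fin m, ∃ b, (a j.castSucc < b ∧ b < a j.succ) ∧ (qpoly a e).eval b = 0 := by
    intro j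
    have hj : a j.castSucc < a j.succ := ha Fin.castSucc_lt_succ
    have hc : ContinuousOn (fun x => (qpoly a e).eval x) (Set.Icc (a j.castSucc) (a j.succ)) :=
      (qpoly a e).continuous.continuousOn
    rcases mul_neg_iff.1 (qpoly_sign ha he j) with ⟨h, h'⟩ | ⟨h, h'⟩
    · obtain ⟨b, hb, hb'⟩ := intermediate_value_Ioo' hj.le hc ⟨h', h⟩
      exact ⟨b, hb, hb'⟩
    · obtain ⟨b, hb, hb'⟩ := intermediate_value_Ioo hj.le hc ⟨h, h'⟩
      exact ⟨b, hb, hb'⟩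
  choose b hb hb0 using h1
  set y : Fin (m + 1) → ℝ := Fin.cons (∑ i, e i) b with hy
  have hyS : y ∈ ilset a := by
    refine ⟨?_, fun j => ?_⟩
    · simp only [hy, Fin.cons_zero]
      exact Finset.sum_pos (fun i _ => he i) Finset.univ_nonempty
    · simpa [hy] using hb j
  refine ⟨y, hyS, ?_⟩
  have hinj : Function.Injective (fun j : Fin m => y j.succ) := by
    have : StrictMono (fun j : Fin m => y j.succ) := fun j k hjk => ilset_disj ha hyS hyS hjk
    exact this.injective
  have hP : qpoly a e = C (y 0) * ∏ j : Fin m, (X - C (y j.succ)) := by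
    refine Polynomial.eq_of_degree_sub_lt_of_eval_index_eq
      (s := (Finset.univ : Finset (Fin m))) (v := fun j => y j.succ) hinj.injOn ?_ ?_
    · rw [Polynomial.degree_lt_iff_coeff_zero]
      intro k hk
      rw [Finset.card_univ, Fintype.card_fin] at hk
      rcases hk.eq_or_lt with rfl | hk
      · rw [Polynomial.coeff_sub, qpoly_coeff, cprod_coeff (y 0) (fun j => y j.succ)]
        simp [hy]
      · have h2 := qpoly_degree a e
        have h3 := cprod_degree (y 0) (fun j => y j.succ)
        rw [Polynomial.degree_lt_iff_coeff_zero] at h2 h3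
        rw [Polynomial.coeff_sub, h2 k hk, h3 k hk, sub_zero]
    · intro j _
      rw [Polynomial.eval_mul, Polynomial.eval_prod,
        Finset.prod_eq_zero (Finset.mem_univ j) (by simp), mul_zero]
      simpa [hy] using hb0 j
  ext i
  have h2 : (qpoly a e).eval (a i) = _ := congrArg (Polynomial.eval (a i)) hP
  rw [← ilmap_qpoly ha.injective y, qpoly_eval, qpoly_eval] at h2
  exact (mul_right_cancel₀ (Finset.prod_ne_zero_iff.2 fun j _ => Dne ha.injective i j) h2).symm

end Interlace

end RMT

namespace RMT

section Jac

open Polynomial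

variable {m : ℕ}

/-- real Vandermonde product on `Fin n` -/
def vd {n : ℕ} (x : Fin n → ℝ) : ℝ := (Matrix.vandermonde x).det

lemma vd_ne {n : ℕ} {x : Fin n → ℝ} (hx : Function.Injective x) : vd x ≠ 0 :=
  Matrix.det_vandermonde_ne_zero_iff.2 hx

lemma prod_erase_abs {n : ℕ} (x : Fin n → ℝ) :
    ∏ i, ∏ j ∈ Finset.univ.erase i, |x i - x j| = |vd x| ^ 2 := by
  rw [vd, Matrix.det_vandermonde, Finset.abs_prod, sq]
  simp_rw [Finset.abs_prod]
  have h : ∀ i : Fin n, ∏ j ∈ Finset.univ.erase i, |x i - x j| =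
      (∏ j ∈ Finset.Ioi i, |x j - x i|) * ∏ j ∈ Finset.Iio i, |x i - x j| := by
    intro i
    have hu : Finset.univ.erase i = Finset.Ioi i ∪ Finset.Iio i := by
      ext j
      rw [Finset.mem_erase, Finset.mem_union, Finset.mem_Ioi, Finset.mem_Iio, ne_comm,
        ne_iff_lt_or_gt]
      simp
    rw [hu, Finset.prod_union]
    · congr 1
      exact Finset.prod_congr rfl fun j _ => abs_sub_comm _ _
    · rw [Finset.disjoint_left]
      intro j; simp; intro h; exact h.le
  simp_rw [h]
  rw [Finset.prod_mul_distrib]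
  congr 1
  rw [Finset.prod_comm' (t' := Finset.univ) (s' := fun j => Finset.Ioi j)]
  intro i j; simp

lemma prod_succAbove {R : Type*} [CommMonoid R] (f : Fin (m + 1) → R) (i : Fin (m + 1)) :
    ∏ j : Fin m, f (i.succAbove j) = ∏ j ∈ Finset.univ.erase i, f j := by
  rw [← Finset.compl_singleton, ← Fin.image_succAbove_univ, Finset.prod_image]
  intro x _ y _ h
  exact Fin.succAbove_right_injective h

/-- the polynomials `P, P_j` -/
def pk (b : Fin m → ℝ) : Fin (m + 1) → ℝ[X] :=
  Fin.cons (∏ j, (X - C (b j))) (fun j => ∏ k ∈ Finset.univ.erase j, (X - C (b k)))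

lemma pk_natDegree (b : Fin m → ℝ) (c : Fin (m + 1)) : (pk b c).natDegree < m + 1 := by
  refine Fin.cases ?_ (fun j => ?_) c
  · simp only [pk, Fin.cons_zero]
    rw [monicprod_natDegree]; exact Nat.lt_succ_self m
  · simp only [pk, Fin.cons_succ]
    rw [Polynomial.natDegree_prod_of_monic _ _ fun _ _ => Polynomial.monic_X_sub_C _]
    simp

lemma pk_eval_det (b : Fin m → ℝ) (x : Fin (m + 1) → ℝ) :
    (Matrix.of fun i c => (pk b c).eval (x i)).det =
      vd x * (Matrix.of fun (k c : Fin (m + 1)) => (pk b c).coeff k).det := by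
  rw [vd, ← Matrix.det_mul]
  congr 1
  ext i c
  rw [Matrix.mul_apply, Matrix.of_apply, Polynomial.eval_eq_sum_range' (pk_natDegree b c),
    Finset.sum_range]
  refine Finset.sum_congr rfl fun k _ => ?_
  simp [Matrix.vandermonde_apply, mul_comm]

lemma vd_cons (β : ℝ) (b : Fin m → ℝ) :
    vd (Fin.cons β b : Fin (m + 1) → ℝ) = (∏ j, (b j - β)) * vd b := by
  rw [vd, vd, Matrix.det_vandermonde, Matrix.det_vandermonde, Fin.prod_univ_succ]
  simp [Fin.prod_Ioi_succ]

lemma pk_coeff_det (b : Fin m → ℝ) (hb : Function.Injective b) :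
    |(Matrix.of fun (k c : Fin (m + 1)) => (pk b c).coeff k).det| = |vd b| := by
  obtain ⟨β, hβ⟩ : ∃ β : ℝ, ∀ j, b j ≠ β := by
    obtain ⟨β, hβ⟩ := Infinite.exists_notMem_finset (Finset.univ.image b)
    exact ⟨β, fun j h => hβ (by simp [← h])⟩
  have h1 := pk_eval_det b (Fin.cons β b)
  have h2 : (Matrix.of fun i c => (pk b c).eval ((Fin.cons β b : Fin (m + 1) → ℝ) i)).det =
      (∏ j, (β - b j)) * ∏ j, ∏ k ∈ Finset.univ.erase j, (b j - b k) := by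
    rw [Matrix.det_of_isUpperTriangular]
    · rw [Fin.prod_univ_succ]
      simp [pk, Polynomial.eval_prod]
    · intro i c hic
      simp only [id] at hic
      rcases Fin.eq_zero_or_eq_succ i with rfl | ⟨i, rfl⟩
      · exact absurd hic (by simp)
      rcases Fin.eq_zero_or_eq_succ c with rfl | ⟨c, rfl⟩
      · simp only [pk, Matrix.of_apply, Fin.cons_succ, Fin.cons_zero, Polynomial.eval_prod]
        exact Finset.prod_eq_zero (Finset.mem_univ i) (by simp)
      · simp only [pk, Matrix.of_apply, Fin.cons_succ, Polynomial.eval_prod]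
        refine Finset.prod_eq_zero (i := i) ?_ (by simp)
        simp only [Finset.mem_erase, Finset.mem_univ, and_true]
        rintro rfl
        exact lt_irrefl _ hic
  rw [h2, vd_cons] at h1
  have h3 := congrArg abs h1
  simp only [abs_mul, Finset.abs_prod] at h3
  rw [prod_erase_abs] at h3
  have h4 : ∏ j, |β - b j| = ∏ j, |b j - β| :=
    Finset.prod_congr rfl fun j _ => abs_sub_comm _ _
  have h5 : ∏ j, |b j - β| ≠ 0 :=
    Finset.prod_ne_zero_iff.2 fun j _ => abs_ne_zero.2 (sub_ne_zero.2 (hβ j))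
  have h6 : |vd b| ≠ 0 := abs_ne_zero.2 (vd_ne hb)
  rw [h4, mul_assoc] at h3
  have h7 := mul_left_cancel₀ h5 h3
  rw [sq] at h7
  exact (mul_left_cancel₀ h6 h7).symm

/-- Jacobian matrix -/
def jac (a y : Fin (m + 1) → ℝ) : Matrix (Fin (m + 1)) (Fin (m + 1)) ℝ :=
  Matrix.of fun i c => (∏ j, (a i - a (i.succAbove j)))⁻¹ *
    ((Fin.cons 1 (fun _ => - y 0) : Fin (m + 1) → ℝ) c *
      (pk (fun j => y j.succ) c).eval (a i))

lemma jac_det {a : Fin (m + 1) → ℝ} (ha : Function.Injective a) {y : Fin (m + 1) → ℝ}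
    (h0 : 0 < y 0) (hy : Function.Injective fun j : Fin m => y j.succ) :
    |(jac a y).det| = y 0 ^ m * |vd fun j : Fin m => y j.succ| / |vd a| := by
  have h1 : (jac a y).det = (∏ i, (∏ j, (a i - a (i.succAbove j)))⁻¹) *
      ((- y 0) ^ m * (vd a *
       (Matrix.of fun (k c : Fin (m + 1)) => (pk (fun j => y j.succ) c).coeff k).det)) := by
    rw [← pk_eval_det]
    unfold jac
    have := Matrix.det_mul_row (Fin.cons 1 (fun _ => - y 0) : Fin (m + 1) → ℝ)
      (Matrix.of fun i c => (pk (fun j => y j.succ) c).eval (a i))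
    have h' := Matrix.det_mul_column (fun i => (∏ j, (a i - a (i.succAbove j)))⁻¹)
      (Matrix.of fun i c => (Fin.cons 1 (fun _ => - y 0) : Fin (m + 1) → ℝ) c *
      (pk (fun j => y j.succ) c).eval (a i))
    simp only [Matrix.of_apply] at this h'
    rw [h', this, Fin.prod_univ_succ]
    simp
  rw [h1]
  simp only [abs_mul, abs_pow, abs_neg, abs_of_pos h0, Finset.abs_prod, abs_inv]
  rw [pk_coeff_det _ hy, Finset.prod_inv_distrib]
  have h2 : ∏ i, ∏ j, |a i - a (i.succAbove j)| = |vd a| ^ 2 := by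
    rw [← prod_erase_abs]
    exact Finset.prod_congr rfl fun i _ => prod_succAbove (fun j => |a i - a j|) i
  rw [h2]
  have h6 : |vd a| ≠ 0 := abs_ne_zero.2 (vd_ne ha)
  field_simp

lemma ilmap_hasFDerivAt {a : Fin (m + 1) → ℝ} (y : Fin (m + 1) → ℝ) :
    HasFDerivAt (ilmap a) (LinearMap.toContinuousLinearMap (Matrix.toLin' (jac a y))) y := by
  rw [hasFDerivAt_pi']
  intro i
  have hp : ∀ j : Fin (m + 1), HasFDerivAt (fun y : Fin (m + 1) → ℝ => y j)
      (ContinuousLinearMap.proj (R := ℝ) (φ := fun _ : Fin (m + 1) => ℝ) j) y :=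
    fun j => hasFDerivAt_apply j y
  have hprod := HasFDerivAt.finsetProd (u := (Finset.univ : Finset (Fin m)))
    (g := fun j (y : Fin (m + 1) → ℝ) => a i - y j.succ) (x := y)
    (fun j _ => (hp j.succ).const_sub (a i))
  have h := ((hp 0).mul hprod).mul_const ((∏ j, (a i - a (i.succAbove j)))⁻¹)
  have hf : (fun y => ilmap a y i) = fun y => (y 0 * ∏ j : Fin m, (a i - y j.succ)) *
      (∏ j, (a i - a (i.succAbove j)))⁻¹ := by
    ext y
    rw [ilmap, Finset.prod_div_distrib, div_eq_mul_inv, mul_assoc]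
  rw [hf]
  refine h.congr_fderiv ?_
  ext v
  simp [Matrix.mulVec, dotProduct, jac, Fin.sum_univ_succ, pk, Polynomial.eval_prod]
  rw [Finset.mul_sum, Finset.mul_sum, add_comm, ← mul_assoc]
  congr 2
  exact Finset.sum_congr rfl fun j _ => by ring

end Jac

end RMT

namespace RMT

section Step

variable {m : ℕ}

lemma row_normSq_sum {k : Matrix (Fin (m + 1)) (Fin (m + 1)) ℂ}
    (hk : k ∈ Matrix.unitaryGroup (Fin (m + 1)) ℂ) (i : Fin (m + 1)) :
    ∑ j, ‖k i j‖ ^ 2 = 1 := by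
  have h := congrFun (congrFun ((Matrix.mem_unitaryGroup_iff).1 hk) i) i
  rw [Matrix.star_eq_conjTranspose, Matrix.mul_apply, Matrix.one_apply_eq] at h
  have h2 : ((∑ j, ‖k i j‖ ^ 2 : ℝ) : ℂ) = 1 := by
    rw [← h]
    push_cast
    refine Finset.sum_congr rfl fun j _ => ?_
    rw [Matrix.conjTranspose_apply, ← starRingEnd_apply, Complex.mul_conj,
      Complex.normSq_eq_norm_sq]
    push_cast; rfl
  exact_mod_cast h2

lemma measurable_rowsq : Measurable fun k : Matrix (Fin (m + 1)) (Fin (m + 1)) ℂ =>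
    (fun i => ‖k (Fin.last m) i‖ ^ 2 : Fin (m + 1) → ℝ) :=
  (by fun_prop : Continuous fun k : Matrix (Fin (m + 1)) (Fin (m + 1)) ℂ =>
    (fun i => ‖k (Fin.last m) i‖ ^ 2 : Fin (m + 1) → ℝ)).measurable

lemma row_lawC {μ : Measure (Matrix (Fin (m + 1)) (Fin (m + 1)) ℂ)}
    (hμ : IsHaarUnitary (m + 1) μ) {f : (Fin (m + 1) → ℝ) → ℂ} (hf : Measurable f)
    (hom : ∀ c : ℝ, 0 < c → ∀ w, f (fun i => c * w i) = f w) :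
    ∫ k, f (fun i => ‖k (Fin.last m) i‖ ^ 2) ∂μ =
      ∫ e in orthant (m + 1), Real.exp (-∑ i, e i) • f e := by
  set p : (Fin (m + 1) → ℝ) → (Fin (m + 1) → ℝ) := fun e i => (∑ j, e j)⁻¹ * e i with hp
  have mp : Measurable p := by
    refine measurable_pi_iff.2 fun i => ?_
    exact (by fun_prop : Measurable fun e : Fin (m + 1) → ℝ => (∑ j, e j)⁻¹ * e i)
  have mpr : Measurable fun k : Matrix (Fin (m + 1)) (Fin (m + 1)) ℂ =>
      p (fun i => ‖k (Fin.last m) i‖ ^ 2) := mp.comp measurable_rowsq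
  have hfp : ∀ e : Fin (m + 1) → ℝ, 0 < ∑ j, e j → f (p e) = f e := fun e he =>
    hom _ (inv_pos.2 he) e
  have hM : μ.map (fun k => p (fun i => ‖k (Fin.last m) i‖ ^ 2)) =
      ((volume.restrict (orthant (m + 1))).withDensity wt).map p := by
    ext A hA
    have h := row_law hμ (f := fun e => A.indicator 1 (p e))
      ((measurable_one.indicator hA).comp mp) (by
        intro c hc w
        congr 1
        ext i
        simp only [hp, ← Finset.mul_sum]
        field_simp)
    rw [Measure.map_apply mpr hA, Measure.map_apply mp hA,
      withDensity_apply _ (mp hA)]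
    have e1 : ∀ k : Matrix (Fin (m + 1)) (Fin (m + 1)) ℂ,
        (A.indicator (1 : (Fin (m + 1) → ℝ) → ENNReal) (p fun i => ‖k (Fin.last m) i‖ ^ 2)) =
        ((fun k : Matrix (Fin (m + 1)) (Fin (m + 1)) ℂ =>
          p fun i => ‖k (Fin.last m) i‖ ^ 2) ⁻¹' A).indicator 1 k := fun k => rfl
    simp_rw [e1] at h
    rw [lintegral_indicator_one (mpr hA)] at h
    refine h.trans ?_
    rw [← lintegral_indicator (mp hA)]
    refine lintegral_congr fun e => ?_
    by_cases he : e ∈ p ⁻¹' A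
    · rw [Set.indicator_of_mem he, Set.indicator_of_mem (show p e ∈ A from he)]; simp
    · rw [Set.indicator_of_notMem he, Set.indicator_of_notMem (show p e ∉ A from he)]; simp
  have h1 : ∫ k, f (fun i => ‖k (Fin.last m) i‖ ^ 2) ∂μ =
      ∫ k, f (p (fun i => ‖k (Fin.last m) i‖ ^ 2)) ∂μ := by
    refine integral_congr_ae ?_
    filter_upwards [haar_ae_mem hμ] with k hk
    rw [hfp _ (by rw [row_normSq_sum hk]; exact one_pos)]
  have h2 : ∫ k, f (p (fun i => ‖k (Fin.last m) i‖ ^ 2)) ∂μ =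
      ∫ z, f z ∂(μ.map (fun k => p (fun i => ‖k (Fin.last m) i‖ ^ 2))) := by
    rw [integral_map mpr.aemeasurable hf.aestronglyMeasurable]
  rw [h1, h2, hM, integral_map mp.aemeasurable hf.aestronglyMeasurable,
    integral_withDensity_eq_integral_toReal_smul measurable_wt (by simp [wt])]
  refine setIntegral_congr_fun (measurableSet_orthant _) fun e he => ?_
  have : 0 < ∑ j, e j := Finset.sum_pos (fun i _ => he i) Finset.univ_nonempty
  simp only [hfp e this, wt]
  rw [ENNReal.toReal_ofReal (Real.exp_pos _).le]

lemma row_pos_ae {μ : Measure (Matrix (Fin (m + 1)) (Fin (m + 1)) ℂ)}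
    (hμ : IsHaarUnitary (m + 1) μ) :
    ∀ᵐ k ∂μ, (fun i => ‖k (Fin.last m) i‖ ^ 2) ∈ orthant (m + 1) := by
  have h := row_law hμ (f := (orthant (m + 1))ᶜ.indicator 1)
    (measurable_one.indicator (measurableSet_orthant _).compl) (by
      intro c hc w
      have : (fun i => c * w i) ∈ (orthant (m + 1))ᶜ ↔ w ∈ (orthant (m + 1))ᶜ := by
        simp [orthant, hc]
      by_cases hw : w ∈ (orthant (m + 1))ᶜ
      · rw [Set.indicator_of_mem hw, Set.indicator_of_mem (this.2 hw)]; rfl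
      · rw [Set.indicator_of_notMem hw, Set.indicator_of_notMem (fun h => hw (this.1 h))])
  have h2 : ∫⁻ e in orthant (m + 1), (orthant (m + 1))ᶜ.indicator 1 e * wt e = 0 := by
    rw [setLIntegral_congr_fun (g := fun _ => 0) (measurableSet_orthant _), lintegral_zero]
    intro e he
    simp [he]
  rw [h2] at h
  have mi : Measurable fun k : Matrix (Fin (m + 1)) (Fin (m + 1)) ℂ =>
      ((orthant (m + 1))ᶜ.indicator (1 : (Fin (m + 1) → ℝ) → ENNReal))
        (fun i => ‖k (Fin.last m) i‖ ^ 2) :=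
    (measurable_one.indicator (measurableSet_orthant _).compl).comp measurable_rowsq
  rw [lintegral_eq_zero_iff mi] at h
  filter_upwards [h] with k hk
  by_contra hc
  simp [Set.indicator_of_mem (show _ ∈ (orthant (m + 1))ᶜ from hc)] at hk

/-- box of interlacing points -/
def ilbox (a : Fin (m + 1) → ℝ) : Set (Fin m → ℝ) :=
  Set.univ.pi fun j => Set.Ioo (a j.castSucc) (a j.succ)

lemma ilset_eq (a : Fin (m + 1) → ℝ) : ilset a =
    (MeasurableEquiv.piFinSuccAbove (fun _ : Fin (m + 1) => ℝ) 0) ⁻¹' (Set.Ioi 0 ×ˢ ilbox a) := by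
  ext y
  simp [ilset, ilbox, MeasurableEquiv.piFinSuccAbove, Fin.tail, Fin.insertNthEquiv]

lemma measurableSet_ilbox (a : Fin (m + 1) → ℝ) : MeasurableSet (ilbox a) :=
  MeasurableSet.univ_pi fun _ => measurableSet_Ioo

lemma measurableSet_ilset (a : Fin (m + 1) → ℝ) : MeasurableSet (ilset a) := by
  rw [ilset_eq]
  exact (MeasurableEquiv.measurable _) (measurableSet_Ioi.prod (measurableSet_ilbox a))

lemma ilbox_mono {a : Fin (m + 1) → ℝ} (ha : StrictMono a) {b : Fin m → ℝ}
    (hb : b ∈ ilbox a) : StrictMono b := by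
  intro j k hjk
  have h := ilset_disj ha (y := Fin.cons 1 b) (y' := Fin.cons 1 b)
    ⟨by simp, fun j => by simpa using hb j (Set.mem_univ _)⟩
    ⟨by simp, fun j => by simpa using hb j (Set.mem_univ _)⟩ hjk
  simpa using h

lemma vd_pos {n : ℕ} {b : Fin n → ℝ} (hb : StrictMono b) : 0 < vd b := by
  rw [vd, Matrix.det_vandermonde]
  refine Finset.prod_pos fun i _ => Finset.prod_pos fun j hj => ?_
  exact sub_pos.2 (hb (Finset.mem_Ioi.1 hj))

lemma integral_pow_exp (m : ℕ) :
    ∫ t in Set.Ioi (0 : ℝ), ((t ^ m * Real.exp (-t) : ℝ) : ℂ) = (m.factorial : ℂ) := by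
  rw [integral_complex_ofReal]
  have h := Real.integral_rpow_mul_exp_neg_mul_Ioi (a := m + 1) (r := 1) (by positivity) one_pos
  rw [Real.Gamma_nat_eq_factorial] at h
  simp at h
  rw [h]; simp

open Polynomial in
lemma interlace_integral {μ : Measure (Matrix (Fin (m + 1)) (Fin (m + 1)) ℂ)}
    (hμ : IsHaarUnitary (m + 1) μ) {a : Fin (m + 1) → ℝ} (ha : StrictMono a)
    {h : (Fin m → ℝ) → ℂ} (hh : Measurable h)
    {T : Matrix (Fin (m + 1)) (Fin (m + 1)) ℂ → ℂ}
    (hT : ∀ k ∈ Matrix.unitaryGroup (Fin (m + 1)) ℂ, ∀ b ∈ ilbox a,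
      ((k * Matrix.diagonal (fun i => ((a i : ℝ) : ℂ)) * kᴴ).submatrix
        Fin.castSucc Fin.castSucc).charpoly = ∏ j, (X - C ((b j : ℝ) : ℂ)) → T k = h b) :
    ∫ k, T k ∂μ = ((m.factorial : ℂ) / (vd a : ℂ)) * ∫ b in ilbox a, (vd b : ℂ) * h b := by
  have hS := measurableSet_ilset a
  have hd : ∀ y ∈ ilset a, HasFDerivWithinAt (ilmap a)
      (LinearMap.toContinuousLinearMap (Matrix.toLin' (jac a y))) (ilset a) y :=
    fun y _ => (ilmap_hasFDerivAt y).hasFDerivWithinAt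
  have hemb := measurableEmbedding_of_fderivWithin hS hd (ilmap_injOn ha)
  obtain ⟨ψ, mψ, hψ⟩ := hemb.exists_measurable_extend (g := fun y : ilset a => (y : Fin (m + 1) → ℝ))
    measurable_subtype_coe (fun _ => inferInstance)
  have hψ' : ∀ y ∈ ilset a, ψ (ilmap a y) = y := fun y hy => congrFun hψ ⟨y, hy⟩
  have himg : ilmap a '' ilset a = orthant (m + 1) := by
    ext e
    constructor
    · rintro ⟨y, hy, rfl⟩; exact ilmap_pos ha hy
    · intro he; exact ilmap_surj ha he
  set R : (Fin (m + 1) → ℝ) → ℂ :=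
    (orthant (m + 1)).indicator (fun e => h (fun j => ψ e j.succ)) with hR
  have mR : Measurable R := by
    refine Measurable.indicator ?_ (measurableSet_orthant _)
    refine hh.comp (measurable_pi_iff.2 fun j => ?_)
    exact (measurable_pi_apply _).comp mψ
  have hRΦ : ∀ y ∈ ilset a, R (ilmap a y) = h (fun j => y j.succ) := by
    intro y hy
    rw [hR, Set.indicator_of_mem (ilmap_pos ha hy), hψ' y hy]
  have hom : ∀ c : ℝ, 0 < c → ∀ w, R (fun i => c * w i) = R w := by
    intro c hc w
    by_cases hw : w ∈ orthant (m + 1)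
    · obtain ⟨y, hy, rfl⟩ := ilmap_surj ha hw
      set y' : Fin (m + 1) → ℝ := Fin.cons (c * y 0) (fun j => y j.succ) with hy'
      have hy'S : y' ∈ ilset a := ⟨by simpa [hy'] using mul_pos hc hy.1, fun j => by
        simpa [hy'] using hy.2 j⟩
      have : (fun i => c * ilmap a y i) = ilmap a y' := by
        ext i
        simp [ilmap, hy', mul_assoc]
      rw [this, hRΦ y hy, hRΦ y' hy'S]
      simp [hy']
    · have hw' : (fun i => c * w i) ∉ orthant (m + 1) := by
        intro hc'; apply hw; intro i; exact (mul_pos_iff_of_pos_left hc).1 (hc' i)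
      rw [hR, Set.indicator_of_notMem hw, Set.indicator_of_notMem hw']
  have step1 : ∫ k, T k ∂μ = ∫ k, R (fun i => ‖k (Fin.last m) i‖ ^ 2) ∂μ := by
    refine integral_congr_ae ?_
    filter_upwards [haar_ae_mem hμ, row_pos_ae hμ] with k hk hpos
    obtain ⟨y, hy, hyw⟩ := ilmap_surj ha hpos
    rw [← hyw, hRΦ y hy]
    refine hT k hk _ (fun j _ => hy.2 j) ?_
    rw [corner_charpoly _ hk]
    have h0 : y 0 = 1 := by
      rw [← ilmap_sum ha.injective y, hyw, row_normSq_sum hk]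
    have h1 := ilmap_qpoly ha.injective y
    rw [hyw, h0] at h1
    have h2 := congrArg (Polynomial.map Complex.ofRealHom) h1
    simpa [qpoly, Polynomial.map_sum, Polynomial.map_prod, Polynomial.map_mul] using h2
  rw [step1, row_lawC hμ mR hom, ← himg,
    integral_image_eq_integral_abs_det_fderiv_smul volume hS hd (ilmap_injOn ha)]
  have step2 : ∫ y in ilset a, |(LinearMap.toContinuousLinearMap
      (Matrix.toLin' (jac a y))).det| • Real.exp (-∑ i, ilmap a y i) • R (ilmap a y) =
      ∫ y in ilset a, (fun z : ℝ × (Fin m → ℝ) => ((z.1 ^ m * Real.exp (-z.1) : ℝ) : ℂ) *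
        (((vd a)⁻¹ : ℂ) * ((vd z.2 : ℂ) * h z.2)))
        (MeasurableEquiv.piFinSuccAbove (fun _ : Fin (m + 1) => ℝ) 0 y) := by
    refine setIntegral_congr_fun hS fun y hy => ?_
    have hmono : StrictMono fun j : Fin m => y j.succ := fun j k hjk => ilset_disj ha hy hy hjk
    have hz : MeasurableEquiv.piFinSuccAbove (fun _ : Fin (m + 1) => ℝ) 0 y =
      (y 0, fun j => y j.succ) := by
      simp [MeasurableEquiv.piFinSuccAbove, Fin.insertNthEquiv]; rfl
    have hdet : (LinearMap.toContinuousLinearMap (Matrix.toLin' (jac a y))).det =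
        (jac a y).det := by
      rw [ContinuousLinearMap.det]; simp
    simp only [hz]
    rw [hdet, hRΦ y hy, jac_det ha.injective hy.1 hmono.injective, ilmap_sum ha.injective,
      abs_of_pos (vd_pos ha), abs_of_pos (vd_pos hmono)]
    simp only [Complex.real_smul]
    push_cast
    ring
  rw [step2, ilset_eq]
  refine (MeasurePreserving.setIntegral_preimage_emb (E := ℂ)
    (volume_preserving_piFinSuccAbove (fun _ : Fin (m + 1) => ℝ) 0)
    (MeasurableEquiv.measurableEmbedding _)
    (fun z : ℝ × (Fin m → ℝ) => ((z.1 ^ m * Real.exp (-z.1) : ℝ) : ℂ) *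
        (((vd a)⁻¹ : ℂ) * ((vd z.2 : ℂ) * h z.2))) (Set.Ioi 0 ×ˢ ilbox a)).trans ?_
  rw [Measure.volume_eq_prod, setIntegral_prod_mul
    (f := fun t : ℝ => ((t ^ m * Real.exp (-t) : ℝ) : ℂ))
    (g := fun b : Fin m → ℝ => (((vd a)⁻¹ : ℂ) * ((vd b : ℂ) * h b))), integral_pow_exp,
    integral_const_mul]
  ring

end Step

end RMT

namespace RMT

/-- signed power -/
def chi (L : ℤ) (w : ℂ) (p : ℝ) : ℂ := ((Real.sign p : ℝ) : ℂ) ^ L * ((|p| : ℝ) : ℂ) ^ w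

lemma chi_pos (L : ℤ) (w : ℂ) {p : ℝ} (hp : 0 < p) : chi L w p = (p : ℂ) ^ w := by
  simp [chi, Real.sign_of_pos hp, abs_of_pos hp]

lemma chi_neg (L : ℤ) (w : ℂ) {p : ℝ} (hp : p < 0) :
    chi L w p = (-1) ^ L * ((-p : ℝ) : ℂ) ^ w := by
  simp [chi, Real.sign_of_neg hp, abs_of_neg hp]

lemma chi_zero (L : ℤ) {w : ℂ} (hw : w ≠ 0) : chi L w 0 = 0 := by
  simp [chi, Complex.zero_cpow hw]

lemma chi_zero_zero {p : ℝ} : chi 0 0 p = 1 := by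
  simp [chi]

lemma measurable_sign : Measurable Real.sign := by
  have : Real.sign = fun r => if r < 0 then (-1 : ℝ) else if 0 < r then 1 else 0 := by
    ext r; rfl
  rw [this]
  exact Measurable.ite measurableSet_Iio measurable_const
    (Measurable.ite measurableSet_Ioi measurable_const measurable_const)

lemma measurable_chi (L : ℤ) (w : ℂ) : Measurable (chi L w) := by
  have h1 : Measurable fun p : ℝ => ((Real.sign p : ℝ) : ℂ) ^ L := by
    have : Measurable fun p : ℝ => Real.sign p ^ L := by
      rcases L with n | n
      · simpa using measurable_sign.pow_const n
      · simp only [zpow_negSucc]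
        exact (measurable_sign.pow_const (n + 1)).inv
    have h2 := Complex.measurable_ofReal.comp this
    have e : (fun p : ℝ => ((Real.sign p : ℝ) : ℂ) ^ L) =
        (Complex.ofReal ∘ fun p => Real.sign p ^ L) := by
      ext p; simp
    rw [e]; exact h2
  unfold chi
  exact h1.mul ((Complex.measurable_ofReal.comp measurable_norm).pow_const w)

lemma norm_sign_zpow {p : ℝ} (hp : p ≠ 0) (L : ℤ) : ‖((Real.sign p : ℝ) : ℂ) ^ L‖ = 1 := by
  rw [norm_zpow]
  rcases Real.sign_apply_eq_of_ne_zero p hp with h | h <;> simp [h]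

lemma norm_chi {p : ℝ} (hp : p ≠ 0) (L : ℤ) (w : ℂ) : ‖chi L w p‖ = |p| ^ w.re := by
  rw [chi, norm_mul, norm_sign_zpow hp, one_mul,
    Complex.norm_cpow_eq_rpow_re_of_pos (abs_pos.2 hp)]

lemma norm_chi_le {p M : ℝ} (hM : 1 ≤ M) (hp : |p| ≤ M) (L : ℤ) {w : ℂ} (hw : 0 ≤ w.re) :
    ‖chi L w p‖ ≤ M ^ w.re := by
  by_cases h : p = 0
  · subst h
    refine le_trans ?_ (Real.one_le_rpow hM hw)
    by_cases h1 : w = 0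
    · by_cases h2 : L = 0
      · simp [chi, h1, h2]
      · simp [chi, h1, _root_.zero_zpow _ h2]
    · simp [chi_zero L h1]
  · rw [norm_chi h]
    exact Real.rpow_le_rpow (abs_nonneg _) hp hw

lemma chi_mul (L : ℤ) (w : ℂ) {p q : ℝ} (hp : p ≠ 0) (hq : q ≠ 0) :
    chi L w (p * q) = chi L w p * chi L w q := by
  have hs : Real.sign (p * q) = Real.sign p * Real.sign q := by
    rcases lt_or_gt_of_ne hp with h | h <;> rcases lt_or_gt_of_ne hq with h' | h'
    · rw [Real.sign_of_neg h, Real.sign_of_neg h', Real.sign_of_pos (mul_pos_of_neg_of_neg h h')]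
      norm_num
    · rw [Real.sign_of_neg h, Real.sign_of_pos h', Real.sign_of_neg (mul_neg_of_neg_of_pos h h')]
      norm_num
    · rw [Real.sign_of_pos h, Real.sign_of_neg h', Real.sign_of_neg (mul_neg_of_pos_of_neg h h')]
      norm_num
    · rw [Real.sign_of_pos h, Real.sign_of_pos h', Real.sign_of_pos (mul_pos h h')]
      norm_num
  rw [chi, chi, chi, hs, abs_mul, Complex.ofReal_mul, Complex.ofReal_mul, mul_zpow,
    Complex.mul_cpow_ofReal_nonneg (abs_nonneg _) (abs_nonneg _)]
  ring

lemma chi_prod {ι : Type*} (S : Finset ι) (L : ℤ) (w : ℂ) (f : ι → ℝ) (hf : ∀ i ∈ S, f i ≠ 0) :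
    chi L w (∏ i ∈ S, f i) = ∏ i ∈ S, chi L w (f i) := by
  classical
  induction S using Finset.induction_on with
  | empty => simp [chi]
  | insert i S hi ih =>
    rw [Finset.prod_insert hi, Finset.prod_insert hi, chi_mul, ih]
    · exact fun j hj => hf j (Finset.mem_insert_of_mem hj)
    · exact hf i (Finset.mem_insert_self _ _)
    · exact Finset.prod_ne_zero_iff.2 fun j hj => hf j (Finset.mem_insert_of_mem hj)

lemma chi_add (L L' : ℤ) (w w' : ℂ) {p : ℝ} (hp : p ≠ 0) :
    chi L w p * chi L' w' p = chi (L + L') (w + w') p := by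
  have h1 : ((Real.sign p : ℝ) : ℂ) ≠ 0 := by
    rw [Ne, Complex.ofReal_eq_zero, Real.sign_eq_zero_iff]; exact hp
  have h2 : ((|p| : ℝ) : ℂ) ≠ 0 := by simpa using hp
  rw [chi, chi, chi, zpow_add₀ h1, Complex.cpow_add _ _ h2]
  ring

lemma chi_hasDerivAt (L : ℤ) {w : ℂ} (hw : w ≠ 0) {p : ℝ} (hp : p ≠ 0) :
    HasDerivAt (chi L w) (w * chi (L - 1) (w - 1) p) p := by
  rcases lt_or_gt_of_ne hp with h | h
  · have h1 : HasDerivAt (fun y : ℝ => (-1 : ℂ) ^ L * ((-y : ℝ) : ℂ) ^ w)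
        ((-1) ^ L * (-1 * (w * ((-p : ℝ) : ℂ) ^ (w - 1)))) p := by
      have h2 := (hasDerivAt_ofReal_cpow_const (x := -p) (by linarith) hw)
      have h3 := HasDerivAt.scomp p h2 (hasDerivAt_neg p)
      simp only [Complex.real_smul] at h3
      have h4 := h3.const_mul ((-1 : ℂ) ^ L)
      simpa using h4
    rw [chi_neg _ _ h]
    refine (h1.congr_of_eventuallyEq ?_).congr_deriv ?_
    · filter_upwards [gt_mem_nhds h] with y hy
      exact chi_neg _ _ hy
    · rw [zpow_sub_one₀ (by norm_num)]
      norm_num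
      ring
  · rw [chi_pos _ _ h]
    refine (hasDerivAt_ofReal_cpow_const h.ne' hw).congr_of_eventuallyEq ?_
    filter_upwards [lt_mem_nhds h] with y hy
    exact chi_pos _ _ hy

lemma continuous_chi (L : ℤ) {w : ℂ} (hw : 0 < w.re) : Continuous (chi L w) := by
  have hw0 : w ≠ 0 := by rintro rfl; simp at hw
  rw [continuous_iff_continuousAt]
  intro p
  by_cases hp : p = 0
  · subst hp
    rw [ContinuousAt, chi_zero L hw0]
    rw [tendsto_zero_iff_norm_tendsto_zero]
    have h1 : Tendsto (fun x : ℝ => |x| ^ w.re) (nhds 0) (nhds 0) := by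
      have : Continuous fun x : ℝ => |x| ^ w.re := by
        exact (continuous_abs).rpow_const fun x => Or.inr hw.le
      have h := this.tendsto 0
      simpa [Real.zero_rpow hw.ne'] using h
    refine squeeze_zero (fun _ => norm_nonneg _) (fun x => ?_) h1
    by_cases hx : x = 0
    · subst hx; rw [chi_zero L hw0]; simp [Real.zero_rpow hw.ne']
    · rw [norm_chi hx]
  · exact (chi_hasDerivAt L hw0 hp).continuousAt

lemma chi_integrableOn (L : ℤ) {w : ℂ} (hw : 0 ≤ w.re) (a b : ℝ) :
    IntegrableOn (chi L w) (Set.Ioc a b) := by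
  set M : ℝ := max 1 (max |a| |b|)
  refine Measure.integrableOn_of_bounded (M := M ^ w.re) (by simp)
    (measurable_chi L w).aestronglyMeasurable ?_
  refine (ae_restrict_iff' measurableSet_Ioc).2 (ae_of_all _ fun x hx => ?_)
  refine norm_chi_le (le_max_left _ _) ?_ L hw
  refine le_trans ?_ (le_max_right _ _)
  exact abs_le_max_abs_abs hx.1.le hx.2

lemma chi_integral (L : ℤ) {w : ℂ} (hw : 1 ≤ w.re) {a b : ℝ} (hab : a ≤ b) :
    ∫ x in Set.Ioo a b, chi (L - 1) (w - 1) x = (chi L w b - chi L w a) / w := by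
  have hw0 : w ≠ 0 := by rintro rfl; norm_num at hw
  have hi := chi_integrableOn (L - 1) (w := w - 1) (by simpa using hw) a b
  have h := integral_eq_of_hasDerivAt_off_countable_of_le (chi L w)
    (fun x => w * chi (L - 1) (w - 1) x) hab (s := {0}) (Set.countable_singleton 0)
    (continuous_chi L (by linarith)).continuousOn
    (fun x hx => chi_hasDerivAt L hw0 hx.2)
    ((intervalIntegrable_iff_integrableOn_Ioc_of_le hab).2 (hi.const_mul w))
  rw [intervalIntegral.integral_of_le hab, integral_Ioc_eq_integral_Ioo, integral_const_mul] at h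
  rw [← h]; field_simp

lemma det_integral {m : ℕ} (f : Fin m → ℝ → ℂ) (S : Fin m → Set ℝ)
    (hf : ∀ i j, IntegrableOn (f i) (S j)) :
    ∫ b in Set.univ.pi S, (Matrix.of fun i j => f i (b j)).det =
      (Matrix.of fun i j => ∫ x in S j, f i x).det := by
  rw [volume_pi, Measure.restrict_pi_pi]
  simp only [Matrix.det_apply', Matrix.of_apply]
  rw [integral_finsetSum]
  · refine Finset.sum_congr rfl fun σ _ => ?_
    rw [integral_const_mul, integral_fintype_prod_eq_prod (f := fun j x => f (σ j) x)]
  · intro σ _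
    refine Integrable.const_mul ?_ _
    exact Integrable.fintype_prod (f := fun j x => f (σ j) x) fun j => hf (σ j) j

lemma det_bordered {m : ℕ} (F : Fin m → ℝ → ℂ) (a : Fin (m + 1) → ℝ) :
    (Matrix.of fun i j : Fin m => F i (a j.succ) - F i (a j.castSucc)).det =
      (-1) ^ m * (Matrix.of fun (i j : Fin (m + 1)) =>
        (Fin.snoc (fun i => F i (a j)) 1 : Fin (m + 1) → ℂ) i).det := by
  set A : Matrix (Fin (m + 1)) (Fin (m + 1)) ℂ := Matrix.of fun (i j : Fin (m + 1)) =>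
        (Fin.snoc (fun i => F i (a j)) 1 : Fin (m + 1) → ℂ) i with hA
  set B : Matrix (Fin (m + 1)) (Fin (m + 1)) ℂ := Matrix.of fun i j =>
    (Fin.cons (A i 0) (fun j => A i j.succ - A i j.castSucc) : Fin (m + 1) → ℂ) j with hB
  have h1 : A.det = B.det := by
    refine Matrix.det_eq_of_forall_col_eq_smul_add_pred (fun _ => 1) ?_ ?_
    · intro i; simp [hB]
    · intro i j; simp [hB]
  rw [h1, Matrix.det_succ_row B (Fin.last m), Fin.sum_univ_succ]
  have h2 : ∀ j : Fin m, B (Fin.last m) j.succ = 0 := by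
    intro j; simp [hB, hA]
  have h3 : B (Fin.last m) 0 = 1 := by simp [hB, hA]
  simp only [h2, h3, mul_zero, zero_mul, Finset.sum_const_zero, add_zero, mul_one]
  rw [← mul_assoc, Fin.val_last, Fin.val_zero, add_zero, ← pow_add, Even.neg_one_pow ⟨m, rfl⟩,
    one_mul]
  congr 1
  ext i j
  simp [hB, hA, Fin.succAbove_last]

end RMT

namespace RMT

section Fub

variable {m : ℕ}

/-- corner of a matrix -/
def corner (Y : Matrix (Fin (m + 1)) (Fin (m + 1)) ℂ) : Matrix (Fin m) (Fin m) ℂ :=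
  Y.submatrix Fin.castSucc Fin.castSucc

/-- embed `U(m)` in `U(m+1)` -/
def emb (k : Matrix (Fin m) (Fin m) ℂ) : Matrix (Fin (m + 1)) (Fin (m + 1)) ℂ :=
  Matrix.reindex finSumFinEquiv finSumFinEquiv
    (Matrix.fromBlocks k 0 0 (1 : Matrix (Fin 1) (Fin 1) ℂ))

lemma emb_conjTranspose (k : Matrix (Fin m) (Fin m) ℂ) : (emb k)ᴴ = emb kᴴ := by
  rw [emb, emb, Matrix.conjTranspose_reindex, Matrix.fromBlocks_conjTranspose]
  simp

lemma emb_mul (k k' : Matrix (Fin m) (Fin m) ℂ) : emb k * emb k' = emb (k * k') := by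
  simp only [emb, Matrix.reindex_apply]
  rw [Matrix.submatrix_mul_equiv, Matrix.fromBlocks_multiply]
  simp

lemma emb_one : emb (1 : Matrix (Fin m) (Fin m) ℂ) = 1 := by
  simp only [emb, Matrix.reindex_apply, Matrix.fromBlocks_one]
  simp

lemma emb_unitary {k : Matrix (Fin m) (Fin m) ℂ} (hk : k ∈ Matrix.unitaryGroup (Fin m) ℂ) :
    emb k ∈ Matrix.unitaryGroup (Fin (m + 1)) ℂ := by
  rw [Matrix.mem_unitaryGroup_iff, Matrix.star_eq_conjTranspose] at *
  rw [emb_conjTranspose, emb_mul, hk, emb_one]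

lemma corner_reindex (M : Matrix (Fin m ⊕ Fin 1) (Fin m ⊕ Fin 1) ℂ) :
    corner (Matrix.reindex finSumFinEquiv finSumFinEquiv M) = M.toBlocks₁₁ := by
  ext i j
  have h : ∀ i : Fin m, finSumFinEquiv.symm (Fin.castSucc i) = (Sum.inl i : Fin m ⊕ Fin 1) := by
    intro i
    exact finSumFinEquiv_symm_apply_castAdd i
  simp [corner, Matrix.toBlocks₁₁, h]

lemma corner_emb (k : Matrix (Fin m) (Fin m) ℂ) (Y : Matrix (Fin (m + 1)) (Fin (m + 1)) ℂ) :
    corner (emb k * Y * (emb k)ᴴ) = k * corner Y * kᴴ := by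
  obtain ⟨M, rfl⟩ := (Matrix.reindex finSumFinEquiv finSumFinEquiv :
    Matrix (Fin m ⊕ Fin 1) (Fin m ⊕ Fin 1) ℂ ≃ _).surjective Y
  rw [corner_reindex, emb_conjTranspose]
  simp only [emb, Matrix.reindex_apply]
  rw [Matrix.submatrix_mul_equiv, Matrix.submatrix_mul_equiv, ← Matrix.reindex_apply,
    corner_reindex]
  conv_lhs => rw [← Matrix.fromBlocks_toBlocks M]
  simp [Matrix.fromBlocks_multiply]

lemma continuous_emb : Continuous (emb : Matrix (Fin m) (Fin m) ℂ → _) := by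
  unfold emb
  simp only [Matrix.reindex_apply]
  exact (Continuous.matrix_fromBlocks continuous_id continuous_const continuous_const
    continuous_const).matrix_submatrix _ _

lemma continuous_corner : Continuous (corner : Matrix (Fin (m + 1)) (Fin (m + 1)) ℂ → _) := by
  unfold corner
  exact continuous_id.matrix_submatrix _ _

lemma corner_fubini {μ : Measure (Matrix (Fin (m + 1)) (Fin (m + 1)) ℂ)}
    (hμ : IsHaarUnitary (m + 1) μ) {μ' : Measure (Matrix (Fin m) (Fin m) ℂ)}
    (hμ' : IsHaarUnitary m μ') {F : Matrix (Fin m) (Fin m) ℂ → ℂ} (mF : Measurable F)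
    (x : Matrix (Fin (m + 1)) (Fin (m + 1)) ℂ) (B : ℝ)
    (hB : ∀ k ∈ Matrix.unitaryGroup (Fin (m + 1)) ℂ, ‖F (corner (k * x * kᴴ))‖ ≤ B) :
    ∫ k, F (corner (k * x * kᴴ)) ∂μ =
      ∫ k, ∫ k', F (k' * corner (k * x * kᴴ) * k'ᴴ) ∂μ' ∂μ := by
  have := hμ.1
  have := hμ'.1
  have mT : Measurable fun k : Matrix (Fin (m + 1)) (Fin (m + 1)) ℂ =>
      F (corner (k * x * kᴴ)) :=
    mF.comp (continuous_corner.comp (by fun_prop :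
      Continuous fun k : Matrix (Fin (m + 1)) (Fin (m + 1)) ℂ => k * x * kᴴ)).measurable
  have key : ∀ (k' : Matrix (Fin m) (Fin m) ℂ) (k : Matrix (Fin (m + 1)) (Fin (m + 1)) ℂ),
      F (k' * corner (k * x * kᴴ) * k'ᴴ) = F (corner ((emb k' * k) * x * (emb k' * k)ᴴ)) := by
    intro k' k
    rw [← corner_emb, Matrix.conjTranspose_mul]
    simp only [Matrix.mul_assoc]
  have h1 : ∀ᵐ k' ∂μ', ∫ k, F (k' * corner (k * x * kᴴ) * k'ᴴ) ∂μ =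
      ∫ k, F (corner (k * x * kᴴ)) ∂μ := by
    filter_upwards [haar_ae_mem hμ'] with k' hk'
    simp only [key]
    have hp := haar_left hμ (emb_unitary hk')
    have h2 := integral_map (μ := μ) hp.measurable.aemeasurable
      (f := fun k => F (corner (k * x * kᴴ))) mT.aestronglyMeasurable
    rw [hp.map_eq] at h2
    exact h2.symm
  have h2 : ∫ k', ∫ k, F (k' * corner (k * x * kᴴ) * k'ᴴ) ∂μ ∂μ' =
      ∫ k, F (corner (k * x * kᴴ)) ∂μ := by
    rw [integral_congr_ae h1]; simp
  rw [← h2]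
  refine integral_integral_swap ?_
  refine Integrable.of_bound (C := B) ?_ ?_
  · refine Measurable.aestronglyMeasurable ?_
    refine mF.comp (Continuous.measurable ?_)
    have hc : Continuous fun p : Matrix (Fin m) (Fin m) ℂ × Matrix (Fin (m + 1)) (Fin (m + 1)) ℂ =>
      corner (p.2 * x * p.2ᴴ) := continuous_corner.comp (by fun_prop)
    exact (continuous_fst.matrix_mul hc).matrix_mul continuous_fst.matrix_conjTranspose
  · have hae : ∀ᵐ p ∂(μ'.prod μ), p.1 ∈ Matrix.unitaryGroup (Fin m) ℂ ∧
        p.2 ∈ Matrix.unitaryGroup (Fin (m + 1)) ℂ :=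
      ((Measure.quasiMeasurePreserving_fst (μ := μ') (ν := μ)).ae (haar_ae_mem hμ')).and
        ((Measure.quasiMeasurePreserving_snd (μ := μ') (ν := μ)).ae (haar_ae_mem hμ))
    filter_upwards [hae] with p hp
    simp only [Function.uncurry]
    rw [key]
    exact hB _ (mul_mem (emb_unitary hp.1) hp.2)

end Fub

section Minor

lemma pminor_eq {l : ℕ} (Y : Matrix (Fin l) (Fin l) ℂ) {j : ℕ} (h : j ≤ l) :
    pminor Y j = (Y.submatrix (Fin.castLE h) (Fin.castLE h)).det.re := by
  unfold pminor
  rw [← Matrix.det_submatrix_equiv_self (finCongr (min_eq_left h))]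
  rfl

lemma pminor_corner {m : ℕ} (Y : Matrix (Fin (m + 1)) (Fin (m + 1)) ℂ) {j : ℕ} (h : j ≤ m) :
    pminor (corner Y) j = pminor Y j := by
  rw [pminor_eq _ h, pminor_eq _ (h.trans (Nat.le_succ m))]
  rfl

lemma pminor_full {l : ℕ} (Y : Matrix (Fin l) (Fin l) ℂ) : pminor Y l = Y.det.re := by
  rw [pminor_eq Y le_rfl]
  rfl

lemma continuous_pminor {l : ℕ} (j : ℕ) :
    Continuous fun Y : Matrix (Fin l) (Fin l) ℂ => pminor Y j := by
  unfold pminor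
  refine Complex.continuous_re.comp (Continuous.matrix_det ?_)
  exact continuous_id.matrix_submatrix _ _

lemma pminor_bound {l : ℕ} (x : Matrix (Fin l) (Fin l) ℂ) (n : ℕ) :
    ∃ M : ℝ, 1 ≤ M ∧ ∀ k ∈ Matrix.unitaryGroup (Fin l) ℂ, ∀ j < n,
      |pminor (k * x * kᴴ) (j + 1)| ≤ M := by
  have h : ∀ j, ∃ M : ℝ, ∀ k ∈ Matrix.unitaryGroup (Fin l) ℂ,
      |pminor (k * x * kᴴ) (j + 1)| ≤ M := by
    intro j
    have hc : Continuous fun k : Matrix (Fin l) (Fin l) ℂ => pminor (k * x * kᴴ) (j + 1) :=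
      (continuous_pminor (j + 1)).comp (by fun_prop)
    obtain ⟨M, hM⟩ := (unitary_isCompact l).exists_bound_of_continuousOn hc.continuousOn
    exact ⟨M, fun k hk => hM k hk⟩
  choose M hM using h
  refine ⟨1 + ∑ j ∈ Finset.range n, |M j|, ?_, ?_⟩
  · have : 0 ≤ ∑ j ∈ Finset.range n, |M j| := Finset.sum_nonneg fun _ _ => abs_nonneg _
    linarith
  · intro k hk j hj
    have h1 := Finset.single_le_sum (f := fun j => |M j|) (fun _ _ => abs_nonneg _)
      (Finset.mem_range.2 hj)
    have h2 := hM j k hk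
    have h3 := le_abs_self (M j)
    linarith

/-- product of functions of minors -/
def prodG (g : ℕ → ℝ → ℂ) (n : ℕ) {l : ℕ} (Y : Matrix (Fin l) (Fin l) ℂ) : ℂ :=
  ∏ j ∈ Finset.range n, g j (pminor Y (j + 1))

lemma measurable_prodG {g : ℕ → ℝ → ℂ} {n : ℕ} (hg : ∀ j < n, Measurable (g j)) {l : ℕ} :
    Measurable fun Y : Matrix (Fin l) (Fin l) ℂ => prodG g n Y := by
  unfold prodG
  refine Finset.measurable_fun_prod _ fun j hj => ?_
  exact (hg j (Finset.mem_range.1 hj)).comp (continuous_pminor (j + 1)).measurable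

lemma prodG_bound {g : ℕ → ℝ → ℂ} {n : ℕ} {l : ℕ} (x : Matrix (Fin l) (Fin l) ℂ)
    (hg : ∀ j < n, ∀ M : ℝ, 1 ≤ M → ∃ B : ℝ, ∀ p, |p| ≤ M → ‖g j p‖ ≤ B) :
    ∃ B : ℝ, ∀ k ∈ Matrix.unitaryGroup (Fin l) ℂ, ‖prodG g n (k * x * kᴴ)‖ ≤ B := by
  obtain ⟨M, hM1, hM⟩ := pminor_bound x n
  choose! B hB using fun j hj => hg j hj M hM1
  refine ⟨∏ j ∈ Finset.range n, B j, fun k hk => ?_⟩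
  rw [prodG, norm_prod]
  refine Finset.prod_le_prod (fun _ _ => norm_nonneg _) fun j hj => ?_
  exact hB j (Finset.mem_range.1 hj) _ (hM k hk j (Finset.mem_range.1 hj))

lemma chi_like_bound {f : ℝ → ℂ} {L : ℤ} {w : ℂ} (hw : 0 ≤ w.re)
    (hf : ∀ p, p ≠ 0 → f p = chi L w p) (M : ℝ) (hM : 1 ≤ M) :
    ∃ B : ℝ, ∀ p, |p| ≤ M → ‖f p‖ ≤ B := by
  refine ⟨max (M ^ w.re) ‖f 0‖, fun p hp => ?_⟩
  by_cases h : p = 0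
  · subst h; exact le_max_right _ _
  · rw [hf p h]; exact (norm_chi_le hM hp L hw).trans (le_max_left _ _)

lemma det_conj_diag {l : ℕ} (a : Fin l → ℂ) {k : Matrix (Fin l) (Fin l) ℂ}
    (hk : k ∈ Matrix.unitaryGroup (Fin l) ℂ) :
    (k * Matrix.diagonal a * kᴴ).det = ∏ i, a i := by
  have h : k * kᴴ = 1 := by
    have := (Matrix.mem_unitaryGroup_iff).1 hk
    rwa [Matrix.star_eq_conjTranspose] at this
  have h2 := congrArg Matrix.det h
  rw [Matrix.det_mul, Matrix.det_one] at h2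
  rw [Matrix.det_mul, Matrix.det_mul, mul_right_comm, h2, one_mul, Matrix.det_diagonal]

end Minor

end RMT

namespace RMT

lemma sNext_shift {m j : ℕ} (hj : j < m) (s : ℕ → ℂ) :
    (s j - s m - 1) - sNext m (fun i => s i - s m - 1) j = s j - sNext (m + 1) s j := by
  unfold sNext
  rw [if_pos (by omega : j + 1 < m + 1)]
  split_ifs with h
  · ring
  · have : j + 1 = m := by omega
    rw [this]; ring

lemma LNext_shift {m j : ℕ} (hj : j < m) (L : ℕ → ℤ) :
    (L j - L m - 1) - LNext m (fun i => L i - L m - 1) j = L j - LNext (m + 1) L j := by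
  unfold LNext
  rw [if_pos (by omega : j + 1 < m + 1)]
  split_ifs with h
  · ring
  · have : j + 1 = m := by omega
    rw [this]; ring

lemma s_sep {n : ℕ} {s : ℕ → ℂ} (hs : ∀ j < n, 1 ≤ (s j - sNext n s j).re) {i j : ℕ}
    (hij : i < j) (hj : j < n) : 1 ≤ (s i - s j).re := by
  induction j, hij using Nat.le_induction with
  | base =>
    have := hs i (by omega)
    rwa [sNext, if_pos hj] at this
  | succ j hij ih =>
    have h1 := ih (by omega)
    have := hs j (by omega)
    rw [sNext, if_pos hj] at this
    simp only [Complex.sub_re] at *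
    linarith

lemma s_nonneg {n : ℕ} {s : ℕ → ℂ} (hs : ∀ j < n, 1 ≤ (s j - sNext n s j).re) {i : ℕ}
    (hi : i < n) : 0 ≤ (s i).re := by
  have h := hs (n - 1) (by omega)
  rw [sNext, if_neg (by omega)] at h
  simp at h
  rcases Nat.lt_or_ge i (n - 1) with h1 | h1
  · have := s_sep hs h1 (by omega)
    simp only [Complex.sub_re] at this
    linarith
  · have : i = n - 1 := by omega
    rw [this]; exact h

lemma VdmC_shift (m : ℕ) (s : ℕ → ℂ) (c : ℂ) : VdmC m (fun i => s i - c) = VdmC m s := by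
  unfold VdmC
  refine Finset.prod_congr rfl fun i _ => Finset.prod_congr rfl fun j _ => by ring

lemma VdmC_succ (m : ℕ) (s : ℕ → ℂ) :
    VdmC (m + 1) s = VdmC m s * ∏ d ∈ Finset.range m, (s m - s d) := by
  rw [VdmC, Finset.prod_range_succ]; rfl

lemma VdmC_ne {n : ℕ} {s : ℕ → ℂ} (h : ∀ i < n, ∀ j < n, i ≠ j → s i ≠ s j) : VdmC n s ≠ 0 := by
  refine Finset.prod_ne_zero_iff.2 fun c hc => Finset.prod_ne_zero_iff.2 fun d hd => ?_
  rw [Finset.mem_range] at hc hd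
  exact sub_ne_zero.2 (h c hc d (by omega) (by omega))

lemma diag_herm {n : ℕ} (a : Fin n → ℝ) :
    (Matrix.diagonal fun i => ((a i : ℝ) : ℂ)).IsHermitian := by
  rw [Matrix.IsHermitian, Matrix.diagonal_conjTranspose]
  congr 1; ext i; simp

lemma conj_herm {n : ℕ} {x : Matrix (Fin n) (Fin n) ℂ} (hx : x.IsHermitian)
    (k : Matrix (Fin n) (Fin n) ℂ) : (k * x * kᴴ).IsHermitian :=
  Matrix.isHermitian_mul_mul_conjTranspose k hx

lemma core_det {m : ℕ} {s : ℕ → ℂ} (L : ℕ → ℤ) {a : Fin (m + 1) → ℝ} (ha : StrictMono a)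
    (ha0 : ∀ i, a i ≠ 0) (hs : ∀ j < m + 1, 1 ≤ (s j - sNext (m + 1) s j).re) :
    (∏ i, chi (L m) (s m) (a i)) * (∫ b in ilbox a, (Matrix.of fun i j : Fin m =>
      chi (L i - L m - 1) (s i - s m - 1) (b j)).det) =
    (Matrix.of fun i j : Fin (m + 1) => chi (L i) (s i) (a j)).det /
      ∏ d ∈ Finset.range m, (s m - s d) := by
  have hsep : ∀ i : Fin m, 1 ≤ (s i - s m).re := fun i => s_sep hs i.2 (by omega)
  have hne : ∀ i : Fin m, s i - s m ≠ 0 := fun i h => by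
    have := hsep i; rw [h] at this; norm_num at this
  rw [ilbox, det_integral (fun i x => chi (L i - L m - 1) (s i - s m - 1) x)]
  swap
  · intro i j
    refine (chi_integrableOn _ ?_ _ _).mono_set Set.Ioo_subset_Ioc_self
    have := hsep i
    simp only [Complex.sub_re, Complex.one_re] at *
    linarith
  have h1 : (Matrix.of fun i j : Fin m => ∫ x in Set.Ioo (a j.castSucc) (a j.succ),
      chi (L i - L m - 1) (s i - s m - 1) x) = Matrix.of fun i j : Fin m =>
        (s i - s m)⁻¹ * (Matrix.of fun i j : Fin m => chi (L i - L m) (s i - s m) (a j.succ) -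
          chi (L i - L m) (s i - s m) (a j.castSucc)) i j := by
    ext i j
    simp only [Matrix.of_apply]
    rw [chi_integral _ (hsep i) (ha (Fin.castSucc_lt_succ)).le]
    rw [div_eq_inv_mul]
  rw [h1, Matrix.det_mul_column, det_bordered (fun i x => chi (L i - L m) (s i - s m) x)]
  have h2 : (Matrix.of fun i j : Fin (m + 1) => chi (L i) (s i) (a j)) =
      Matrix.of fun i j : Fin (m + 1) => chi (L m) (s m) (a j) *
       (Matrix.of fun (i j : Fin (m + 1)) =>
        (Fin.snoc (fun i : Fin m => chi (L i - L m) (s i - s m) (a j)) 1 : Fin (m + 1) → ℂ) i) i j := by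
    ext i j
    simp only [Matrix.of_apply]
    refine Fin.lastCases ?_ (fun i => ?_) i
    · simp
    · rw [Fin.snoc_castSucc, chi_add _ _ _ _ (ha0 j)]
      simp
  rw [h2, Matrix.det_mul_row]
  have h3 : ∏ d ∈ Finset.range m, (s m - s d) = (-1) ^ m * ∏ i : Fin m, (s i - s m) := by
    rw [Finset.prod_range (fun d => s m - s d)]
    have : ∀ i : Fin m, s m - s i = (-1) * (s i - s m) := fun i => by ring
    simp_rw [this]
    rw [Finset.prod_mul_distrib]; simp
  rw [h3, Finset.prod_inv_distrib]
  have h4 : ∏ i : Fin m, (s i - s m) ≠ 0 := Finset.prod_ne_zero_iff.2 fun i _ => hne i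
  have h5 : ((-1 : ℂ) ^ m) * (-1) ^ m = 1 := by rw [← mul_pow]; simp
  have h6 : ((-1 : ℂ) ^ m) ≠ 0 := by simp
  field_simp
  rw [sq, h5, mul_one]

theorem core (n : ℕ) : ∀ (g : ℕ → ℝ → ℂ) (L : ℕ → ℤ) (s : ℕ → ℂ) (a : Fin n → ℝ)
    (μ : Measure (Matrix (Fin n) (Fin n) ℂ)), IsHaarUnitary n μ → StrictMono a →
    (∀ i, a i ≠ 0) → (∀ j < n, 1 ≤ (s j - sNext n s j).re) → (∀ j < n, Measurable (g j)) →
    (∀ j < n, ∀ p, p ≠ 0 → g j p = chi (L j - LNext n L j - 1) (s j - sNext n s j - 1) p) →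
    ∫ k, prodG g n (k * Matrix.diagonal (fun i => ((a i : ℝ) : ℂ)) * kᴴ) ∂μ =
      (∏ j ∈ Finset.range n, (Nat.factorial j : ℂ)) *
        (Matrix.of fun b c : Fin n => chi (L b) (s b) (a c)).det / ((vd a : ℂ) * VdmC n s) := by
  induction n with
  | zero =>
    intro g L s a μ hμ _ _ _ _ _
    have := hμ.1
    simp [prodG, vd, VdmC]
  | succ m ih =>
    intro g L s a μ hμ ha ha0 hs hg hgc
    obtain ⟨μ', hμ'⟩ := exists_haar m
    have hP1 := hμ.1
    have hP2 := hμ'.1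
    have hmF : Measurable fun Y : Matrix (Fin m) (Fin m) ℂ => prodG g m Y :=
      measurable_prodG fun j hj => hg j (by omega)
    have hbd : ∀ j < m + 1, ∀ M : ℝ, 1 ≤ M → ∃ B : ℝ, ∀ p, |p| ≤ M → ‖g j p‖ ≤ B := by
      intro j hj M hM
      refine chi_like_bound ?_ (hgc j hj) M hM
      have := hs j hj
      simp only [Complex.sub_re, Complex.one_re] at *
      linarith
    have hcorner : ∀ Y : Matrix (Fin (m + 1)) (Fin (m + 1)) ℂ, prodG g m (corner Y) =
        prodG g m Y := by
      intro Y
      unfold prodG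
      refine Finset.prod_congr rfl fun j hj => ?_
      rw [pminor_corner Y (by rw [Finset.mem_range] at hj; omega)]
    set D := Matrix.diagonal (fun i => ((a i : ℝ) : ℂ)) with hD
    -- factor out the last minor
    have h1 : ∫ k, prodG g (m + 1) (k * D * kᴴ) ∂μ =
        (∏ i, chi (L m) (s m) (a i)) * ∫ k, prodG g m (corner (k * D * kᴴ)) ∂μ := by
      rw [← integral_const_mul]
      refine integral_congr_ae ?_
      filter_upwards [haar_ae_mem hμ] with k hk
      rw [hcorner, prodG, Finset.prod_range_succ, pminor_full, det_conj_diag _ hk,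
        ← Complex.ofReal_prod, Complex.ofReal_re, hgc m (by omega), mul_comm]
      · rw [LNext, sNext, if_neg (by omega), if_neg (by omega), sub_neg_eq_add, sub_neg_eq_add,
          add_sub_cancel_right, add_sub_cancel_right, chi_prod _ _ _ _ fun i _ => ha0 i]
        rfl
      · exact Finset.prod_ne_zero_iff.2 fun i _ => ha0 i
    obtain ⟨B, hB⟩ := prodG_bound (g := g) (n := m) D fun j hj => hbd j (by omega)
    have h2 := corner_fubini hμ hμ' hmF D B fun k hk => by rw [hcorner]; exact hB k hk
    set h : (Fin m → ℝ) → ℂ := fun b =>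
      ∫ k', prodG g m (k' * Matrix.diagonal (fun i => ((b i : ℝ) : ℂ)) * k'ᴴ) ∂μ' with hh
    have hhm : Measurable h := by
      have hc : Continuous fun p : (Fin m → ℝ) × Matrix (Fin m) (Fin m) ℂ =>
          p.2 * Matrix.diagonal (fun i => ((p.1 i : ℝ) : ℂ)) * p.2ᴴ := by
        fun_prop
      have := (hmF.comp hc.measurable).stronglyMeasurable.integral_prod_right' (ν := μ')
      exact this.measurable
    have h3 := interlace_integral hμ ha hhm
      (T := fun k => ∫ k', prodG g m (k' * corner (k * D * kᴴ) * k'ᴴ) ∂μ') (by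
        intro k hk b hb hcp
        refine integral_conj hμ' ?_ (diag_herm b) ?_ hmF
        · exact (conj_herm (diag_herm a) k).submatrix _
        · rw [Matrix.charpoly_diagonal]; exact hcp)
    have h4 : ∫ b in ilbox a, (vd b : ℂ) * h b = ((∏ j ∈ Finset.range m, (Nat.factorial j : ℂ)) /
        VdmC m s) * ∫ b in ilbox a, (Matrix.of fun i j : Fin m =>
          chi (L i - L m - 1) (s i - s m - 1) (b j)).det := by
      rw [← integral_const_mul]
      refine integral_congr_ae ?_
      have hae : ∀ᵐ b : Fin m → ℝ, ∀ j, b j ≠ 0 := by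
        rw [ae_all_iff]; intro j
        exact Measure.ae_eval_ne (μ := fun _ : Fin m => (volume : Measure ℝ)) j 0
      filter_upwards [ae_restrict_of_ae hae, ae_restrict_mem (measurableSet_ilbox a)] with b hb0 hb
      have hbm := ilbox_mono ha hb
      have := ih g (fun i => L i - L m - 1) (fun i => s i - s m - 1) b μ' hμ' hbm hb0
        (fun j hj => by rw [sNext_shift hj]; exact hs j (by omega))
        (fun j hj => hg j (by omega))
        (fun j hj p hp => by
          rw [sNext_shift hj, LNext_shift hj]; exact hgc j (by omega) p hp)
      simp only [hh]
      rw [this]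
      have hv : (vd b : ℂ) ≠ 0 := by exact_mod_cast (vd_pos hbm).ne'
      have hV : VdmC m (fun i => s i - s m - 1) = VdmC m s := by
        simp_rw [sub_sub]; exact VdmC_shift m s _
      rw [hV]
      have hVn : VdmC m s ≠ 0 := VdmC_ne fun i hi j hj hij e => by
        rcases Nat.lt_or_gt_of_ne hij with q | q
        · have := s_sep hs q (by omega : j < m + 1)
          rw [e] at this; norm_num at this
        · have := s_sep hs q (by omega : i < m + 1)
          rw [e] at this; norm_num at this
      field_simp
    rw [h1, h2, h3, h4, mul_left_comm, mul_left_comm (∏ i, chi (L m) (s m) (a i)),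
      core_det L ha ha0 hs, VdmC_succ, Finset.prod_range_succ]
    simp only [div_eq_mul_inv, mul_inv]
    ring

end RMT

namespace RMT

theorem core_unsorted (n : ℕ) (g : ℕ → ℝ → ℂ) (L : ℕ → ℤ) (s : ℕ → ℂ) (a : Fin n → ℝ)
    (μ : Measure (Matrix (Fin n) (Fin n) ℂ)) (hμ : IsHaarUnitary n μ) (ha : Function.Injective a)
    (ha0 : ∀ i, a i ≠ 0) (hs : ∀ j < n, 1 ≤ (s j - sNext n s j).re)
    (hg : ∀ j < n, Measurable (g j))
    (hgc : ∀ j < n, ∀ p, p ≠ 0 → g j p = chi (L j - LNext n L j - 1) (s j - sNext n s j - 1) p) :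
    ∫ k, prodG g n (k * Matrix.diagonal (fun i => ((a i : ℝ) : ℂ)) * kᴴ) ∂μ =
      (∏ j ∈ Finset.range n, (Nat.factorial j : ℂ)) *
        (Matrix.of fun b c : Fin n => chi (L b) (s b) (a c)).det / ((vd a : ℂ) * VdmC n s) := by
  set σ := Tuple.sort a
  have hm : StrictMono (a ∘ σ) :=
    (Tuple.monotone_sort a).strictMono_of_injective (ha.comp σ.injective)
  have h1 := core n g L s (a ∘ σ) μ hμ hm (fun i => ha0 _) hs hg hgc
  rw [integral_conj hμ (diag_herm a) (diag_herm (a ∘ σ)) _ (measurable_prodG hg), h1]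
  · have e1 : (Matrix.of fun b c : Fin n => chi (L b) (s b) ((a ∘ σ) c)) =
        (Matrix.of fun b c : Fin n => chi (L b) (s b) (a c)).submatrix id σ := rfl
    have e2 : vd (a ∘ σ) = ((Equiv.Perm.sign σ : ℤ) : ℝ) * vd a := by
      have : Matrix.vandermonde (a ∘ σ) = (Matrix.vandermonde a).submatrix σ id := rfl
      rw [vd, this, Matrix.det_permute]; rfl
    rw [e1, Matrix.det_permute', e2]
    rcases Int.units_eq_one_or (Equiv.Perm.sign σ) with h | h
    · simp [h]
    · simp [h]
  · rw [Matrix.charpoly_diagonal, Matrix.charpoly_diagonal]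
    exact (Equiv.prod_comp σ (fun i => (Polynomial.X - Polynomial.C ((a i : ℝ) : ℂ)))).symm

lemma vd_eq (n : ℕ) (a : ℕ → ℝ) :
    ((vd (fun i : Fin n => a i) : ℝ) : ℂ) = VdmC n (fun j => ((a j : ℝ) : ℂ)) := by
  rw [vd, Matrix.det_vandermonde, VdmC, Finset.prod_range]
  push_cast
  have h1 : ∀ i : Fin n, ∏ j ∈ Finset.Ioi i, (((a j : ℝ) : ℂ) - (a i : ℝ)) =
      ∏ j : Fin n, if i < j then (((a j : ℝ) : ℂ) - (a i : ℝ)) else 1 := by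
    intro i
    rw [← Finset.prod_filter]
    congr 1; ext j; simp
  simp_rw [h1]
  rw [Finset.prod_comm]
  refine Finset.prod_congr rfl fun c _ => ?_
  have h2 := Finset.prod_range (n := n) (fun d => if d < (c : ℕ) then (((a c : ℝ) : ℂ) - (a d : ℝ)) else 1)
  simp only [Fin.val_fin_lt] at h2
  rw [← h2, ← Finset.prod_filter]
  congr 1; ext d; simp
  intro h; exact h.trans c.2

end RMT

namespace RMT

/-- the constant in the main formula -/
def Kc (l n : ℕ) (s : ℕ → ℂ) : ℂ :=
  ∏ j ∈ Finset.range n,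
    ((Nat.factorial (l - (j + 1)) : ℂ) * Complex.Gamma (s j + 1)) /
      ((Nat.factorial (n - (j + 1)) : ℂ) * Complex.Gamma (s j + (l - n : ℕ) + 1))

/-- the rank `n` diagonal matrix -/
def dg (l n : ℕ) (a : ℕ → ℝ) : Matrix (Fin l) (Fin l) ℂ :=
  Matrix.diagonal (fun i : Fin l => if (i : ℕ) < n then ((a i : ℝ) : ℂ) else 0)

/-- the right-hand side of the main formula -/
def rhsQ (l n : ℕ) (L : ℕ → ℤ) (s : ℕ → ℂ) (a : ℕ → ℝ) : ℂ :=
  Kc l n s * ((∏ j ∈ Finset.range n, (Nat.factorial j : ℂ)) *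
    (Matrix.of fun b c : Fin n => chi (L b) (s b) (a c)).det /
      (VdmC n (fun j => ((a j : ℝ) : ℂ)) * VdmC n s))

/-- the main formula for continuous test functions -/
def Q (l n : ℕ) : Prop := ∀ (g : ℕ → ℝ → ℂ) (L : ℕ → ℤ) (s : ℕ → ℂ) (a : ℕ → ℝ)
    (μ : Measure (Matrix (Fin l) (Fin l) ℂ)), IsHaarUnitary l μ →
    (∀ i < n, a i ≠ 0) → (∀ i < n, ∀ j < n, i ≠ j → a i ≠ a j) →
    (∀ j < n, 1 ≤ (s j - sNext n s j).re) →
    (∀ j < n, Continuous (g j)) →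
    (∀ j < n, ∀ p, p ≠ 0 → g j p = chi (L j - LNext n L j - 1) (s j - sNext n s j - 1) p) →
    ∫ k, prodG g n (k * dg l n a * kᴴ) ∂μ = rhsQ l n L s a

lemma Q_base (l : ℕ) : Q l l := by
  intro g L s a μ hμ ha0 had hs hg hgc
  have h := core_unsorted l g L s (fun i => a i) μ hμ
    (fun i j h => by
      by_contra hne
      exact had i i.2 j j.2 (fun e => hne (Fin.ext e)) h) (fun i => ha0 i i.2) hs
    (fun j hj => (hg j hj).measurable) hgc
  have e : dg l l a = Matrix.diagonal (fun i : Fin l => ((a i : ℝ) : ℂ)) := by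
    unfold dg; congr 1; ext i; simp
  rw [e, h, vd_eq, rhsQ]
  have hK : Kc l l s = 1 := by
    refine Finset.prod_eq_one fun j hj => ?_
    rw [Nat.sub_self, Nat.cast_zero, add_zero]
    refine div_self (mul_ne_zero (by exact_mod_cast Nat.factorial_ne_zero _) ?_)
    refine Complex.Gamma_ne_zero_of_re_pos ?_
    have := s_nonneg hs (Finset.mem_range.1 hj)
    rw [Complex.add_re, Complex.one_re]; linarith
  rw [hK, one_mul]

/-- dominated convergence over the unitary group -/
lemma int_cont {l : ℕ} {μ : Measure (Matrix (Fin l) (Fin l) ℂ)} (hμ : IsHaarUnitary l μ)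
    {f : ℝ → Matrix (Fin l) (Fin l) ℂ → ℂ} (hf : Continuous fun p : ℝ × _ => f p.1 p.2) :
    ContinuousAt (fun ε => ∫ k, f ε k ∂μ) 0 := by
  have := hμ.1
  have hc : IsCompact ((Set.Icc (-1 : ℝ) 1) ×ˢ
      {A : Matrix (Fin l) (Fin l) ℂ | A ∈ Matrix.unitaryGroup (Fin l) ℂ}) :=
    isCompact_Icc.prod (unitary_isCompact l)
  obtain ⟨B, hB⟩ := hc.exists_bound_of_continuousOn hf.continuousOn
  refine tendsto_integral_filter_of_dominated_convergence (fun _ => B) ?_ ?_ (by simp) ?_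
  · refine Eventually.of_forall fun ε => ?_
    exact (Continuous.measurable (by fun_prop)).aestronglyMeasurable
  · filter_upwards [Icc_mem_nhds (by norm_num : (-1 : ℝ) < 0) (by norm_num : (0 : ℝ) < 1)] with ε hε
    filter_upwards [haar_ae_mem hμ] with k hk
    exact hB (ε, k) ⟨hε, hk⟩
  · refine ae_of_all _ fun k => ?_
    exact Continuous.tendsto (by fun_prop : Continuous fun ε => f ε k) 0

lemma continuous_prodG {g : ℕ → ℝ → ℂ} {n : ℕ} (hg : ∀ j < n, Continuous (g j)) {l : ℕ} :
    Continuous fun Y : Matrix (Fin l) (Fin l) ℂ => prodG g n Y := by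
  unfold prodG
  refine continuous_finsetProd _ fun j hj => ?_
  exact (hg j (Finset.mem_range.1 hj)).comp (continuous_pminor (j + 1))

/-- extend `s` -/
def sHat (n : ℕ) (s : ℕ → ℂ) : ℕ → ℂ := fun j => if j < n then s j + 1 else 0
/-- extend `L` -/
def LHat (n : ℕ) (L : ℕ → ℤ) : ℕ → ℤ := fun j => if j < n then L j + 1 else 0
/-- extend `a` -/
def aHat (n : ℕ) (a : ℕ → ℝ) (ε : ℝ) : ℕ → ℝ := fun j => if j < n then a j else ε
/-- extend `g` -/
def gHat (n : ℕ) (g : ℕ → ℝ → ℂ) : ℕ → ℝ → ℂ := fun j => if j < n then g j else fun _ => 1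

lemma sHat_diff {n j : ℕ} (hj : j < n) (s : ℕ → ℂ) :
    sHat n s j - sNext (n + 1) (sHat n s) j = s j - sNext n s j := by
  unfold sNext sHat
  rw [if_pos hj, if_pos (by omega : j + 1 < n + 1)]
  split_ifs <;> ring

lemma LHat_diff {n j : ℕ} (hj : j < n) (L : ℕ → ℤ) :
    LHat n L j - LNext (n + 1) (LHat n L) j = L j - LNext n L j := by
  unfold LNext LHat
  rw [if_pos hj, if_pos (by omega : j + 1 < n + 1)]
  split_ifs <;> ring

lemma sHat_last (n : ℕ) (s : ℕ → ℂ) : sHat n s n - sNext (n + 1) (sHat n s) n = 1 := by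
  simp [sNext, sHat]

lemma LHat_last (n : ℕ) (L : ℕ → ℤ) : LHat n L n - LNext (n + 1) (LHat n L) n = 1 := by
  simp [LNext, LHat]

lemma chi_one_one {p : ℝ} (hp : p ≠ 0) : chi 1 1 p = p := by
  rcases lt_or_gt_of_ne hp with h | h
  · rw [chi_neg _ _ h]; simp
  · rw [chi_pos _ _ h]; simp

lemma det_hat {n : ℕ} (L : ℕ → ℤ) (s : ℕ → ℂ) (a : ℕ → ℝ) (ha0 : ∀ i < n, a i ≠ 0)
    (hs : ∀ i < n, 0 ≤ (s i).re) :
    (Matrix.of fun b c : Fin (n + 1) => chi (LHat n L b) (sHat n s b) (aHat n a 0 c)).det =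
      (∏ i ∈ Finset.range n, ((a i : ℝ) : ℂ)) *
        (Matrix.of fun b c : Fin n => chi (L b) (s b) (a c)).det := by
  rw [Matrix.det_succ_column _ (Fin.last n), Finset.sum_eq_single (Fin.last n)]
  · have h1 : (Matrix.of fun b c : Fin (n + 1) =>
        chi (LHat n L b) (sHat n s b) (aHat n a 0 c)).submatrix (Fin.last n).succAbove
          (Fin.last n).succAbove = Matrix.of fun b c : Fin n => ((a c : ℝ) : ℂ) *
            (Matrix.of fun b c : Fin n => chi (L b) (s b) (a c)) b c := by
      ext b c
      simp only [Matrix.submatrix_apply, Matrix.of_apply, Fin.succAbove_last, Fin.val_castSucc,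
        LHat, sHat, aHat, if_pos b.2, if_pos c.2]
      rw [← chi_add _ _ _ _ (ha0 c c.2), chi_one_one (ha0 c c.2), mul_comm]
    rw [h1, Matrix.det_mul_row, Finset.prod_range (fun i => ((a i : ℝ) : ℂ))]
    simp [LHat, sHat, aHat, chi_zero_zero]
  · intro b _ hb
    have hb' : (b : ℕ) < n := by
      have := b.2
      have h2 : (b : ℕ) ≠ n := fun e => hb (Fin.ext e)
      omega
    have : chi (LHat n L b) (sHat n s b) (aHat n a 0 (Fin.last n : Fin (n + 1))) = 0 := by
      simp only [LHat, sHat, aHat, if_pos hb', Fin.val_last, lt_irrefl, if_false]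
      refine chi_zero _ fun e => ?_
      have h1 := hs b hb'
      have h2 := congrArg Complex.re e
      simp at h2; linarith
    simp only [Matrix.of_apply, this]
    ring
  · simp

lemma Kc_hat {l n : ℕ} (hl : n + 1 ≤ l) (s : ℕ → ℂ) (hs : ∀ i < n, 0 ≤ (s i).re) :
    Kc l (n + 1) (sHat n s) * (Nat.factorial n : ℂ) =
      Kc l n s * ∏ j ∈ Finset.range n, (s j + 1) := by
  unfold Kc
  rw [Finset.prod_range_succ]
  have hlast : ((Nat.factorial (l - (n + 1)) : ℂ) * Complex.Gamma (sHat n s n + 1)) /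
      ((Nat.factorial (n + 1 - (n + 1)) : ℂ) * Complex.Gamma (sHat n s n + (l - (n + 1) : ℕ) + 1))
        = 1 := by
    simp only [sHat, lt_irrefl, if_false, zero_add, Complex.Gamma_one, Nat.sub_self]
    rw [Complex.Gamma_nat_eq_factorial]
    rw [mul_one, Nat.factorial_zero, Nat.cast_one, one_mul]
    exact div_self (Nat.cast_ne_zero.2 (Nat.factorial_ne_zero _))
  rw [hlast, mul_one]
  have hfac : (Nat.factorial n : ℂ) = ∏ j ∈ Finset.range n, ((n - j : ℕ) : ℂ) := by
    rw [← Finset.prod_range_reflect, ← Finset.prod_range_add_one_eq_factorial]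
    push_cast
    refine Finset.prod_congr rfl fun j hj => ?_
    rw [Finset.mem_range] at hj
    rw [show n - (n - 1 - j) = j + 1 by omega]; push_cast; rfl
  rw [hfac, ← Finset.prod_mul_distrib, ← Finset.prod_mul_distrib]
  refine Finset.prod_congr rfl fun j hj => ?_
  rw [Finset.mem_range] at hj
  have hre := hs j hj
  have e1 : sHat n s j = s j + 1 := by simp [sHat, hj]
  have e2 : s j + 1 + (l - (n + 1) : ℕ) + 1 = s j + (l - n : ℕ) + 1 := by
    rw [show l - n = (l - (n + 1)) + 1 by omega]; push_cast; ring
  have hne : s j + 1 ≠ 0 := fun e => by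
    have := congrArg Complex.re e
    simp at this; linarith
  have e3 : n + 1 - (j + 1) = (n - (j + 1)) + 1 := by omega
  have e4 : n - j = (n - (j + 1)) + 1 := by omega
  rw [e1, e2, Complex.Gamma_add_one _ hne, e3, e4, Nat.factorial_succ]
  have h5 : (((n - (j + 1)) + 1 : ℕ) : ℂ) ≠ 0 := Nat.cast_ne_zero.2 (Nat.succ_ne_zero _)
  have h6 : ((Nat.factorial (n - (j + 1)) : ℕ) : ℂ) ≠ 0 := by
    exact_mod_cast Nat.factorial_ne_zero _
  have h7 : Complex.Gamma (s j + (l - n : ℕ) + 1) ≠ 0 := by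
    refine Complex.Gamma_ne_zero_of_re_pos ?_
    simp
    positivity
  rw [Nat.cast_mul]
  field_simp

lemma rhsQ_hat {l n : ℕ} (hl : n + 1 ≤ l) (L : ℕ → ℤ) (s : ℕ → ℂ) (a : ℕ → ℝ)
    (ha0 : ∀ i < n, a i ≠ 0) (hs : ∀ i < n, 0 ≤ (s i).re) :
    rhsQ l (n + 1) (LHat n L) (sHat n s) (aHat n a 0) = rhsQ l n L s a := by
  unfold rhsQ
  rw [det_hat L s a ha0 hs, VdmC_succ, VdmC_succ]
  have e1 : VdmC n (sHat n s) = VdmC n s := by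
    have : VdmC n (sHat n s) = VdmC n (fun i => s i - (-1)) := by
      refine Finset.prod_congr rfl fun i hi => Finset.prod_congr rfl fun j hj => ?_
      rw [Finset.mem_range] at hi hj
      rw [sHat, sHat, if_pos hi, if_pos (by omega)]; ring
    rw [this, VdmC_shift]
  have e2 : VdmC n (fun j => ((aHat n a 0 j : ℝ) : ℂ)) = VdmC n (fun j => ((a j : ℝ) : ℂ)) := by
    refine Finset.prod_congr rfl fun i hi => Finset.prod_congr rfl fun j hj => ?_
    rw [Finset.mem_range] at hi hj
    simp only [aHat]
    rw [if_pos hi, if_pos (by omega)]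
  have e3 : ∏ d ∈ Finset.range n, (((aHat n a 0 n : ℝ) : ℂ) - ((aHat n a 0 d : ℝ) : ℂ)) =
      (-1) ^ n * ∏ d ∈ Finset.range n, ((a d : ℝ) : ℂ) := by
    rw [← Finset.card_range n, ← Finset.prod_const, Finset.card_range, ← Finset.prod_mul_distrib]
    refine Finset.prod_congr rfl fun i hi => ?_
    rw [Finset.mem_range] at hi
    simp [aHat, hi]
  have e4 : ∏ d ∈ Finset.range n, (sHat n s n - sHat n s d) =
      (-1) ^ n * ∏ d ∈ Finset.range n, (s d + 1) := by
    rw [← Finset.card_range n, ← Finset.prod_const, Finset.card_range, ← Finset.prod_mul_distrib]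
    refine Finset.prod_congr rfl fun i hi => ?_
    rw [Finset.mem_range] at hi
    simp [sHat, hi]
  rw [e1, e2, e3, e4, Finset.prod_range_succ]
  have hA : ∏ d ∈ Finset.range n, ((a d : ℝ) : ℂ) ≠ 0 :=
    Finset.prod_ne_zero_iff.2 fun i hi => by exact_mod_cast ha0 i (Finset.mem_range.1 hi)
  have hS : ∏ d ∈ Finset.range n, (s d + 1) ≠ 0 :=
    Finset.prod_ne_zero_iff.2 fun i hi e => by
      have h1 := hs i (Finset.mem_range.1 hi)
      have := congrArg Complex.re e
      simp at this; linarith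
  have hK := Kc_hat hl s hs
  set A := ∏ d ∈ Finset.range n, ((a d : ℝ) : ℂ)
  set S := ∏ d ∈ Finset.range n, (s d + 1)
  have h5 : ((-1 : ℂ) ^ n) * (-1) ^ n = 1 := by rw [← mul_pow]; simp
  have hK2 : Kc l (n + 1) (sHat n s) * (Nat.factorial n : ℂ) * S⁻¹ = Kc l n s := by
    rw [hK, mul_inv_cancel_right₀ hS]
  rw [← hK2]
  have h6 : ((-1 : ℂ) ^ n)⁻¹ = (-1) ^ n := by
    rw [inv_eq_iff_eq_inv]; exact eq_inv_of_mul_eq_one_left h5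
  simp only [div_eq_mul_inv, mul_inv, h6]
  have hAA : A * A⁻¹ = 1 := mul_inv_cancel₀ hA
  generalize (Matrix.of fun b c : Fin n => chi (L b) (s b) (a c)).det = D
  generalize (VdmC n fun j => ((a j : ℝ) : ℂ))⁻¹ = V
  generalize (VdmC n s)⁻¹ = W
  generalize (∏ x ∈ Finset.range n, (Nat.factorial x : ℂ)) = F
  generalize Kc l (n + 1) (sHat n s) = KK
  generalize (Nat.factorial n : ℂ) = nf
  calc _ = KK * F * nf * D * V * W * S⁻¹ * (A * A⁻¹) * ((-1) ^ n * (-1) ^ n) := by ring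
    _ = _ := by rw [hAA, h5]; ring

lemma Q_step {l n : ℕ} (hl : n + 1 ≤ l) (h : Q l (n + 1)) : Q l n := by
  intro g L s a μ hμ ha0 had hs hg hgc
  have hs0 : ∀ i < n, 0 ≤ (s i).re := fun i hi => s_nonneg hs hi
  have hsh : ∀ j < n + 1, 1 ≤ (sHat n s j - sNext (n + 1) (sHat n s) j).re := by
    intro j hj
    rcases Nat.lt_or_ge j n with h1 | h1
    · rw [sHat_diff h1]; exact hs j h1
    · have : j = n := by omega
      subst this
      rw [sHat_last]; simp
  have hgh : ∀ j < n + 1, Continuous (gHat n g j) := by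
    intro j hj
    unfold gHat
    split_ifs with h1
    · exact hg j h1
    · exact continuous_const
  have hgch : ∀ j < n + 1, ∀ p, p ≠ 0 → gHat n g j p =
      chi (LHat n L j - LNext (n + 1) (LHat n L) j - 1)
        (sHat n s j - sNext (n + 1) (sHat n s) j - 1) p := by
    intro j hj p hp
    rcases Nat.lt_or_ge j n with h1 | h1
    · rw [sHat_diff h1, LHat_diff h1, gHat, if_pos h1]; exact hgc j h1 p hp
    · have : j = n := by omega
      subst this
      rw [sHat_last, LHat_last, gHat, if_neg (lt_irrefl _), sub_self, sub_self, chi_zero_zero]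
  have hev : ∀ᶠ ε in nhdsWithin (0 : ℝ) {0}ᶜ,
      ∫ k, prodG (gHat n g) (n + 1) (k * dg l (n + 1) (aHat n a ε) * kᴴ) ∂μ =
        rhsQ l (n + 1) (LHat n L) (sHat n s) (aHat n a ε) := by
    have h1 : ∀ᶠ ε in nhds (0 : ℝ), ∀ i ∈ Finset.range n, ε ≠ a i := by
      rw [Filter.eventually_all_finset]
      intro i hi
      exact isOpen_ne.mem_nhds (ha0 i (Finset.mem_range.1 hi)).symm
    filter_upwards [self_mem_nhdsWithin, nhdsWithin_le_nhds h1] with ε h0 hne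
    refine h _ _ _ _ μ hμ ?_ ?_ hsh hgh hgch
    · intro i hi
      unfold aHat
      split_ifs with h2
      · exact ha0 i h2
      · exact h0
    · intro i hi j hj hij
      unfold aHat
      split_ifs with h2 h3 h3
      · exact had i h2 j h3 hij
      · exact (hne i (Finset.mem_range.2 h2)).symm
      · exact hne j (Finset.mem_range.2 h3)
      · omega
  have hda : Continuous fun ε => dg l (n + 1) (aHat n a ε) := by
    unfold dg
    refine Continuous.matrix_diagonal (continuous_pi fun i => ?_)
    unfold aHat
    split_ifs <;> fun_prop
  have hL : ContinuousAt (fun ε => ∫ k, prodG (gHat n g) (n + 1)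
      (k * dg l (n + 1) (aHat n a ε) * kᴴ) ∂μ) 0 := by
    refine int_cont hμ ?_
    refine (continuous_prodG hgh).comp ?_
    have := hda.comp (continuous_fst (X := ℝ) (Y := Matrix (Fin l) (Fin l) ℂ))
    simp only [Function.comp_def] at this
    fun_prop
  have hac : ∀ c, Continuous fun ε => aHat n a ε c := by
    intro c
    unfold aHat
    split_ifs <;> fun_prop
  have hR : ContinuousAt (fun ε => rhsQ l (n + 1) (LHat n L) (sHat n s) (aHat n a ε)) 0 := by
    unfold rhsQ
    refine ContinuousAt.mul continuousAt_const ?_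
    refine ContinuousAt.div ?_ ?_ ?_
    · refine ContinuousAt.mul continuousAt_const (Continuous.continuousAt ?_)
      refine Continuous.matrix_det ?_
      refine continuous_matrix fun b c => ?_
      simp only [Matrix.of_apply]
      rcases Nat.lt_or_ge (b : ℕ) n with h1 | h1
      · refine (continuous_chi _ ?_).comp (hac c)
        rw [sHat, if_pos h1]
        have := hs0 b h1
        simp; linarith
      · have e1 : LHat n L b = 0 := by rw [LHat, if_neg (by omega)]
        have e2 : sHat n s b = 0 := by rw [sHat, if_neg (by omega)]
        simp only [e1, e2, chi_zero_zero]
        exact continuous_const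
    · refine ContinuousAt.mul (Continuous.continuousAt ?_) continuousAt_const
      unfold VdmC
      refine continuous_finsetProd _ fun c _ => continuous_finsetProd _ fun d _ => ?_
      have h1 := hac c
      have h2 := hac d
      fun_prop
    · refine mul_ne_zero ?_ ?_
      · refine VdmC_ne fun i hi j hj hij e => ?_
        have e' : aHat n a 0 i = aHat n a 0 j := by exact_mod_cast e
        revert e'
        unfold aHat
        split_ifs with h2 h3 h3
        · exact had i h2 j h3 hij
        · exact ha0 i h2
        · exact (ha0 j h3).symm
        · omega
      · refine VdmC_ne fun i hi j hj hij e => ?_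
        rcases Nat.lt_or_gt_of_ne hij with q | q
        · have := s_sep hsh q hj
          rw [e] at this; norm_num at this
        · have := s_sep hsh q hi
          rw [e] at this; norm_num at this
  have hfin := tendsto_nhds_unique_of_eventuallyEq
    (hL.tendsto.mono_left nhdsWithin_le_nhds) (hR.tendsto.mono_left nhdsWithin_le_nhds) hev
  rw [rhsQ_hat hl L s a ha0 hs0] at hfin
  rw [← hfin]
  congr 1; ext k
  have e1 : dg l (n + 1) (aHat n a 0) = dg l n a := by
    unfold dg
    congr 1; ext i
    unfold aHat
    by_cases h1 : (i : ℕ) < n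
    · simp [h1, Nat.lt_succ_of_lt h1]
    · simp [h1]
  rw [e1, prodG, prodG, Finset.prod_range_succ]
  have e2 : gHat n g n = fun _ => 1 := by simp [gHat]
  rw [e2, mul_one]
  refine Finset.prod_congr rfl fun j hj => ?_
  rw [gHat, if_pos (Finset.mem_range.1 hj)]

theorem Q_all {l n : ℕ} (hln : n ≤ l) : Q l n := by
  refine Nat.decreasingInduction (motive := fun n _ => Q l n) ?_ (Q_base l) hln
  intro k hk h
  exact Q_step hk h

end RMT

namespace RMT

/-- shifted exponents -/
def sDel (n : ℕ) (s : ℕ → ℂ) (δ : ℝ) : ℕ → ℂ := fun j => s j + (δ : ℂ) * ((n - j : ℕ) : ℂ)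

lemma sDel_diff {n j : ℕ} (hj : j < n) (s : ℕ → ℂ) (δ : ℝ) :
    sDel n s δ j - sNext n (sDel n s δ) j - 1 = (s j - sNext n s j - 1) + δ := by
  unfold sNext sDel
  split_ifs with h
  · rw [show n - j = (n - (j + 1)) + 1 by omega]; push_cast; ring
  · rw [show n - j = 1 by omega]; push_cast; ring

lemma continuous_sDel (n : ℕ) (s : ℕ → ℂ) (j : ℕ) : Continuous fun δ => sDel n s δ j := by
  unfold sDel; fun_prop

lemma continuous_chi_exp (L : ℤ) {p : ℝ} (hp : p ≠ 0) : Continuous fun w => chi L w p := by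
  unfold chi
  have h : ((|p| : ℝ) : ℂ) ≠ 0 := by simpa using hp
  exact continuous_const.mul (continuous_const.cpow continuous_id fun _ =>
    Or.inl (by simpa using hp))

/-- the integrand function -/
def gS (n : ℕ) (s : ℕ → ℂ) (L : ℕ → ℤ) : ℕ → ℝ → ℂ := fun j p =>
  if p = 0 then 0 else chi (L j - LNext n L j - 1) (s j - sNext n s j - 1) p

lemma sphProd_eq (n : ℕ) (s : ℕ → ℂ) (L : ℕ → ℤ) {l : ℕ} (Y : Matrix (Fin l) (Fin l) ℂ) :
    sphProd n s L Y = prodG (gS n s L) n Y := rfl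

lemma final_form {l n : ℕ} (hln : n ≤ l) (a : ℕ → ℝ)
    (ha0 : ∀ i < n, a i ≠ 0)
    (hadist : ∀ i < n, ∀ j < n, i ≠ j → a i ≠ a j)
    (L : ℕ → ℤ) (s : ℕ → ℂ)
    (hs : ∀ j < n, 1 ≤ (s j - sNext n s j).re)
    (μ : Measure (Matrix (Fin l) (Fin l) ℂ)) (hμ : IsHaarUnitary l μ) :
    ∫ k, prodG (gS n s L) n (k * dg l n a * kᴴ) ∂μ = rhsQ l n L s a := by
  have hP := hμ.1
  have hw : ∀ j < n, 0 ≤ (s j - sNext n s j - 1).re := by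
    intro j hj
    have := hs j hj
    rw [Complex.sub_re, Complex.one_re]; linarith
  set G : ℝ → ℕ → ℝ → ℂ := fun δ j => chi (L j - LNext n L j - 1)
    ((s j - sNext n s j - 1) + δ) with hG
  have hpos : ∀ δ : ℝ, 0 < δ → ∀ j < n, 0 < ((s j - sNext n s j - 1) + (δ : ℂ)).re := by
    intro δ hδ j hj
    have := hw j hj
    rw [Complex.add_re, Complex.ofReal_re]; linarith
  have hev : ∀ᶠ δ in nhdsWithin (0 : ℝ) (Set.Ioi 0),
      ∫ k, prodG (G δ) n (k * dg l n a * kᴴ) ∂μ = rhsQ l n L (sDel n s δ) a := by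
    filter_upwards [self_mem_nhdsWithin] with δ hδ
    refine Q_all hln (G δ) L (sDel n s δ) a μ hμ ha0 hadist ?_ ?_ ?_
    · intro j hj
      have h1 := hpos δ hδ j hj
      rw [← sDel_diff hj, Complex.sub_re, Complex.one_re] at h1
      linarith
    · intro j hj
      exact continuous_chi _ (hpos δ hδ j hj)
    · intro j hj p hp
      rw [sDel_diff hj]
  have hLt : Tendsto (fun δ => ∫ k, prodG (G δ) n (k * dg l n a * kᴴ) ∂μ)
      (nhdsWithin (0 : ℝ) (Set.Ioi 0)) (nhds (∫ k, prodG (gS n s L) n (k * dg l n a * kᴴ) ∂μ)) := by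
    obtain ⟨M, hM1, hM⟩ := pminor_bound (dg l n a) n
    refine tendsto_integral_filter_of_dominated_convergence
      (fun _ => ∏ j ∈ Finset.range n, M ^ ((s j - sNext n s j - 1).re + 1)) ?_ ?_ (by simp) ?_
    · refine Eventually.of_forall fun δ => ?_
      have h1 : Measurable fun Y : Matrix (Fin l) (Fin l) ℂ => prodG (G δ) n Y :=
        measurable_prodG fun j _ => measurable_chi _ _
      have h2 : Continuous fun k : Matrix (Fin l) (Fin l) ℂ => k * dg l n a * kᴴ := by fun_prop
      exact (h1.comp h2.measurable).aestronglyMeasurable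
    · have hI : Set.Ioo (0 : ℝ) 1 ∈ nhdsWithin (0 : ℝ) (Set.Ioi 0) :=
        Ioo_mem_nhdsGT one_pos
      filter_upwards [hI] with δ hδ
      filter_upwards [haar_ae_mem hμ] with k hk
      rw [prodG, norm_prod]
      refine Finset.prod_le_prod (fun _ _ => norm_nonneg _) fun j hj => ?_
      rw [Finset.mem_range] at hj
      refine (norm_chi_le hM1 (hM k hk j hj) _ (hpos δ hδ.1 j hj).le).trans ?_
      refine Real.rpow_le_rpow_of_exponent_le hM1 ?_
      rw [Complex.add_re, Complex.ofReal_re]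
      linarith [hδ.2]
    · refine ae_of_all _ fun k => ?_
      unfold prodG
      refine tendsto_finsetProd _ fun j hj => ?_
      rw [Finset.mem_range] at hj
      generalize pminor (k * dg l n a * kᴴ) (j + 1) = p
      by_cases hp : p = 0
      · subst hp
        refine Tendsto.congr' (f₁ := fun _ => (0 : ℂ)) ?_ ?_
        · filter_upwards [self_mem_nhdsWithin] with δ hδ
          rw [hG]
          refine (chi_zero _ fun e => ?_).symm
          have := hpos δ hδ j hj
          rw [e] at this; simp at this
        · simp [gS]
      · rw [gS, if_neg hp]
        have h1 : Continuous fun δ : ℝ => G δ j p :=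
          (continuous_chi_exp _ hp).comp (by fun_prop :
            Continuous fun δ : ℝ => (s j - sNext n s j - 1) + (δ : ℂ))
        have h2 := h1.tendsto 0
        simp only [hG, Complex.ofReal_zero, add_zero] at h2
        exact h2.mono_left nhdsWithin_le_nhds
  have e0 : sDel n s 0 = s := by ext j; simp [sDel]
  have hRt : ContinuousAt (fun δ => rhsQ l n L (sDel n s δ) a) 0 := by
    have hsc : ∀ j, ContinuousAt (fun δ => sDel n s δ j) 0 := fun j =>
      (continuous_sDel n s j).continuousAt
    have hgam : ∀ (j : ℕ) (c : ℕ), j < n → ContinuousAt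
        (fun δ => Complex.Gamma (sDel n s δ j + (c : ℂ) + 1)) 0 := by
      intro j c hj
      refine ContinuousAt.comp (g := Complex.Gamma)
        (f := fun δ => sDel n s δ j + (c : ℂ) + 1) ?_ ?_
      · refine (Complex.differentiableAt_Gamma _ fun m e => ?_).continuousAt
        rw [e0] at e
        have h1 := s_nonneg hs hj
        have h2 := congrArg Complex.re e
        simp at h2
        have h3 : (0 : ℝ) ≤ c := Nat.cast_nonneg c
        have h4 : (0 : ℝ) ≤ m := Nat.cast_nonneg m
        linarith
      · exact ((hsc j).add continuousAt_const).add continuousAt_const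
    unfold rhsQ Kc
    refine ContinuousAt.mul ?_ ?_
    · refine tendsto_finsetProd _ fun j hj => ?_
      rw [Finset.mem_range] at hj
      have hA := hgam j 0 hj
      simp only [Nat.cast_zero, add_zero] at hA
      refine ContinuousAt.div (continuousAt_const.mul hA)
        (continuousAt_const.mul (hgam j (l - n) hj)) ?_
      refine mul_ne_zero (Nat.cast_ne_zero.2 (Nat.factorial_ne_zero _)) ?_
      refine Complex.Gamma_ne_zero_of_re_pos ?_
      rw [e0]
      have h1 := s_nonneg hs hj
      simp
      positivity
    · refine ContinuousAt.div ?_ ?_ ?_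
      · refine continuousAt_const.mul (Continuous.continuousAt ?_)
        refine Continuous.matrix_det (continuous_matrix fun b c => ?_)
        simp only [Matrix.of_apply]
        exact (continuous_chi_exp _ (ha0 c c.2)).comp (continuous_sDel n s b)
      · refine continuousAt_const.mul (Continuous.continuousAt ?_)
        unfold VdmC
        refine continuous_finsetProd _ fun c _ => continuous_finsetProd _ fun d _ => ?_
        exact (continuous_sDel n s c).sub (continuous_sDel n s d)
      · rw [e0]
        refine mul_ne_zero ?_ ?_
        · exact VdmC_ne fun i hi j hj hij e => hadist i hi j hj hij (by exact_mod_cast e)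
        · refine VdmC_ne fun i hi j hj hij e => ?_
          rcases Nat.lt_or_gt_of_ne hij with q | q
          · have := s_sep hs q hj
            rw [e] at this; norm_num at this
          · have := s_sep hs q hi
            rw [e] at this; norm_num at this
  have h := tendsto_nhds_unique_of_eventuallyEq hLt
    (hRt.tendsto.mono_left nhdsWithin_le_nhds) hev
  rw [h, e0]

end RMT

namespace RMT

/-- Explicit formula for `N_{l,n}(s, L; diag(a,0,…,0))` for a rank-`n`
diagonal Hermitian `l × l` matrix. -/
theorem statement1 (l n : ℕ) (hn : 1 ≤ n) (hln : n ≤ l) (a : ℕ → ℝ)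
    (ha0 : ∀ i < n, a i ≠ 0)
    (hadist : ∀ i < n, ∀ j < n, i ≠ j → a i ≠ a j)
    (L : ℕ → ℤ) (hL : ∀ i < n, L i = 0 ∨ L i = 1)
    (s : ℕ → ℂ) (hsdist : ∀ i < n, ∀ j < n, i ≠ j → s i ≠ s j)
    (hs : ∀ j < n, 1 ≤ (s j - sNext n s j).re)
    (μ : Measure (Matrix (Fin l) (Fin l) ℂ)) (hμ : IsHaarUnitary l μ) :
    Nsph l n μ s L
        (Matrix.diagonal (fun i : Fin l => if (i : ℕ) < n then ((a i : ℝ) : ℂ) else 0)) =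
      (∏ j ∈ Finset.range n,
          ((Nat.factorial (l - (j + 1)) : ℂ) * Complex.Gamma (s j + 1)) /
            ((Nat.factorial (n - (j + 1)) : ℂ) * Complex.Gamma (s j + (l - n : ℕ) + 1))) *
        ((∏ j ∈ Finset.range n, (Nat.factorial j : ℂ)) *
          Matrix.det (Matrix.of fun b c : Fin n =>
            ((Real.sign (a c) : ℝ) : ℂ) ^ (L b) * ((|a c| : ℝ) : ℂ) ^ (s b)) /
          (VdmC n (fun j => ((a j : ℝ) : ℂ)) * VdmC n s)) := by
  exact final_form hln a ha0 hadist L s hs μ hμ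

end RMT
end
end

section
/- Let l ≥ n ≥ 1 and let s ∈ ℂ^n satisfy Re(s_j − s_{j+1}) ≥ 1 for all j = 1,…,n (convention s_{n+1} = −1). Then C_{l,n}(s) = ∫_{U(l)} ∏_{j=1}^{n} |det((k P k*)_[j])|^{s_j−s_{j+1}−1} dk = ∏_{j=1}^{n} (l−j)! Γ(s_j+1) / ((n−j)! Γ(s_j+l−n+1)), where P is the l×l diagonal matrix with n ones followed by l−n zeros on the diagonal and Γ is the Gamma function. -/
open MeasureTheory Matrix Finset Filter

noncomputable section

namespace RMT

/-- Complex Gaussian density. -/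
def gdens (z : ℂ) : ℝ := Real.pi⁻¹ * Real.exp (-‖z‖ ^ 2)

/-- The standard complex Gaussian measure. -/
def gamC : Measure ℂ := volume.withDensity fun z => ENNReal.ofReal (gdens z)

/-- The standard Gaussian measure on `ℂ^m`. -/
def G (m : ℕ) : Measure (Fin m → ℂ) := Measure.pi fun _ => gamC

lemma gdens_nonneg (z : ℂ) : 0 ≤ gdens z := by unfold gdens; positivity

lemma gdens_meas : Measurable gdens := by unfold gdens; fun_prop

lemma gdens_integral : ∫ z, gdens z = 1 := by
  unfold gdens
  rw [integral_const_mul]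
  have := Complex.integral_exp_neg_rpow (p := 2) (by norm_num)
  simp only [Real.rpow_two] at this
  rw [this]
  norm_num [Real.Gamma_two]
  

lemma gdens_integrable : Integrable gdens := by
  by_contra h
  have := gdens_integral
  rw [integral_undef h] at this
  norm_num at this

instance : IsProbabilityMeasure gamC := by
  constructor
  rw [gamC, withDensity_apply _ MeasurableSet.univ, Measure.restrict_univ,
    ← ofReal_integral_eq_lintegral_ofReal gdens_integrable (ae_of_all _ gdens_nonneg),
    gdens_integral, ENNReal.ofReal_one]

instance (m : ℕ) : IsProbabilityMeasure (G m) := by unfold G; infer_instance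

lemma G_eq (m : ℕ) : G m = (volume : Measure (Fin m → ℂ)).withDensity
    fun y => ENNReal.ofReal (∏ i, gdens (y i)) := by
  unfold G
  apply Measure.pi_eq
  intro s hs
  have hint : Integrable (fun y : Fin m → ℂ => ∏ i, (s i).indicator gdens (y i)) :=
    Integrable.fintype_prod fun i => gdens_integrable.indicator (hs i)
  rw [withDensity_apply _ (MeasurableSet.univ_pi hs), ← lintegral_indicator (MeasurableSet.univ_pi hs)]
  have h1 : ∀ y : Fin m → ℂ, (Set.univ.pi s).indicator
      (fun y => ENNReal.ofReal (∏ i, gdens (y i))) y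
      = ENNReal.ofReal (∏ i, (s i).indicator gdens (y i)) := by
    intro y
    by_cases hy : y ∈ Set.univ.pi s
    · rw [Set.indicator_of_mem hy]
      congr 1
      apply Finset.prod_congr rfl
      intro i _
      rw [Set.indicator_of_mem (hy i trivial)]
    · rw [Set.indicator_of_notMem hy]
      simp only [Set.mem_pi, Set.mem_univ, true_implies, not_forall] at hy
      obtain ⟨i, hi⟩ := hy
      rw [Finset.prod_eq_zero (Finset.mem_univ i) (by rw [Set.indicator_of_notMem hi])]
      simp
  simp only [h1]
  rw [← ofReal_integral_eq_lintegral_ofReal hint (ae_of_all _ fun y =>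
    Finset.prod_nonneg fun i _ => Set.indicator_nonneg (fun _ _ => gdens_nonneg _) _),
    integral_fintype_prod_volume_eq_prod, ENNReal.ofReal_prod_of_nonneg]
  · apply Finset.prod_congr rfl
    intro i _
    rw [gamC, withDensity_apply _ (hs i), integral_indicator (hs i),
     ofReal_integral_eq_lintegral_ofReal gdens_integrable.restrict (ae_of_all _ gdens_nonneg)]
  · intro i _
    exact integral_nonneg fun x => Set.indicator_nonneg (fun _ _ => gdens_nonneg _) _

lemma prod_gdens {m : ℕ} (y : Fin m → ℂ) :
    ∏ i, gdens (y i) = (Real.pi⁻¹) ^ m * Real.exp (- ∑ i, ‖y i‖ ^ 2) := by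
  unfold gdens
  rw [Finset.prod_mul_distrib, ← Real.exp_sum]
  simp

/-- Dropping coordinates. -/
lemma G_drop {m k : ℕ} (e : Fin k → Fin m) (he : Function.Injective e) :
    MeasurePreserving (fun y : Fin m → ℂ => fun i => y (e i)) (G m) (G k) := by
  refine ⟨by fun_prop, ?_⟩
  symm
  unfold G
  apply Measure.pi_eq
  intro s hs
  rw [Measure.map_apply (by fun_prop) (MeasurableSet.univ_pi hs)]
  have : (fun y : Fin m → ℂ => fun i => y (e i)) ⁻¹' (Set.univ.pi s)
      = Set.univ.pi (fun j => ⋂ i, ⋂ (_ : e i = j), s i) := by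
    ext y
    simp only [Set.mem_preimage, Set.mem_pi, Set.mem_univ, true_implies, Set.mem_iInter]
    constructor
    · rintro h j i rfl
      exact h i
    · intro h i
      exact h _ i rfl
  rw [this, Measure.pi_pi]
  rw [← Finset.prod_subset (Finset.subset_univ (Finset.univ.image e)), Finset.prod_image
    (fun a _ b _ h => he h)]
  · apply Finset.prod_congr rfl
    intro i _
    congr 1
    ext z
    simp only [Set.mem_iInter]
    constructor
    · intro h; exact h i rfl
    · intro h i' hi'
      rwa [he hi']
  · intro j _ hj
    have : (⋂ i, ⋂ (_ : e i = j), s i) = Set.univ := by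
      ext z
      simp only [Set.mem_iInter, Set.mem_univ, iff_true]
      intro i hi
      exact absurd (Finset.mem_image.2 ⟨i, Finset.mem_univ _, hi⟩) hj
    rw [this, measure_univ]

lemma normSq_vecMul {m : ℕ} {U : Matrix (Fin m) (Fin m) ℂ} (hU : U ∈ Matrix.unitaryGroup (Fin m) ℂ)
    (y : Fin m → ℂ) : ∑ i, ‖(y ᵥ* U) i‖ ^ 2 = ∑ i, ‖y i‖ ^ 2 := by
  have key : ∀ v : Fin m → ℂ, ((∑ i, ‖v i‖ ^ 2 : ℝ) : ℂ) = v ⬝ᵥ star v := by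
    intro v
    simp [dotProduct, Complex.mul_conj, Complex.normSq_eq_norm_sq]
  have hU' : U * star U = 1 := (Matrix.mem_unitaryGroup_iff).1 hU
  apply Complex.ofReal_injective
  rw [key, key, star_vecMul, ← dotProduct_mulVec, mulVec_mulVec]
  rw [← Matrix.star_eq_conjTranspose, hU', one_mulVec]

lemma G_unitary {m : ℕ} {U : Matrix (Fin m) (Fin m) ℂ} (hU : U ∈ Matrix.unitaryGroup (Fin m) ℂ) :
    MeasurePreserving (fun y : Fin m → ℂ => y ᵥ* U) (G m) (G m) := by
  have hmeas : Measurable (fun y : Fin m → ℂ => y ᵥ* U) := by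
    unfold vecMul dotProduct
    fun_prop
  have hvol : MeasurePreserving (fun y : Fin m → ℂ => y ᵥ* U)
      (volume : Measure (Fin m → ℂ)) volume := by
    refine ⟨hmeas, ?_⟩
    let f : (Fin m → ℂ) →ₗ[ℂ] (Fin m → ℂ) := Matrix.vecMulLinear U
    have hdet : LinearMap.det (f.restrictScalars ℝ) = 1 := by
      rw [LinearMap.det_restrictScalars, Algebra.norm_complex_eq]
      have : f = Matrix.toLin' Uᵀ := by
        ext i j
        simp [f]
      rw [this, LinearMap.det_toLin', det_transpose]
      have h2 := (Matrix.mem_unitaryGroup_iff).1 hU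
      have h3 := congrArg Matrix.det h2
      rw [det_mul, Matrix.star_eq_conjTranspose, det_conjTranspose, det_one] at h3
      change Complex.normSq U.det = 1
      rw [← Complex.ofReal_inj, ← Complex.mul_conj]
      simpa using h3
    have := Measure.map_linearMap_addHaar_eq_smul_addHaar (volume : Measure (Fin m → ℂ))
      (f := f.restrictScalars ℝ) (by rw [hdet]; norm_num)
    rw [hdet] at this
    simp only [inv_one, abs_one, ENNReal.ofReal_one, one_smul] at this
    exact this
  refine ⟨hmeas, ?_⟩
  ext s hs
  rw [Measure.map_apply hmeas hs, G_eq, withDensity_apply _ (hmeas hs), withDensity_apply _ hs]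
  rw [← hvol.setLIntegral_comp_preimage hs]
  · simp only [prod_gdens, normSq_vecMul hU]
  · simp only [prod_gdens]; fun_prop

end RMT

namespace RMT

/-- Complex power of the absolute value, set to zero at zero. -/
def Pw (x : ℝ) (a : ℂ) : ℂ := if x = 0 then 0 else ((|x| : ℝ) : ℂ) ^ a

lemma Pw_mul (x y : ℝ) (a : ℂ) : Pw (x * y) a = Pw x a * Pw y a := by
  unfold Pw
  by_cases hx : x = 0
  · simp [hx]
  by_cases hy : y = 0
  · simp [hy]
  simp only [hx, hy, mul_eq_zero, or_self, if_false, abs_mul, Complex.ofReal_mul]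
  exact Complex.mul_cpow_ofReal_nonneg (abs_nonneg _) (abs_nonneg _) a

lemma Pw_add (x : ℝ) (a b : ℂ) : Pw x (a + b) = Pw x a * Pw x b := by
  unfold Pw
  by_cases hx : x = 0
  · simp [hx]
  simp only [hx, if_false]
  exact Complex.cpow_add _ _ (by simpa using hx)

lemma Pw_norm (x : ℝ) (a : ℂ) : ((‖Pw x a‖ : ℝ) : ℂ) = Pw x (a.re : ℂ) := by
  unfold Pw
  by_cases hx : x = 0
  · simp [hx]
  simp only [hx, if_false]
  rw [Complex.norm_cpow_eq_rpow_re_of_pos (abs_pos.2 hx), Complex.ofReal_cpow (abs_nonneg _)]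

lemma Pw_one (a : ℂ) : Pw 1 a = 1 := by simp [Pw]

lemma Pw_meas (a : ℂ) : Measurable fun x => Pw x a := by
  unfold Pw
  refine Measurable.ite (measurableSet_singleton 0) measurable_const ?_
  fun_prop

lemma radial_aux (m : ℕ) (hm : 1 ≤ m) (b : ℂ) (hb : 0 ≤ b.re) :
    IntegrableOn (fun r : ℝ => r ^ (m * 2 - 1) • ((Real.exp (-r ^ 2) : ℝ) : ℂ) * Pw (r ^ 2) b)
      (Set.Ioi 0) ∧
    ∫ r in Set.Ioi (0 : ℝ), r ^ (m * 2 - 1) • ((Real.exp (-r ^ 2) : ℝ) : ℂ) * Pw (r ^ 2) b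
      = 2⁻¹ * Complex.Gamma (m + b) := by
  have hre : 0 < (m + b : ℂ).re := by
    simp
    have : (1 : ℝ) ≤ m := by exact_mod_cast hm
    linarith
  have hcv := Complex.GammaIntegral_convergent hre
  have key : ∀ r ∈ Set.Ioi (0 : ℝ), r ^ (m * 2 - 1) • ((Real.exp (-r ^ 2) : ℝ) : ℂ) * Pw (r ^ 2) b
      = (2 : ℂ)⁻¹ * ((|(2 : ℝ)| * r ^ ((2 : ℝ) - 1)) •
        (fun x : ℝ => ((Real.exp (-x) : ℝ) : ℂ) * (x : ℂ) ^ ((m + b : ℂ) - 1)) (r ^ (2 : ℝ))) := by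
    intro r hr
    have hr0 : (0 : ℝ) < r := hr
    have hr2 : (0 : ℝ) < r ^ 2 := by positivity
    have e1 : (2 : ℝ) - 1 = 1 := by norm_num
    simp only [Real.rpow_two, e1, Real.rpow_one, Pw, hr2.ne', if_false, abs_of_pos hr2,
      abs_of_pos (two_pos : (0 : ℝ) < 2), Complex.real_smul]
    have e2 : (m + b : ℂ) - 1 = ((m - 1 : ℕ) : ℂ) + b := by
      rw [Nat.cast_sub hm]; push_cast; ring
    rw [e2, Complex.cpow_add _ _ (by exact_mod_cast hr2.ne'), Complex.cpow_natCast]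
    have e3 : m * 2 - 1 = 2 * (m - 1) + 1 := by omega
    rw [e3]
    push_cast
    rw [pow_succ, pow_mul]
    ring
  constructor
  · refine IntegrableOn.congr_fun ?_ (fun r hr => (key r hr).symm) measurableSet_Ioi
    apply Integrable.const_mul
    exact (integrableOn_Ioi_comp_rpow_iff _ two_ne_zero).2 hcv
  · rw [setIntegral_congr_fun measurableSet_Ioi key, integral_const_mul]
    rw [integral_comp_rpow_Ioi (fun x : ℝ => ((Real.exp (-x) : ℝ) : ℂ) * (x : ℂ) ^ ((m + b : ℂ) - 1))
      two_ne_zero, Complex.Gamma_eq_integral hre]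
    rfl

lemma radial0 (m : ℕ) (hm : 1 ≤ m) : ∃ κ : ℂ, ∀ (b : ℂ), 0 ≤ b.re →
    Integrable (fun y : Fin m → ℂ => Pw (∑ i, ‖y i‖ ^ 2) b) (G m) ∧
    ∫ y, Pw (∑ i, ‖y i‖ ^ 2) b ∂(G m) = κ * Complex.Gamma (m + b) := by
  have : Nonempty (Fin m) := ⟨⟨0, hm⟩⟩
  let E := EuclideanSpace ℂ (Fin m)
  let L : (Fin m → ℂ) ≃L[ℝ] E := (PiLp.continuousLinearEquiv 2 ℝ (fun _ : Fin m => ℂ)).symm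
  let ν : Measure E := Measure.map L volume
  have : ν.IsAddHaarMeasure := L.isAddHaarMeasure_map volume
  have hL : MeasurePreserving L (volume : Measure (Fin m → ℂ)) ν := ⟨L.continuous.measurable, rfl⟩
  have hLe : MeasurableEmbedding L := L.toHomeomorph.measurableEmbedding
  have hfr : Module.finrank ℝ E = m * 2 := by
    rw [← Module.finrank_mul_finrank ℝ ℂ]; simp [E, mul_comm]
  refine ⟨(Real.pi⁻¹ ^ m : ℝ) * ((m * 2 : ℕ) * ((ν.real (Metric.ball 0 1) : ℂ) * 2⁻¹)), ?_⟩
  intro b hb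
  obtain ⟨h1, h2⟩ := radial_aux m hm b hb
  have hden : Measurable fun y : Fin m → ℂ => ENNReal.ofReal (∏ i, gdens (y i)) := by
    simp only [prod_gdens]; fun_prop
  have hfin : ∀ᵐ y : Fin m → ℂ, ENNReal.ofReal (∏ i, gdens (y i)) < ⊤ :=
    ae_of_all _ fun _ => ENNReal.ofReal_lt_top
  rw [G_eq, integrable_withDensity_iff_integrable_smul' hden hfin,
    integral_withDensity_eq_integral_toReal_smul hden hfin]
  let f : ℝ → ℂ := fun r => ((Real.exp (-r ^ 2) : ℝ) : ℂ) * Pw (r ^ 2) b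
  have hf : ∀ y : Fin m → ℂ, (ENNReal.ofReal (∏ i, gdens (y i))).toReal • Pw (∑ i, ‖y i‖ ^ 2) b
      = ((Real.pi⁻¹ ^ m : ℝ) : ℂ) * f ‖L y‖ := by
    intro y
    have hn : ‖L y‖ ^ 2 = ∑ i, ‖y i‖ ^ 2 := EuclideanSpace.norm_sq_eq _
    rw [ENNReal.toReal_ofReal (Finset.prod_nonneg fun i _ => gdens_nonneg _), prod_gdens]
    simp only [f, hn, Complex.real_smul]
    push_cast
    ring
  have hsm : ∀ r : ℝ, r ^ (m * 2 - 1) • f r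
      = r ^ (m * 2 - 1) • ((Real.exp (-r ^ 2) : ℝ) : ℂ) * Pw (r ^ 2) b := by
    intro r; simp only [f, smul_mul_assoc]
  simp only [hf]
  constructor
  · apply Integrable.const_mul
    have := (hL.integrable_comp_emb hLe (g := fun x => f ‖x‖)).2
      ((integrable_fun_norm_addHaar ν (f := f)).2 (by
        rw [hfr]; simpa only [hsm] using h1))
    exact this
  · rw [integral_const_mul, hL.integral_comp hLe (fun x => f ‖x‖), integral_fun_norm_addHaar ν f, hfr]
    simp only [hsm]
    rw [h2]
    simp only [nsmul_eq_mul, Complex.real_smul]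
    ring

lemma radial (m : ℕ) (hm : 1 ≤ m) (b : ℂ) (hb : 0 ≤ b.re) :
    Integrable (fun y : Fin m → ℂ => Pw (∑ i, ‖y i‖ ^ 2) b) (G m) ∧
    ∫ y, Pw (∑ i, ‖y i‖ ^ 2) b ∂(G m) = Complex.Gamma (m + b) / Complex.Gamma m := by
  obtain ⟨κ, hκ⟩ := radial0 m hm
  refine ⟨(hκ b hb).1, ?_⟩
  rw [(hκ b hb).2]
  have h0 := (hκ 0 le_rfl).2
  have hnull : ∀ᵐ y ∂(G m), Pw (∑ i, ‖y i‖ ^ 2) 0 = 1 := by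
    rw [G_eq]
    apply (withDensity_absolutelyContinuous _ _).ae_le
    have : Nonempty (Fin m) := ⟨⟨0, hm⟩⟩
    have : ∀ᵐ y : Fin m → ℂ, y ≠ 0 := by
      rw [ae_iff]; simp
    filter_upwards [this] with y hy
    have : ∑ i, ‖y i‖ ^ 2 ≠ 0 := by
      intro h
      apply hy
      ext i
      rw [Finset.sum_eq_zero_iff_of_nonneg (fun _ _ => by positivity)] at h
      simpa using h i (Finset.mem_univ i)
    simp [Pw, this]
  rw [integral_congr_ae hnull] at h0
  simp at h0
  have hG : Complex.Gamma m ≠ 0 := by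
    intro h; rw [h] at h0; simp at h0
  field_simp
  rw [mul_right_comm, ← h0, one_mul]

end RMT

namespace RMT

/-- Gram determinant of the rows of `r`. -/
def D {j m : ℕ} (r : Fin j → Fin m → ℂ) : ℝ := (det (Matrix.of r * (Matrix.of r)ᴴ)).re

lemma D_mul {j m : ℕ} (T : Matrix (Fin j) (Fin j) ℂ) (r K : Fin j → Fin m → ℂ)
    (h : Matrix.of r = T * Matrix.of K) : D r = Complex.normSq T.det * D K := by
  unfold D
  have : det (Matrix.of r * (Matrix.of r)ᴴ)
      = (Complex.normSq T.det : ℂ) * det (Matrix.of K * (Matrix.of K)ᴴ) := by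
    rw [h, conjTranspose_mul, ← Complex.mul_conj]
    rw [show T * Matrix.of K * ((Matrix.of K)ᴴ * Tᴴ) = T * (Matrix.of K * (Matrix.of K)ᴴ) * Tᴴ by
      simp only [Matrix.mul_assoc]]
    rw [det_mul, det_mul, det_conjTranspose]
    simp only [Complex.star_def]
    ring
  rw [this, Complex.re_ofReal_mul]

lemma D_unitary {j m : ℕ} {U : Matrix (Fin m) (Fin m) ℂ} (hU : U ∈ Matrix.unitaryGroup (Fin m) ℂ)
    (r : Fin j → Fin m → ℂ) : D (fun i => r i ᵥ* U) = D r := by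
  unfold D
  have h1 : Matrix.of (fun i => r i ᵥ* U) = Matrix.of r * U := by
    ext i c; rfl
  have hU' : U * Uᴴ = 1 := (Matrix.mem_unitaryGroup_iff).1 hU
  rw [h1, conjTranspose_mul, Matrix.mul_assoc, ← Matrix.mul_assoc U, hU', Matrix.one_mul]

lemma det_first_row {j : ℕ} (A : Matrix (Fin (j + 1)) (Fin (j + 1)) ℂ)
    (h : ∀ i : Fin j, A 0 i.succ = 0) : A.det = A 0 0 * (A.submatrix Fin.succ Fin.succ).det := by
  rw [det_succ_row_zero, Fin.sum_univ_succ]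
  simp [h]

lemma D_cons {j m : ℕ} (r : Fin (j + 1) → Fin (m + 1) → ℂ) (h : ∀ p : Fin m, r 0 p.succ = 0) :
    D r = Complex.normSq (r 0 0) * D (fun (i : Fin j) (p : Fin m) => r i.succ p.succ) := by
  let T : Matrix (Fin (j + 1)) (Fin (j + 1)) ℂ :=
    Matrix.of fun i => Fin.cons (r i 0) (fun i' => if i = i'.succ then 1 else 0)
  let K : Fin (j + 1) → Fin (m + 1) → ℂ :=
    Fin.cons (Fin.cons 1 0) (fun i => Fin.cons 0 (fun p => r i.succ p.succ))
  have hT : T.det = r 0 0 := by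
    rw [det_first_row]
    · have : T.submatrix Fin.succ Fin.succ = 1 := by
        ext a b
        simp [T, Matrix.one_apply]
      rw [this]
      simp [T]
    · intro i
      simp [T, (Fin.succ_ne_zero i).symm]
  rw [D_mul T r K ?_, hT]
  · congr 1
    unfold D
    congr 1
    rw [det_first_row]
    · have h1 : (Matrix.of K * (Matrix.of K)ᴴ) 0 0 = 1 := by
        simp [Matrix.mul_apply, Fin.sum_univ_succ, K]
      rw [h1, one_mul]
      congr 1
      ext a b
      simp [Matrix.mul_apply, Fin.sum_univ_succ, K]
    · intro i
      simp [Matrix.mul_apply, Fin.sum_univ_succ, K]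
  · ext i p
    rw [Matrix.mul_apply, Fin.sum_univ_succ]
    refine Fin.cases ?_ (fun i => ?_) i <;> refine Fin.cases ?_ (fun p => ?_) p <;>
      simp [T, K, h, (Fin.succ_ne_zero _).symm]

lemma LQ {l : ℕ} (f : Fin l → Fin l → ℂ) : ∃ U ∈ Matrix.unitaryGroup (Fin l) ℂ,
    ∃ T : Matrix (Fin l) (Fin l) ℂ, (∀ i p, i < p → T i p = 0) ∧ Matrix.of f = T * U := by
  let f' : Fin l → EuclideanSpace ℂ (Fin l) := fun i => WithLp.toLp 2 (f i)
  let b := InnerProductSpace.gramSchmidtOrthonormalBasis (𝕜 := ℂ) (by simp) f'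
  refine ⟨Matrix.of fun p c => b p c, ?_, Matrix.of fun i p => inner ℂ (b p) (f' i), ?_, ?_⟩
  · rw [Matrix.mem_unitaryGroup_iff]
    ext p q
    have := orthonormal_iff_ite.1 b.orthonormal q p
    rw [PiLp.inner_apply] at this
    simp only [Matrix.mul_apply, Matrix.star_apply, Matrix.of_apply, Matrix.one_apply]
    simp only [RCLike.inner_apply, Complex.star_def] at this ⊢
    rw [this]
    simp only [eq_comm]
  · intro i p hip
    exact InnerProductSpace.gramSchmidtOrthonormalBasis_inv_triangular _ f' hip
  · ext i c
    have h1 := b.sum_repr' (f' i)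
    have h2 := congrArg (fun v : EuclideanSpace ℂ (Fin l) => v c) h1
    simp only [Matrix.mul_apply, Matrix.of_apply]
    simpa [f'] using h2.symm

lemma rot1 {m : ℕ} (y : Fin (m + 1) → ℂ) : ∃ V ∈ Matrix.unitaryGroup (Fin (m + 1)) ℂ,
    ∀ p : Fin m, (y ᵥ* V) p.succ = 0 := by
  obtain ⟨U, hU, T, hT, hf⟩ := LQ (fun _ : Fin (m + 1) => y)
  refine ⟨star U, Unitary.star_mem hU, ?_⟩
  intro p
  have h1 : Matrix.of (fun _ : Fin (m + 1) => y) * star U = T := by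
    rw [hf, Matrix.mul_assoc, (Matrix.mem_unitaryGroup_iff).1 hU, Matrix.mul_one]
  have h2 := congrFun (congrFun h1 0) p.succ
  rw [hT _ _ (Fin.succ_pos p)] at h2
  exact h2

lemma sum_castLE {j l : ℕ} (h : j ≤ l) (g : Fin l → ℂ) (hg : ∀ p : Fin l, j ≤ p → g p = 0) :
    ∑ p, g p = ∑ p : Fin j, g (Fin.castLE h p) := by
  symm
  apply Finset.sum_of_injOn (Fin.castLE h)
  · intro a _ b _ hab
    exact Fin.castLE_injective h hab
  · intro a _; simp
  · intro p _ hp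
    apply hg
    by_contra hlt
    push Not at hlt
    exact hp ⟨⟨p, hlt⟩, by simp, rfl⟩
  · intro _ _; rfl

/-- The basic product of powers of leading Gram determinants. -/
def F (n m : ℕ) (a : ℕ → ℂ) (Y : Fin n → Fin m → ℂ) : ℂ :=
  ∏ j : Fin n, Pw (D (fun i : Fin (j + 1) => Y (Fin.castLE j.2 i))) (a j)

lemma D_LQ {n l : ℕ} (hnl : n ≤ l) (Y : Fin n → Fin l → ℂ) :
    ∃ U ∈ Matrix.unitaryGroup (Fin l) ℂ, ∀ (q : ℕ) (K : Matrix (Fin l) (Fin q) ℂ)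
      (j : ℕ) (hj : j ≤ n),
      D (fun i : Fin j => Y (Fin.castLE hj i) ᵥ* K) = D (fun i : Fin j => Y (Fin.castLE hj i)) *
        D (fun i : Fin j => U (Fin.castLE (hj.trans hnl) i) ᵥ* K) := by
  obtain ⟨U, hU, T, hT, hf⟩ := LQ (fun i : Fin l => if h : (i : ℕ) < n then Y ⟨i, h⟩ else 0)
  refine ⟨U, hU, ?_⟩
  have key : ∀ (q : ℕ) (K : Matrix (Fin l) (Fin q) ℂ) (j : ℕ) (hj : j ≤ n),
      D (fun i : Fin j => Y (Fin.castLE hj i) ᵥ* K) =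
        Complex.normSq (T.submatrix (Fin.castLE (hj.trans hnl)) (Fin.castLE (hj.trans hnl))).det *
        D (fun i : Fin j => U (Fin.castLE (hj.trans hnl) i) ᵥ* K) := by
    intro q K j hj
    apply D_mul
    ext i c
    have h1 := congrArg (fun M => (M * K) (Fin.castLE (hj.trans hnl) i) c) hf
    simp only [Matrix.mul_assoc] at h1
    have hi : (i : ℕ) < n := lt_of_lt_of_le i.2 hj
    rw [Matrix.mul_apply (M := T), sum_castLE (hj.trans hnl)] at h1
    · rw [Matrix.mul_apply]
      refine Eq.trans ?_ h1
      simp only [Matrix.mul_apply, Matrix.of_apply, vecMul, dotProduct]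
      apply Finset.sum_congr rfl
      intro x _
      simp only [Fin.val_castLE, hi, dif_pos]
      rfl
    · intro p hp
      rw [hT _ _ (by rw [Fin.lt_def]; simp; omega), zero_mul]
  intro q K j hj
  have h1 := key l 1 j hj
  simp only [vecMul_one] at h1
  have hone : D (fun i : Fin j => U (Fin.castLE (hj.trans hnl) i)) = 1 := by
    unfold D
    have hU' : U * star U = 1 := (Matrix.mem_unitaryGroup_iff).1 hU
    have : Matrix.of (fun i : Fin j => U (Fin.castLE (hj.trans hnl) i)) *
        (Matrix.of (fun i : Fin j => U (Fin.castLE (hj.trans hnl) i)))ᴴ = 1 := by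
      ext a b
      have := congrFun (congrFun hU' (Fin.castLE (hj.trans hnl) a)) (Fin.castLE (hj.trans hnl) b)
      simp only [Matrix.one_apply, (Fin.castLE_injective (hj.trans hnl)).eq_iff] at this ⊢
      exact this
    rw [this]; simp
  rw [hone, mul_one] at h1
  rw [key q K j hj, h1]

lemma F_LQ {n l : ℕ} (hnl : n ≤ l) (Y : Fin n → Fin l → ℂ) :
    ∃ U ∈ Matrix.unitaryGroup (Fin l) ℂ, ∀ (a : ℕ → ℂ) (q : ℕ) (K : Matrix (Fin l) (Fin q) ℂ),
      F n q a (fun i => Y i ᵥ* K) = F n l a Y * F n q a (fun i => U (Fin.castLE hnl i) ᵥ* K) := by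
  obtain ⟨U, hU, h⟩ := D_LQ hnl Y
  refine ⟨U, hU, ?_⟩
  intro a q K
  unfold F
  rw [← Finset.prod_mul_distrib]
  apply Finset.prod_congr rfl
  intro j _
  rw [h q K (j + 1) j.2, Pw_mul]
  rfl

lemma F_unitary {n m : ℕ} {U : Matrix (Fin m) (Fin m) ℂ} (hU : U ∈ Matrix.unitaryGroup (Fin m) ℂ)
    (a : ℕ → ℂ) (Y : Fin n → Fin m → ℂ) : F n m a (fun i => Y i ᵥ* U) = F n m a Y := by
  unfold F
  apply Finset.prod_congr rfl
  intro j _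
  rw [D_unitary hU (fun i : Fin (j + 1) => Y (Fin.castLE j.2 i))]

lemma F_cons {n m : ℕ} (a : ℕ → ℂ) (Y : Fin (n + 1) → Fin (m + 1) → ℂ)
    (h : ∀ p : Fin m, Y 0 p.succ = 0) :
    F (n + 1) (m + 1) a Y = Pw (Complex.normSq (Y 0 0)) (∑ j ∈ Finset.range (n + 1), a j) *
      F n m (fun j => a (j + 1)) (fun i p => Y i.succ p.succ) := by
  have hsum : Pw (Complex.normSq (Y 0 0)) (∑ j ∈ Finset.range (n + 1), a j)
      = ∏ j : Fin (n + 1), Pw (Complex.normSq (Y 0 0)) (a j) := by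
    rw [Fin.prod_univ_eq_prod_range (fun j => Pw (Complex.normSq (Y 0 0)) (a j))]
    have : ∀ n, Pw (Complex.normSq (Y 0 0)) (∑ j ∈ Finset.range (n + 1), a j)
      = ∏ j ∈ Finset.range (n + 1), Pw (Complex.normSq (Y 0 0)) (a j) := by
      intro n
      induction n with
      | zero => simp
      | succ k ih => rw [Finset.sum_range_succ, Finset.prod_range_succ, Pw_add, ih]
    exact this n
  have hD : ∀ j : Fin (n + 1), D (fun i : Fin (j + 1) => Y (Fin.castLE j.2 i)) =
      Complex.normSq (Y 0 0) * D (fun (i : Fin j) (p : Fin m) => Y (Fin.castLE j.2 i.succ) p.succ) := by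
    intro j
    exact D_cons (fun i : Fin (j + 1) => Y (Fin.castLE j.2 i)) h
  rw [hsum]
  unfold F
  simp only [hD, Pw_mul]
  rw [Finset.prod_mul_distrib]
  congr 1
  rw [Fin.prod_univ_succ]
  have : D (fun (i : Fin ((0 : Fin (n + 1)) : ℕ)) (p : Fin m) =>
      Y (Fin.castLE (0 : Fin (n + 1)).2 i.succ) p.succ) = 1 := by
    unfold D
    have : IsEmpty (Fin ((0 : Fin (n + 1)) : ℕ)) := by simp; infer_instance
    rw [det_isEmpty]; rfl
  rw [this, Pw_one, one_mul]
  rfl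

lemma F_norm {n m : ℕ} (a : ℕ → ℂ) (Y : Fin n → Fin m → ℂ) :
    ((‖F n m a Y‖ : ℝ) : ℂ) = F n m (fun j => ((a j).re : ℂ)) Y := by
  unfold F
  rw [norm_prod]
  push_cast
  simp only [Pw_norm]

lemma F_meas {n m : ℕ} (a : ℕ → ℂ) : Measurable (F n m a) := by
  unfold F
  apply Finset.measurable_prod
  intro j _
  apply (Pw_meas _).comp
  unfold D
  apply Complex.measurable_re.comp
  apply Continuous.measurable
  refine Continuous.matrix_det ?_
  refine Continuous.matrix_mul ?_ (Continuous.matrix_conjTranspose ?_) <;>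
  · refine continuous_pi fun i => ?_
    exact continuous_apply _

end RMT

namespace RMT

/-- Gaussian `n × m` matrices. -/
def GM (n m : ℕ) : Measure (Fin n → Fin m → ℂ) := Measure.pi fun _ => G m

instance (n m : ℕ) : IsProbabilityMeasure (GM n m) := by unfold GM; infer_instance

lemma sect {n m : ℕ} (a : ℕ → ℂ) (hI : Integrable (F n m (fun j => a (j + 1))) (GM n m))
    (y : Fin (m + 1) → ℂ) :
    Integrable (fun Y : Fin n → Fin (m + 1) → ℂ => F (n + 1) (m + 1) a (Fin.cons y Y)) (GM n (m + 1)) ∧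
    ∫ Y, F (n + 1) (m + 1) a (Fin.cons y Y) ∂(GM n (m + 1)) =
      Pw (∑ i, ‖y i‖ ^ 2) (∑ j ∈ Finset.range (n + 1), a j) *
        ∫ Y, F n m (fun j => a (j + 1)) Y ∂(GM n m) := by
  obtain ⟨V, hV, hy⟩ := rot1 y
  have hΦ : MeasurePreserving (fun (Y : Fin n → Fin (m + 1) → ℂ) (i : Fin n) (p : Fin m) =>
      (Y i ᵥ* V) p.succ) (GM n (m + 1)) (GM n m) :=
    measurePreserving_pi _ _ fun _ => (G_drop Fin.succ (Fin.succ_injective m)).comp (G_unitary hV)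
  have hn : Complex.normSq ((y ᵥ* V) 0) = ∑ i, ‖y i‖ ^ 2 := by
    rw [← normSq_vecMul hV, Fin.sum_univ_succ]
    simp [hy, Complex.normSq_eq_norm_sq]
  have key : ∀ Y : Fin n → Fin (m + 1) → ℂ, F (n + 1) (m + 1) a (Fin.cons y Y) =
      Pw (∑ i, ‖y i‖ ^ 2) (∑ j ∈ Finset.range (n + 1), a j) *
        F n m (fun j => a (j + 1)) (fun i p => (Y i ᵥ* V) p.succ) := by
    intro Y
    rw [← F_unitary hV, F_cons _ _ (by simpa using hy)]
    simp [hn]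
  simp only [key]
  constructor
  · exact (hΦ.integrable_comp_of_integrable hI).const_mul _
  · rw [integral_const_mul, ← hΦ.map_eq, integral_map hΦ.measurable.aemeasurable
      (F_meas _).aestronglyMeasurable]

lemma W (n : ℕ) : ∀ m, n ≤ m → ∀ a : ℕ → ℂ, (∀ j < n, 0 ≤ (a j).re) →
    Integrable (F n m a) (GM n m) ∧ ∫ Y, F n m a Y ∂(GM n m) =
      ∏ j ∈ Finset.range n, Complex.Gamma (((m - j : ℕ) : ℂ) + ∑ i ∈ Finset.range (n - j), a (j + i)) /
        Complex.Gamma ((m - j : ℕ) : ℂ) := by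
  induction n with
  | zero =>
    intro m _ a _
    have : F 0 m a = fun _ => 1 := by ext Y; simp [F]
    rw [this]
    exact ⟨integrable_const _, by simp⟩
  | succ n ih =>
    intro m' hm a ha
    obtain ⟨m, rfl⟩ : ∃ m, m' = m + 1 := ⟨m' - 1, by omega⟩
    have hre : ∀ a : ℕ → ℂ, (∀ j < n + 1, 0 ≤ (a j).re) →
        0 ≤ (∑ j ∈ Finset.range (n + 1), a j).re := by
      intro a ha
      rw [Complex.re_sum]
      exact Finset.sum_nonneg fun j hj => ha j (Finset.mem_range.1 hj)
    obtain ⟨i1, i2⟩ := ih m (by omega) (fun j => a (j + 1)) (fun j hj => ha (j + 1) (by omega))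
    let ar : ℕ → ℂ := fun j => ((a j).re : ℂ)
    have har : ∀ j < n + 1, 0 ≤ (ar j).re := fun j hj => by simpa [ar] using ha j hj
    obtain ⟨r1, r2⟩ := ih m (by omega) (fun j => ar (j + 1)) (fun j hj => har (j + 1) (by omega))
    have hs := sect a i1
    have hr := sect ar r1
    obtain ⟨R1, R2⟩ := radial (m + 1) (by omega) _ (hre a ha)
    obtain ⟨S1, S2⟩ := radial (m + 1) (by omega) _ (hre ar har)
    let e := MeasurableEquiv.piFinSuccAbove (fun _ : Fin (n + 1) => Fin (m + 1) → ℂ) 0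
    have he : MeasurePreserving e (GM (n + 1) (m + 1)) ((G (m + 1)).prod (GM n (m + 1))) :=
      measurePreserving_piFinSuccAbove (fun _ => G (m + 1)) 0
    let f : (Fin (m + 1) → ℂ) × (Fin n → Fin (m + 1) → ℂ) → ℂ :=
      fun x => F (n + 1) (m + 1) a (Fin.cons x.1 x.2)
    have hfe : ∀ Y, f (e Y) = F (n + 1) (m + 1) a Y := by
      intro Y
      change F (n + 1) (m + 1) a (Fin.cons (Y 0) (Fin.tail Y)) = _
      rw [Fin.cons_self_tail]
    have hfm : Measurable f := by
      have : f = fun x => F (n + 1) (m + 1) a (e.symm x) := by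
        ext x
        rw [← hfe, MeasurableEquiv.apply_symm_apply]
      rw [this]
      exact (F_meas _).comp e.symm.measurable
    have hfI : Integrable f ((G (m + 1)).prod (GM n (m + 1))) := by
      rw [integrable_prod_iff hfm.aestronglyMeasurable]
      refine ⟨ae_of_all _ fun y => (hs y).1, ?_⟩
      have : ∀ y, ∫ Y, ‖f (y, Y)‖ ∂(GM n (m + 1)) =
          (Pw (∑ i, ‖y i‖ ^ 2) (∑ j ∈ Finset.range (n + 1), ar j) *
            ∫ Y, F n m (fun j => ar (j + 1)) Y ∂(GM n m)).re := by
        intro y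
        rw [← (hr y).2, ← Complex.ofReal_re (∫ Y, ‖f (y, Y)‖ ∂(GM n (m + 1))), ← integral_complex_ofReal]
        simp only [f, F_norm]
        rfl
      simp only [this]
      exact (S1.mul_const _).re
    constructor
    · have := (he.integrable_comp_emb e.measurableEmbedding (g := f)).2 hfI
      refine this.congr (ae_of_all _ fun Y => hfe Y)
    · calc ∫ Y, F (n + 1) (m + 1) a Y ∂(GM (n + 1) (m + 1))
          = ∫ Y, f (e Y) ∂(GM (n + 1) (m + 1)) := by simp only [hfe]
        _ = ∫ x, f x ∂((G (m + 1)).prod (GM n (m + 1))) := he.integral_comp' f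
        _ = ∫ y, ∫ Y, f (y, Y) ∂(GM n (m + 1)) ∂(G (m + 1)) := integral_prod _ hfI
        _ = _ := by
          simp only [f, (hs _).2]
          rw [integral_mul_const, R2, i2, Finset.prod_range_succ', mul_comm]
          congr 1
          · apply Finset.prod_congr rfl
            intro j _
            have e1 : m + 1 - (j + 1) = m - j := by omega
            have e2 : n + 1 - (j + 1) = n - j := by omega
            rw [e1, e2]
            congr 3
            apply Finset.sum_congr rfl
            intro i _
            congr 1
            omega
          · simp

end RMT

namespace RMT

lemma pminor_eq_s2 {l n : ℕ} (hnl : n ≤ l) (k : Matrix (Fin l) (Fin l) ℂ) (j : ℕ) (hj : j ≤ l) :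
    pminor (k * projMat l n * kᴴ) j =
      D (fun (i : Fin j) (c : Fin n) => k (Fin.castLE hj i) (Fin.castLE hnl c)) := by
  unfold pminor D
  congr 1
  rw [← det_submatrix_equiv_self (finCongr (min_eq_left hj))]
  congr 1
  ext p q
  simp only [Matrix.of_apply, Matrix.submatrix_apply]
  rw [Matrix.mul_apply, sum_castLE hnl, Matrix.mul_apply]
  · apply Finset.sum_congr rfl
    intro c _
    simp only [projMat, Matrix.mul_diagonal]
    simp
    rfl
  · intro c hc
    simp only [projMat, Matrix.mul_diagonal]
    simp [hc]

lemma absProd_eq {l n : ℕ} (hnl : n ≤ l) (s : ℕ → ℂ) (k : Matrix (Fin l) (Fin l) ℂ) :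
    absProd n s (k * projMat l n * kᴴ) = F n n (fun j => s j - sNext n s j - 1)
      (fun i c => k (Fin.castLE hnl i) (Fin.castLE hnl c)) := by
  unfold absProd F
  rw [← Fin.prod_univ_eq_prod_range (fun j => if pminor (k * projMat l n * kᴴ) (j + 1) = 0 then 0
    else (((|pminor (k * projMat l n * kᴴ) (j + 1)| : ℝ) : ℂ) ^ (s j - sNext n s j - 1)))]
  apply Finset.prod_congr rfl
  intro j _
  rw [pminor_eq_s2 hnl k (j + 1) (by have := j.2; omega)]
  rfl

lemma main_id {l n : ℕ} (hnl : n ≤ l) (a : ℕ → ℂ) (ha : ∀ j < n, 0 ≤ (a j).re)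
    (μ : Measure (Matrix (Fin l) (Fin l) ℂ)) (hμ : IsHaarUnitary l μ) :
    ∫ Y, F n n a Y ∂(GM n n) = (∫ Y, F n l a Y ∂(GM n l)) *
      ∫ k, F n n a (fun i c => k (Fin.castLE hnl i) (Fin.castLE hnl c)) ∂μ := by
  obtain ⟨hp, hsupp, hinv⟩ := hμ
  have hae : ∀ᵐ k ∂μ, k ∈ Matrix.unitaryGroup (Fin l) ℂ := by
    rw [ae_iff]; exact hsupp
  let κ : Matrix (Fin l) (Fin l) ℂ → Matrix (Fin l) (Fin n) ℂ :=
    fun k => k.submatrix id (Fin.castLE hnl)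
  have hentry : ∀ p c, Measurable fun k : Matrix (Fin l) (Fin l) ℂ => k p c := fun p c =>
    (measurable_pi_apply c).comp (measurable_pi_apply (X := fun _ => Fin l → ℂ) p)
  -- matrices indexed by `(Y, k)`
  let f : (ℕ → ℂ) → (Fin n → Fin l → ℂ) × Matrix (Fin l) (Fin l) ℂ → ℂ :=
    fun a x => F n n a (fun i => x.1 i ᵥ* κ x.2)
  have hfm : ∀ a, Measurable (f a) := by
    intro a
    apply (F_meas a).comp
    refine measurable_pi_iff.2 fun i => measurable_pi_iff.2 fun c => ?_
    simp only [vecMul, dotProduct, κ, Matrix.submatrix_apply, id]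
    refine Finset.measurable_sum _ fun p _ => ?_
    refine Measurable.mul ?_ ((hentry _ _).comp measurable_snd)
    exact (measurable_pi_apply p).comp ((measurable_pi_apply i).comp measurable_fst)
  have hMP : ∀ k ∈ Matrix.unitaryGroup (Fin l) ℂ, MeasurePreserving
      (fun (Y : Fin n → Fin l → ℂ) (i : Fin n) => Y i ᵥ* κ k) (GM n l) (GM n n) := by
    intro k hk
    exact measurePreserving_pi _ _ fun _ =>
      (G_drop (Fin.castLE hnl) (Fin.castLE_injective hnl)).comp (G_unitary hk)
  have hsec : ∀ a : ℕ → ℂ, (∀ j < n, 0 ≤ (a j).re) → ∀ k ∈ Matrix.unitaryGroup (Fin l) ℂ,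
      Integrable (fun Y => f a (Y, k)) (GM n l) ∧
      ∫ Y, f a (Y, k) ∂(GM n l) = ∫ Y, F n n a Y ∂(GM n n) := by
    intro a ha k hk
    refine ⟨(hMP k hk).integrable_comp_of_integrable (W n n le_rfl a ha).1, ?_⟩
    rw [← (hMP k hk).map_eq, integral_map (hMP k hk).measurable.aemeasurable
      (F_meas _).aestronglyMeasurable]
  have hI : Integrable (f a) ((GM n l).prod μ) := by
    rw [integrable_prod_iff' (hfm a).aestronglyMeasurable]
    refine ⟨hae.mono fun k hk => (hsec a ha k hk).1, ?_⟩
    let ar : ℕ → ℂ := fun j => ((a j).re : ℂ)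
    have har : ∀ j < n, 0 ≤ (ar j).re := fun j hj => by simpa [ar] using ha j hj
    refine (integrable_const (∫ Y, F n n ar Y ∂(GM n n)).re).congr ?_
    filter_upwards [hae] with k hk
    rw [← (hsec ar har k hk).2, ← Complex.ofReal_re (∫ Y, ‖f a (Y, k)‖ ∂(GM n l)),
      ← integral_complex_ofReal]
    simp only [f, F_norm]
    rfl
  have hswap := integral_integral_swap (f := fun Y k => f a (Y, k)) hI
  have hR : ∫ k, ∫ Y, f a (Y, k) ∂(GM n l) ∂μ = ∫ Y, F n n a Y ∂(GM n n) := by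
    rw [integral_congr_ae (hae.mono fun k hk => (hsec a ha k hk).2)]
    simp
  have hLft : ∀ Y, ∫ k, f a (Y, k) ∂μ = F n l a Y *
      ∫ k, F n n a (fun i c => k (Fin.castLE hnl i) (Fin.castLE hnl c)) ∂μ := by
    intro Y
    obtain ⟨U, hU, h⟩ := F_LQ hnl Y
    simp only [f, h]
    rw [integral_const_mul]
    congr 1
    have hUm : Measurable fun A : Matrix (Fin l) (Fin l) ℂ => U * A := by
      refine measurable_pi_iff.2 fun i => measurable_pi_iff.2 fun c => ?_
      simp only [Matrix.mul_apply]
      exact Finset.measurable_sum _ fun p _ => (hentry _ _).const_mul _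
    conv_rhs => rw [← hinv U hU]
    rw [integral_map hUm.aemeasurable]
    · rfl
    · apply Measurable.aestronglyMeasurable
      apply (F_meas a).comp
      exact measurable_pi_iff.2 fun i => measurable_pi_iff.2 fun c => hentry _ _
  rw [← hR, ← hswap]
  simp only [hLft]
  rw [integral_mul_const]

lemma tele (n : ℕ) (s : ℕ → ℂ) (r : ℕ) : ∀ j, j + r = n →
    ∑ i ∈ Finset.range r, (s (j + i) - sNext n s (j + i) - 1) =
      (if j < n then s j else -1) + 1 - (r : ℂ) := by
  induction r with
  | zero => intro j hj; simp [show ¬ j < n by omega]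
  | succ r ih =>
    intro j hj
    rw [Finset.sum_range_succ']
    have h1 := ih (j + 1) (by omega)
    have e : ∀ i, j + (i + 1) = j + 1 + i := fun i => by omega
    have h2 : ∑ i ∈ Finset.range r, (s (j + (i + 1)) - sNext n s (j + (i + 1)) - 1) =
        ∑ i ∈ Finset.range r, (s (j + 1 + i) - sNext n s (j + 1 + i) - 1) :=
      Finset.sum_congr rfl fun i _ => by rw [e i]
    rw [h2, h1]
    simp only [sNext, add_zero, show j < n by omega, if_true]
    push_cast
    ring

/-- Evaluation of the normalization constant `C_{l,n}(s)`. -/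
theorem statement2 (l n : ℕ) (hn : 1 ≤ n) (hln : n ≤ l)
    (s : ℕ → ℂ) (hs : ∀ j < n, 1 ≤ (s j - sNext n s j).re)
    (μ : Measure (Matrix (Fin l) (Fin l) ℂ)) (hμ : IsHaarUnitary l μ) :
    Csph l n μ s =
      ∏ j ∈ Finset.range n,
        ((Nat.factorial (l - (j + 1)) : ℂ) * Complex.Gamma (s j + 1)) /
          ((Nat.factorial (n - (j + 1)) : ℂ) * Complex.Gamma (s j + (l - n : ℕ) + 1)) := by
  unfold Csph
  simp only [absProd_eq hln]
  set a : ℕ → ℂ := fun j => s j - sNext n s j - 1 with hadef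
  have ha : ∀ j < n, 0 ≤ (a j).re := by
    intro j hj
    have := hs j hj
    simp only [hadef, Complex.sub_re, Complex.one_re] at this ⊢
    linarith
  have hmain := main_id hln a ha μ hμ
  have hb : ∀ j ∈ Finset.range n, ∑ i ∈ Finset.range (n - j), a (j + i)
      = s j + 1 - ((n - j : ℕ) : ℂ) := by
    intro j hj
    have hj' := Finset.mem_range.1 hj
    have := tele n s (n - j) j (by omega)
    rw [if_pos hj'] at this
    exact this
  have hW : ∀ m, n ≤ m → ∫ Y, F n m a Y ∂(GM n m) = ∏ j ∈ Finset.range n,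
      Complex.Gamma (s j + (m - n : ℕ) + 1) / (Nat.factorial (m - (j + 1)) : ℂ) := by
    intro m hm
    rw [(W n m hm a ha).2]
    apply Finset.prod_congr rfl
    intro j hj
    have hj' := Finset.mem_range.1 hj
    rw [hb j hj]
    congr 1
    · congr 1
      rw [Nat.cast_sub (by omega), Nat.cast_sub (by omega), Nat.cast_sub hm]
      ring
    · rw [show m - j = (m - (j + 1)) + 1 by omega]
      push_cast
      exact Complex.Gamma_nat_eq_factorial _
  have hne : ∀ j ∈ Finset.range n,
      Complex.Gamma (s j + (l - n : ℕ) + 1) / (Nat.factorial (l - (j + 1)) : ℂ) ≠ 0 := by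
    intro j hj
    have hj' := Finset.mem_range.1 hj
    apply div_ne_zero
    · apply Complex.Gamma_ne_zero_of_re_pos
      have h1 := congrArg Complex.re (hb j hj)
      have h2 : 0 ≤ (∑ i ∈ Finset.range (n - j), a (j + i)).re := by
        rw [Complex.re_sum]
        exact Finset.sum_nonneg fun i hi => ha _ (by have := Finset.mem_range.1 hi; omega)
      have h3 : (1 : ℝ) ≤ ((n - j : ℕ) : ℝ) := by exact_mod_cast (by omega : 1 ≤ n - j)
      have h4 : (0 : ℝ) ≤ ((l - n : ℕ) : ℝ) := Nat.cast_nonneg _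
      rw [h1] at h2
      simp only [Complex.add_re, Complex.sub_re, Complex.one_re, Complex.natCast_re] at h2 ⊢
      linarith
    · exact_mod_cast Nat.factorial_ne_zero _
  rw [hW n le_rfl, hW l hln] at hmain
  have hne' := Finset.prod_ne_zero_iff.2 hne
  apply mul_left_cancel₀ hne'
  rw [← hmain, ← Finset.prod_mul_distrib]
  apply Finset.prod_congr rfl
  intro j hj
  have h1 := hne j hj
  have h2 : (Nat.factorial (l - (j + 1)) : ℂ) ≠ 0 := by exact_mod_cast Nat.factorial_ne_zero _
  have h3 : Complex.Gamma (s j + (l - n : ℕ) + 1) ≠ 0 := fun h => h1 (by rw [h, zero_div])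
  have h4 : (Nat.factorial (n - (j + 1)) : ℂ) ≠ 0 := by exact_mod_cast Nat.factorial_ne_zero _
  simp only [Nat.sub_self, Nat.cast_zero, add_zero]
  field_simp

end RMT
end
end
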